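/- arXiv:math/0306045 — 3 statements merged into one kernel-verified Lean document; each statement's English description precedes it below -/
import Mathlib

section
/- Let X be a weakly irreducible, critical multitype Galton-Watson tree with all exponential moments of the offspring law finite, let 𝒞 be the space of bounded functions on 𝒳 × 𝒳*, U_g(a) = log ∑_c 𝒬{c|a} e^{g(a,c)}, and Ĵ(ν) = sup_{g∈𝒞} ∫ [g(b,c) − ∑_{j=1}^{n} U_g(a_j)] ν(db, dc), writing c = (n, a₁,…,a_n). Then for every closed set F ⊆ ℳ(𝒳 × 𝒳*), limsup_{n→∞} (1/n) log P{M_X ∈ F | |T| = n} ≤ −inf_{ν∈F} Ĵ(ν). -/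
open scoped ENNReal NNReal BigOperators
open Filter

/-- Finite rooted planar trees with vertex types in `𝒳`. -/
inductive PTree (𝒳 : Type*) where
  | node : 𝒳 → List (PTree 𝒳) → PTree 𝒳

namespace PTree

variable {𝒳 : Type*}

/-- The type of the root. -/
def root : PTree 𝒳 → 𝒳
  | node a _ => a

/-- The list of subtrees rooted at the children of the root (left to right). -/
def children : PTree 𝒳 → List (PTree 𝒳)
  | node _ ts => ts

/-- The types of the children of the root, from left to right. -/
def childLabels (t : PTree 𝒳) : List 𝒳 := t.children.map root

/-- The list of all subtrees `X^v`, `v` a vertex of the tree. -/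
def subtrees : PTree 𝒳 → List (PTree 𝒳)
  | node a ts => node a ts :: (ts.attach.map (fun s => subtrees s.1)).flatten
decreasing_by
  have := List.sizeOf_lt_of_mem s.2
  simp only [PTree.node.sizeOf_spec]
  omega

/-- Number of vertices. -/
def size (t : PTree 𝒳) : ℕ := t.subtrees.length

/-- The vertices at depth exactly `k`, as subtrees, from left to right. -/
def atDepth : ℕ → PTree 𝒳 → List (PTree 𝒳)
  | 0, t => [t]
  | (k+1), node _ ts => (ts.attach.map (fun s => atDepth k s.1)).flatten

/-- Truncation of a tree at height `k` (keeping the generations `0,…,k`). -/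
def trunc : ℕ → PTree 𝒳 → PTree 𝒳
  | 0, node a _ => node a []
  | (k+1), node a ts => node a (ts.attach.map (fun s => trunc k s.1))

/-- The height of a tree (largest `k` such that generation `k` is nonempty). -/
def height : PTree 𝒳 → ℕ
  | node _ [] => 0
  | node _ (t :: ts) => ((t :: ts).attach.map (fun s => height s.1)).foldr max 0 + 1
decreasing_by
  have := List.sizeOf_lt_of_mem s.2
  simp only [PTree.node.sizeOf_spec] at *
  omega

/-- The largest offspring number in the tree. -/
def maxDeg : PTree 𝒳 → ℕ
  | node _ ts => max ts.length (((ts.attach.map (fun s => maxDeg s.1)).foldr max 0))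
decreasing_by
  have := List.sizeOf_lt_of_mem s.2
  simp only [PTree.node.sizeOf_spec] at *
  omega

end PTree
noncomputable instance {𝒳 : Type*} : DecidableEq (PTree 𝒳) := Classical.decEq _

/-- Extended-real logarithm of an extended nonnegative real. -/
noncomputable def elog (x : ℝ≥0∞) : EReal :=
  if x = 0 then ⊥ else if x = ∞ then ⊤ else ((Real.log x.toReal : ℝ) : EReal)

open Classical in
/-- Relative entropy `H(ν ‖ ρ)` of two (probability) vectors on a countable set,
with value `∞` if `ν` is not absolutely continuous with respect to `ρ`.  (For
probability vectors each summand below is nonnegative and the sum equals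
`∑ ν a log (ν a / ρ a)`.) -/
noncomputable def relEnt {α : Type*} (ν ρ : α → ℝ) : ℝ≥0∞ :=
  if ∀ a, ρ a = 0 → ν a = 0 then
    ∑' a, ENNReal.ofReal (ν a * Real.log (ν a / ρ a) + ρ a - ν a)
  else ∞

/-- The Cramér rate function `I_p(x) = sup_λ {λx - log ∑ p(n) e^{λn}}`. -/
noncomputable def cramerRate (p : ℕ → ℝ) (x : ℝ) : EReal :=
  ⨆ lam : ℝ, ((lam * x - Real.log (∑' n : ℕ, p n * Real.exp (lam * n)) : ℝ) : EReal)

/-- Total mass `P{|T| = n}` assigned by the weight `w` to trees with `n` vertices. -/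
noncomputable def treeMass {𝒳 : Type*} (w : PTree 𝒳 → ℝ) (n : ℕ) : ℝ≥0∞ :=
  ∑' t : PTree 𝒳, if t.size = n then ENNReal.ofReal (w t) else 0

open Classical in
/-- Conditional probability of the event `E` given `{|T| = n}`, for the (sub)probability
weight `w` on finite planar trees.  -/
noncomputable def condP {𝒳 : Type*} (w : PTree 𝒳 → ℝ) (n : ℕ) (E : Set (PTree 𝒳)) : ℝ≥0∞ :=
  (∑' t : PTree 𝒳, if t.size = n ∧ t ∈ E then ENNReal.ofReal (w t) else 0) / treeMass w n

/-- The set of sizes having positive probability. -/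
noncomputable def sizeSupport {𝒳 : Type*} (w : PTree 𝒳 → ℝ) : Set ℕ := {n | 0 < treeMass w n}
section Multitype

variable {𝒳 : Type*} [Fintype 𝒳] [DecidableEq 𝒳]

/-- The weight of a typed tree under the multitype Galton-Watson law with initial
distribution `μ0` and offspring kernel `𝒬` (an offspring `c ∈ 𝒳*` is recorded as the
list of types of the children from left to right):
`μ0(root) ∏_v 𝒬{C(v) | type v}`. -/
noncomputable def mgwWeight (μ0 : 𝒳 → ℝ) (𝒬 : 𝒳 → List 𝒳 → ℝ) (t : PTree 𝒳) : ℝ :=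
  μ0 t.root * (t.subtrees.map (fun s => 𝒬 s.root s.childLabels)).prod

/-- The multiplicity `m(a,c)` of the symbol `a` in `c ∈ 𝒳*`. -/
def mult (a : 𝒳) (c : List 𝒳) : ℕ := c.count a

/-- The empirical offspring measure `M_X` of a typed tree. -/
noncomputable def empOff (t : PTree 𝒳) : 𝒳 × List 𝒳 → ℝ := fun x =>
  ((t.subtrees.filter (fun s => s.root = x.1 ∧ s.childLabels = x.2)).length : ℝ) / t.size

/-- The `𝒳`-marginal `ν₁` of a measure on `𝒳 × 𝒳*`. -/
noncomputable def marg1 (ν : 𝒳 × List 𝒳 → ℝ) (a : 𝒳) : ℝ := ∑' c : List 𝒳, ν (a, c)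

/-- Shift-invariance: `ν₁(a) = ∑_{(b,c)} m(a,c) ν(b,c)` for all `a`. -/
def ShiftInv (ν : 𝒳 × List 𝒳 → ℝ) : Prop :=
  ∀ a : 𝒳, marg1 ν a = ∑' x : 𝒳 × List 𝒳, (mult a x.2 : ℝ) * ν x

/-- Membership in `ℳ(𝒳 × 𝒳*)`: a probability measure with finite mean offspring
number. -/
structure IsOffMeasure (ν : 𝒳 × List 𝒳 → ℝ) : Prop where
  nonneg : ∀ x, 0 ≤ ν x
  hasSum : HasSum ν 1
  moment : Summable (fun x : 𝒳 × List 𝒳 => (x.2.length : ℝ) * ν x)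

/-- The space `ℳ(𝒳 × 𝒳*)`. -/
def MSpace (𝒳 : Type*) [Fintype 𝒳] [DecidableEq 𝒳] :=
  {ν : 𝒳 × List 𝒳 → ℝ // IsOffMeasure ν}

/-- The test functions defining the topology of `ℳ(𝒳 × 𝒳*)`: all bounded functions
together with the functions `(b,c) ↦ m(a,c) 𝟙_{b₀}(b)`, `a, b₀ ∈ 𝒳`. -/
def offTests (𝒳 : Type*) [Fintype 𝒳] [DecidableEq 𝒳] : Set ((𝒳 × List 𝒳) → ℝ) :=
  {f | ∃ M : ℝ, ∀ x, |f x| ≤ M} ∪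
    {f | ∃ a b₀ : 𝒳, f = fun x => (mult a x.2 : ℝ) * (if x.1 = b₀ then 1 else 0)}

/-- The topology of `ℳ(𝒳 × 𝒳*)`: the smallest topology making `ν ↦ ∫ f dν`
continuous for every test function `f`. -/
noncomputable instance : TopologicalSpace (MSpace 𝒳) :=
  TopologicalSpace.induced
    (fun ν : MSpace 𝒳 => fun f : offTests 𝒳 => ∑' x, ν.1 x * f.1 x) Pi.topologicalSpace

open Classical in
/-- The rate function `J(ν) = H(ν ‖ ν₁ ⊗ 𝒬)` for shift-invariant `ν`, `∞` otherwise. -/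
noncomputable def offRate (𝒬 : 𝒳 → List 𝒳 → ℝ) (ν : 𝒳 × List 𝒳 → ℝ) : ℝ≥0∞ :=
  if ShiftInv ν then relEnt ν (fun x => marg1 ν x.1 * 𝒬 x.1 x.2) else ∞

/-- The expected offspring matrix `A(a,b) = ∑_c 𝒬{c | b} m(a,c)` (with values in
`[0,∞]`). -/
noncomputable def meanMat (𝒬 : 𝒳 → List 𝒳 → ℝ) : Matrix 𝒳 𝒳 ℝ≥0∞ :=
  Matrix.of fun a b => ∑' c : List 𝒳, ENNReal.ofReal (𝒬 b c) * (mult a c : ℝ≥0∞)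

/-- `A* = ∑_{k ≥ 1} A^k`. -/
noncomputable def matStar (A : Matrix 𝒳 𝒳 ℝ≥0∞) : Matrix 𝒳 𝒳 ℝ≥0∞ :=
  Matrix.of fun a b => ∑' k : ℕ, (A ^ (k + 1)) a b

/-- Weak irreducibility of a nonnegative matrix with respect to a partition of `𝒳`
into recurrent states `Xr` and transient states `Xt`. -/
structure WeaklyIrred (A : Matrix 𝒳 𝒳 ℝ≥0∞) (Xr Xt : Finset 𝒳) : Prop where
  compl : ∀ a, a ∈ Xr ↔ a ∉ Xt
  npty : Xr.Nonempty
  rec_pos : ∀ a b, b ∈ Xr → 0 < matStar A a b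
  trans_zero : ∀ a b, b ∈ Xt → a = b ∨ a ∈ Xr → matStar A a b = 0

/-- The real expected offspring matrix. -/
noncomputable def meanMatR (𝒬 : 𝒳 → List 𝒳 → ℝ) : Matrix 𝒳 𝒳 ℝ :=
  Matrix.of fun a b => ∑' c : List 𝒳, 𝒬 b c * (mult a c : ℝ)

/-- Criticality: the Perron-Frobenius eigenvalue of the expected offspring matrix is
`1`; equivalently (for weakly irreducible matrices) there is a strictly positive right
eigenvector with eigenvalue `1`. -/
def CriticalKernel (𝒬 : 𝒳 → List 𝒳 → ℝ) : Prop :=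
  ∃ u : 𝒳 → ℝ, (∀ a, 0 < u a) ∧ ∀ a, ∑ b, meanMatR 𝒬 a b * u b = u a

/-- The uniform bound on the number of transient offspring. -/
def BoundedTransient (𝒬 : 𝒳 → List 𝒳 → ℝ) (Xt : Finset 𝒳) : Prop :=
  ∃ B : ℕ, ∀ b c, 𝒬 b c ≠ 0 → c.countP (fun a => decide (a ∈ Xt)) ≤ B

end Multitype
section Variational

variable {𝒳 : Type*} [Fintype 𝒳] [DecidableEq 𝒳]

/-- `U_g(a) = log ∑_c 𝒬{c|a} e^{g(a,c)}`. -/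
noncomputable def Ug (𝒬 : 𝒳 → List 𝒳 → ℝ) (g : 𝒳 × List 𝒳 → ℝ) (a : 𝒳) : ℝ :=
  Real.log (∑' c : List 𝒳, 𝒬 a c * Real.exp (g (a, c)))

/-- The variational functional
`Ĵ(ν) = sup_{g bounded} ∫ [g(b,c) − ∑_{j=1}^n U_g(a_j)] ν(db,dc)`,
where `c = (n, a₁, …, a_n)`. -/
noncomputable def offRateVar (𝒬 : 𝒳 → List 𝒳 → ℝ) (ν : 𝒳 × List 𝒳 → ℝ) : EReal :=
  ⨆ g : {g : 𝒳 × List 𝒳 → ℝ // ∃ M : ℝ, ∀ x, |g x| ≤ M},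
    ((∑' x : 𝒳 × List 𝒳, ν x * (g.1 x - (x.2.map (Ug 𝒬 g.1)).sum) : ℝ) : EReal)

end Variational
section ForestSums

namespace PTree

variable {𝒳 : Type*}

theorem subtrees_node (a : 𝒳) (ts : List (PTree 𝒳)) :
    (node a ts).subtrees = node a ts :: (ts.map subtrees).flatten := by
  rw [subtrees]
  simp only [List.map_attach_eq_pmap, List.pmap_eq_map]

theorem induction_node {P : PTree 𝒳 → Prop}
    (h : ∀ a ts, (∀ t ∈ ts, P t) → P (node a ts)) : ∀ t, P t
  | node a ts => h a ts fun t _ => induction_node h t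
decreasing_by
  have := List.sizeOf_lt_of_mem ‹t ∈ ts›
  simp only [PTree.node.sizeOf_spec]
  omega

theorem size_node (a : 𝒳) (ts : List (PTree 𝒳)) :
    (node a ts).size = 1 + (ts.map size).sum := by
  simp only [size, subtrees_node, List.length_cons, List.length_flatten, List.map_map]
  rw [add_comm]
  rfl

theorem size_pos (t : PTree 𝒳) : 0 < t.size := by
  cases t
  rw [size_node]
  omega

/-- A tree is its root type together with the list of subtrees of the root. -/
def equivProd : 𝒳 × List (PTree 𝒳) ≃ PTree 𝒳 where
  toFun p := node p.1 p.2
  invFun t := (t.root, t.children)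
  left_inv _ := rfl
  right_inv t := by cases t; rfl

theorem tsum_eq (f : PTree 𝒳 → ℝ≥0∞) : ∑' t, f t = ∑' a, ∑' ts, f (node a ts) := by
  rw [← equivProd.tsum_eq f, ← ENNReal.tsum_prod]
  rfl

end PTree

theorem ENNReal.tsum_list_eq {α : Type*} (f : List α → ℝ≥0∞) :
    ∑' l, f l = f [] + ∑' a, ∑' l, f (a :: l) := by
  classical
  rw [tsum_eq_add_tsum_ite [], ← ENNReal.tsum_prod]
  congr 1
  have hinj : Function.Injective fun p : α × List α => p.1 :: p.2 := by
    rintro ⟨a, l⟩ ⟨b, m⟩ h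
    simpa using h
  rw [← hinj.tsum_eq]
  · simp
  · intro l hl
    cases l with
    | nil => simp at hl
    | cons a l => exact ⟨(a, l), rfl⟩

variable {𝒳 : Type*}

/-- The weight `∏_v q{C(v) | X(v)}` of a tree. -/
noncomputable def offWeight (q : 𝒳 → List 𝒳 → ℝ≥0∞) (t : PTree 𝒳) : ℝ≥0∞ :=
  (t.subtrees.map fun s => q s.root s.childLabels).prod

theorem offWeight_node (q : 𝒳 → List 𝒳 → ℝ≥0∞) (a : 𝒳) (ts : List (PTree 𝒳)) :
    offWeight q (.node a ts) = q a (ts.map PTree.root) * (ts.map (offWeight q)).prod := by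
  simp only [offWeight, PTree.subtrees_node, List.map_cons, List.prod_cons, List.map_flatten,
    List.prod_flatten, List.map_map]
  rfl

/-- The weight of a tree, restricted to trees of height less than `k`. -/
noncomputable def offWeightLT (q : 𝒳 → List 𝒳 → ℝ≥0∞) : ℕ → PTree 𝒳 → ℝ≥0∞
  | 0, _ => 0
  | k + 1, .node a ts => q a (ts.map PTree.root) * (ts.map (offWeightLT q k)).prod

theorem exists_offWeightLT_eq (q : 𝒳 → List 𝒳 → ℝ≥0∞) (t : PTree 𝒳) :
    ∃ k, ∀ j, k ≤ j → offWeightLT q j t = offWeight q t := by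
  induction t using PTree.induction_node with
  | h a ts ih =>
    choose! f hf using ih
    refine ⟨(ts.map f).sum + 1, fun j hj => ?_⟩
    obtain ⟨j, rfl⟩ : ∃ i, j = i + 1 := ⟨j - 1, by omega⟩
    rw [offWeight_node, offWeightLT]
    congr 2
    refine List.map_congr_left fun t ht => hf t ht j ?_
    have := List.single_le_sum (l := ts.map f) (by simp) _ (List.mem_map_of_mem ht)
    omega

variable [DecidableEq 𝒳]

/-- Total mass of the trees with root type `a` under the weight `w`. -/
noncomputable def rootMass (w : PTree 𝒳 → ℝ≥0∞) (a : 𝒳) : ℝ≥0∞ :=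
  ∑' t : PTree 𝒳, if t.root = a then w t else 0

theorem tsum_forest_labels (w : PTree 𝒳 → ℝ≥0∞) (c : List 𝒳) :
    ∑' ts : List (PTree 𝒳), (if ts.map PTree.root = c then (ts.map w).prod else 0)
      = (c.map (rootMass w)).prod := by
  induction c with
  | nil =>
    rw [ENNReal.tsum_list_eq]
    simp
  | cons a c ih =>
    rw [ENNReal.tsum_list_eq]
    simp only [List.map_nil, List.nil_eq, reduceCtorEq, if_false, zero_add, List.map_cons,
      List.cons.injEq, List.prod_cons]
    rw [← ih, rootMass, ← ENNReal.tsum_mul_right]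
    refine tsum_congr fun t => ?_
    rw [← ENNReal.tsum_mul_left]
    refine tsum_congr fun ts => ?_
    by_cases h1 : t.root = a <;> by_cases h2 : ts.map PTree.root = c <;> simp [h1, h2]

theorem tsum_forest (w : PTree 𝒳 → ℝ≥0∞) (g : List 𝒳 → ℝ≥0∞) :
    ∑' ts : List (PTree 𝒳), g (ts.map PTree.root) * (ts.map w).prod
      = ∑' c, g c * (c.map (rootMass w)).prod := by
  simp_rw [← tsum_forest_labels, ← ENNReal.tsum_mul_left]
  rw [ENNReal.tsum_comm]
  refine tsum_congr fun ts => ?_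
  rw [tsum_eq_single (ts.map PTree.root)]
  · simp
  · intro c hc
    simp [hc.symm]

theorem rootMass_offWeight (q : 𝒳 → List 𝒳 → ℝ≥0∞) (a : 𝒳) :
    rootMass (offWeight q) a = ∑' c, q a c * (c.map (rootMass (offWeight q))).prod := by
  rw [rootMass, PTree.tsum_eq, tsum_eq_single a]
  · simp only [PTree.root, if_true, offWeight_node]
    exact tsum_forest _ _
  · intro b hb
    simp [PTree.root, hb]

theorem rootMass_offWeightLT_le_one {q : 𝒳 → List 𝒳 → ℝ≥0∞} (hq : ∀ a, ∑' c, q a c ≤ 1) (k : ℕ)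
    (a : 𝒳) : rootMass (offWeightLT q k) a ≤ 1 := by
  induction k generalizing a with
  | zero => simp [rootMass, offWeightLT]
  | succ k ih =>
    rw [rootMass, PTree.tsum_eq, tsum_eq_single a]
    · simp only [PTree.root, if_true, offWeightLT]
      rw [tsum_forest]
      refine (ENNReal.tsum_le_tsum fun c => ?_).trans (hq a)
      refine mul_le_of_le_one_right' ?_
      induction c with
      | nil => simp
      | cons b c ihc => simpa using mul_le_one' (ih b) ihc
    · intro b hb
      simp [PTree.root, hb]

theorem rootMass_offWeight_le_one {q : 𝒳 → List 𝒳 → ℝ≥0∞} (hq : ∀ a, ∑' c, q a c ≤ 1) (a : 𝒳) :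
    rootMass (offWeight q) a ≤ 1 := by
  rw [rootMass, ENNReal.tsum_eq_iSup_sum]
  refine iSup_le fun s => ?_
  choose f hf using exists_offWeightLT_eq q
  refine le_trans ?_ (rootMass_offWeightLT_le_one hq (s.sup f) a)
  refine le_trans (le_of_eq ?_) (ENNReal.sum_le_tsum s)
  refine Finset.sum_congr rfl fun t ht => ?_
  rw [hf t _ (Finset.le_sup ht)]

theorem tsum_offWeight_le_card [Fintype 𝒳] {q : 𝒳 → List 𝒳 → ℝ≥0∞}
    (hq : ∀ a, ∑' c, q a c ≤ 1) : ∑' t, offWeight q t ≤ Fintype.card 𝒳 := by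
  have h : ∀ t : PTree 𝒳, offWeight q t = ∑ a, if t.root = a then offWeight q t else 0 := by simp
  rw [tsum_congr h, Summable.tsum_finsetSum fun _ _ => ENNReal.summable]
  refine (Finset.sum_le_sum fun a _ => rootMass_offWeight_le_one hq a).trans ?_
  simp

end ForestSums

section Contexts

/-- One step of the path from the root to a marked vertex: the type of the vertex on the path and
the subtrees hanging off it to the left and to the right of the path. A list of frames is a tree
with one subtree cut out. -/
abbrev TreeFrame (𝒳 : Type*) := 𝒳 × List (PTree 𝒳) × List (PTree 𝒳)

variable {𝒳 : Type*}

/-- Graft a tree at the marked vertex. -/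
def ctxFill : List (TreeFrame 𝒳) → PTree 𝒳 → PTree 𝒳
  | [], t => t
  | F :: C, t => .node F.1 (F.2.1 ++ ctxFill C t :: F.2.2)

/-- The number of vertices without the subtree at the marked vertex. -/
def ctxSize : List (TreeFrame 𝒳) → ℕ
  | [] => 0
  | F :: C => 1 + (F.2.1.map PTree.size).sum + (F.2.2.map PTree.size).sum + ctxSize C

/-- The position of the marked vertex in depth-first order. -/
def ctxPos : List (TreeFrame 𝒳) → ℕ
  | [] => 0
  | F :: C => 1 + (F.2.1.map PTree.size).sum + ctxPos C

/-- The root type when the marked vertex has type `a`. -/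
def ctxRoot (a : 𝒳) : List (TreeFrame 𝒳) → 𝒳
  | [] => a
  | F :: _ => F.1

/-- The weight of all vertices outside the subtree at the marked vertex, which has type `a`. -/
noncomputable def ctxWeight (q : 𝒳 → List 𝒳 → ℝ≥0∞) (a : 𝒳) : List (TreeFrame 𝒳) → ℝ≥0∞
  | [] => 1
  | F :: C => q F.1 (F.2.1.map PTree.root ++ ctxRoot a C :: F.2.2.map PTree.root) *
      ((F.2.1.map (offWeight q)).prod * (F.2.2.map (offWeight q)).prod) * ctxWeight q a C

theorem ctxRoot_cons (a : 𝒳) (F : TreeFrame 𝒳) (C : List (TreeFrame 𝒳)) :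
    ctxRoot a (F :: C) = F.1 := rfl

theorem root_ctxFill (C : List (TreeFrame 𝒳)) (t : PTree 𝒳) :
    (ctxFill C t).root = ctxRoot t.root C := by
  cases C <;> rfl

theorem size_ctxFill (C : List (TreeFrame 𝒳)) (t : PTree 𝒳) :
    (ctxFill C t).size = ctxSize C + t.size := by
  induction C with
  | nil => simp [ctxFill, ctxSize]
  | cons F C ih =>
    simp only [ctxFill, ctxSize, PTree.size_node, List.map_append, List.map_cons, List.sum_append,
      List.sum_cons, ih]
    ring

theorem offWeight_ctxFill (q : 𝒳 → List 𝒳 → ℝ≥0∞) (C : List (TreeFrame 𝒳)) (t : PTree 𝒳) :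
    offWeight q (ctxFill C t) = ctxWeight q t.root C * offWeight q t := by
  induction C with
  | nil => simp [ctxFill, ctxWeight]
  | cons F C ih =>
    simp only [ctxFill, ctxWeight, offWeight_node, List.map_append, List.map_cons, List.prod_append,
      List.prod_cons, ih, root_ctxFill]
    ring

theorem ctxRoot_append (a : 𝒳) (C D : List (TreeFrame 𝒳)) :
    ctxRoot a (C ++ D) = ctxRoot (ctxRoot a D) C := by
  cases C <;> rfl

theorem ctxSize_append (C D : List (TreeFrame 𝒳)) :
    ctxSize (C ++ D) = ctxSize C + ctxSize D := by
  induction C with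
  | nil => simp [ctxSize]
  | cons F C ih =>
    simp only [List.cons_append, ctxSize, ih]
    ring

theorem ctxWeight_append (q : 𝒳 → List 𝒳 → ℝ≥0∞) (a : 𝒳) (C D : List (TreeFrame 𝒳)) :
    ctxWeight q a (C ++ D) = ctxWeight q (ctxRoot a D) C * ctxWeight q a D := by
  induction C with
  | nil => simp [ctxWeight]
  | cons F C ih =>
    simp only [List.cons_append, ctxWeight, ih, ctxRoot_append]
    ring

theorem ctxSize_eq_zero {C : List (TreeFrame 𝒳)} : ctxSize C = 0 ↔ C = [] := by
  cases C with
  | nil => simp [ctxSize]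
  | cons F C => simp [ctxSize]

theorem ctxPos_lt_size (C : List (TreeFrame 𝒳)) (t : PTree 𝒳) :
    ctxPos C < (ctxFill C t).size := by
  rw [size_ctxFill]
  have := t.size_pos
  suffices ctxPos C ≤ ctxSize C by omega
  clear this
  induction C with
  | nil => simp [ctxPos]
  | cons F C ih => simp only [ctxPos, ctxSize]; omega

theorem ctxPos_lt_of_append {l m k : List (PTree 𝒳)} {s : PTree 𝒳} (hm : m = l ++ s :: k)
    {p : ℕ} (hp : p < s.size) (p' : ℕ) :
    1 + (l.map PTree.size).sum + p < 1 + (m.map PTree.size).sum + p' := by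
  subst hm
  simp only [List.map_append, List.map_cons, List.sum_append, List.sum_cons]
  omega

theorem ctxFill_injective {C D : List (TreeFrame 𝒳)} {t : PTree 𝒳}
    (h : ctxFill C t = ctxFill D t) (hpos : ctxPos C = ctxPos D) : C = D := by
  induction C generalizing D with
  | nil =>
    cases D with
    | nil => rfl
    | cons G D => simp only [ctxPos] at hpos; omega
  | cons F C ih =>
    cases D with
    | nil => simp only [ctxPos] at hpos; omega
    | cons G D =>
      obtain ⟨b, l, r⟩ := F
      obtain ⟨b', l', r'⟩ := G
      simp only [ctxFill, PTree.node.injEq, ctxPos] at h hpos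
      obtain ⟨rfl, h⟩ := h
      have hC := ctxPos_lt_size C t
      have hD := ctxPos_lt_size D t
      rcases List.append_eq_append_iff.1 h with ⟨k, hk, hk'⟩ | ⟨k, hk, hk'⟩
      · cases k with
        | nil =>
          simp only [List.append_nil, List.nil_append, List.cons.injEq] at hk hk'
          obtain ⟨h1, rfl⟩ := hk'
          subst hk
          rw [ih h1 (by omega)]
        | cons s k =>
          simp only [List.cons_append, List.cons.injEq] at hk'
          obtain ⟨rfl, -⟩ := hk'
          exact absurd hpos (ctxPos_lt_of_append hk hC _).ne
      · cases k with
        | nil =>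
          simp only [List.append_nil, List.nil_append, List.cons.injEq] at hk hk'
          obtain ⟨h1, rfl⟩ := hk'
          subst hk
          rw [ih h1.symm (by omega)]
        | cons s k =>
          simp only [List.cons_append, List.cons.injEq] at hk'
          obtain ⟨rfl, -⟩ := hk'
          exact absurd hpos.symm (ctxPos_lt_of_append hk hD _).ne

theorem append_eq_append_of_ctxSize {C C' D D' : List (TreeFrame 𝒳)} (h : C ++ D = C' ++ D')
    (hsize : ctxSize C = ctxSize C') : C = C' ∧ D = D' := by
  rcases List.append_eq_append_iff.1 h with ⟨k, rfl, rfl⟩ | ⟨k, rfl, rfl⟩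
  · rw [ctxSize_append] at hsize
    obtain rfl := ctxSize_eq_zero.1 (by omega : ctxSize k = 0)
    simp
  · rw [ctxSize_append] at hsize
    obtain rfl := ctxSize_eq_zero.1 (by omega : ctxSize k = 0)
    simp

variable [DecidableEq 𝒳]

/-- Total weight of the trees with root type `a` and a marked vertex of type `a`, having `n`
vertices outside the subtree at the marked vertex, whose weight is not counted. -/
noncomputable def returnMass (q : 𝒳 → List 𝒳 → ℝ≥0∞) (a : 𝒳) (n : ℕ) : ℝ≥0∞ :=
  ∑' C : List (TreeFrame 𝒳), if ctxSize C = n ∧ ctxRoot a C = a then ctxWeight q a C else 0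

theorem returnMass_zero (q : 𝒳 → List 𝒳 → ℝ≥0∞) (a : 𝒳) : 1 ≤ returnMass q a 0 := by
  refine le_trans ?_ (ENNReal.le_tsum [])
  simp [ctxSize, ctxRoot, ctxWeight]

theorem returnMass_mul_le (q : 𝒳 → List 𝒳 → ℝ≥0∞) (a : 𝒳) (n m : ℕ) :
    returnMass q a n * returnMass q a m ≤ returnMass q a (n + m) := by
  let P (n : ℕ) (C : List (TreeFrame 𝒳)) : Prop := ctxSize C = n ∧ ctxRoot a C = a
  have key (n : ℕ) : returnMass q a n = ∑' C : {C // P n C}, ctxWeight q a C.1 := by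
    refine Eq.trans ?_ (tsum_subtype {C | P n C} (ctxWeight q a)).symm
    refine tsum_congr fun C => ?_
    simp only [Set.indicator, Set.mem_ofPred_eq, P]
    split_ifs <;> rfl
  rw [key, key, key, ← ENNReal.tsum_mul_right]
  simp_rw [← ENNReal.tsum_mul_left]
  rw [← ENNReal.tsum_prod]
  let φ : {C // P n C} × {C // P m C} → {C // P (n + m) C} := fun p =>
    ⟨p.1.1 ++ p.2.1, by
      obtain ⟨⟨C, h1, h2⟩, ⟨D, h3, h4⟩⟩ := p
      simp only [P, ctxSize_append, ctxRoot_append, h1, h2, h3, h4, and_self]⟩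
  have hφ : Function.Injective φ := by
    rintro ⟨⟨C, h1, h2⟩, ⟨D, h3, h4⟩⟩ ⟨⟨C', h1', h2'⟩, ⟨D', h3', h4'⟩⟩ h
    have := append_eq_append_of_ctxSize (Subtype.ext_iff.1 h) (h1.trans h1'.symm)
    simpa using this
  refine le_trans (le_of_eq (tsum_congr ?_)) (ENNReal.tsum_comp_le_tsum_of_injective hφ _)
  rintro ⟨⟨C, h1, h2⟩, ⟨D, h3, h4⟩⟩
  simp only [φ, ctxWeight_append, h4]

theorem returnMass_pow_le (q : 𝒳 → List 𝒳 → ℝ≥0∞) (a : 𝒳) (n k : ℕ) :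
    returnMass q a n ^ k ≤ returnMass q a (k * n) := by
  induction k with
  | zero => simpa using returnMass_zero q a
  | succ k ih =>
    rw [pow_succ, Nat.succ_mul]
    exact (mul_le_mul_left ih _).trans (returnMass_mul_le q a _ _)

theorem returnMass_mul_offWeight_le (q : 𝒳 → List 𝒳 → ℝ≥0∞) (t : PTree 𝒳) (m : ℕ) :
    returnMass q t.root m * offWeight q t ≤ ((m + t.size : ℕ) : ℝ≥0∞) *
      ∑' s : PTree 𝒳, if s.size = m + t.size ∧ s.root = t.root then offWeight q s else 0 := by
  set N := m + t.size with hN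
  let f : PTree 𝒳 × ℕ → ℝ≥0∞ := fun p =>
    if p.2 < N then (if p.1.size = N ∧ p.1.root = t.root then offWeight q p.1 else 0) else 0
  have h1 : ∑' p, f p = (N : ℝ≥0∞) *
      ∑' s : PTree 𝒳, if s.size = N ∧ s.root = t.root then offWeight q s else 0 := by
    rw [ENNReal.tsum_prod', ENNReal.tsum_comm, tsum_eq_sum (s := Finset.range N)]
    · rw [Finset.sum_congr rfl (g := fun _ =>
        ∑' s : PTree 𝒳, if s.size = N ∧ s.root = t.root then offWeight q s else 0)]
      · simp
      · intro i hi
        simp [f, Finset.mem_range.1 hi]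
    · intro i hi
      simp only [Finset.mem_range] at hi
      simp [f, hi]
  rw [← h1, returnMass, ← ENNReal.tsum_mul_right]
  let φ : List (TreeFrame 𝒳) → PTree 𝒳 × ℕ := fun C => (ctxFill C t, ctxPos C)
  have hφ : Function.Injective φ := fun C D h =>
    ctxFill_injective (congrArg Prod.fst h) (congrArg Prod.snd h)
  refine le_trans (ENNReal.tsum_le_tsum fun C => ?_)
    (ENNReal.tsum_comp_le_tsum_of_injective hφ f)
  split_ifs with h
  · have h3 := ctxPos_lt_size C t
    rw [size_ctxFill, h.1, ← hN] at h3
    simp only [f, φ, offWeight_ctxFill, size_ctxFill, root_ctxFill, h.1, h.2, ← hN, h3, and_self,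
      if_true]
    exact le_rfl
  · simp

/-- The mean offspring matrix. -/
noncomputable def offMean (q : 𝒳 → List 𝒳 → ℝ≥0∞) : Matrix 𝒳 𝒳 ℝ≥0∞ :=
  Matrix.of fun a b => ∑' c : List 𝒳, q b c * (mult a c : ℝ≥0∞)

theorem offMean_apply (q : 𝒳 → List 𝒳 → ℝ≥0∞) (a b : 𝒳) :
    offMean q a b = ∑' c : List 𝒳, q b c * (mult a c : ℝ≥0∞) := rfl

theorem tsum_split_eq_mult (b : 𝒳) (c : List 𝒳) :
    ∑' l : List 𝒳, ∑' r : List 𝒳, (if l ++ b :: r = c then (1 : ℝ≥0∞) else 0) = mult b c := by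
  induction c with
  | nil => simp [mult]
  | cons x c ih =>
    rw [ENNReal.tsum_list_eq, tsum_eq_single x]
    · simp only [List.nil_append, List.cons.injEq, List.cons_append, true_and, ih]
      by_cases h : b = x
      · simp [h, mult, add_comm]
      · simp [h, mult, Ne.symm h]
    · intro y hy
      simp [hy]

theorem tsum_split (b : 𝒳) (g : List 𝒳 → ℝ≥0∞) :
    ∑' l : List 𝒳, ∑' r : List 𝒳, g (l ++ b :: r) = ∑' c, g c * mult b c := by
  simp_rw [← tsum_split_eq_mult, ← ENNReal.tsum_mul_left]
  refine Eq.symm (ENNReal.tsum_comm.trans (tsum_congr fun l =>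
    ENNReal.tsum_comm.trans (tsum_congr fun r => ?_)))
  rw [tsum_eq_single (l ++ b :: r)]
  · simp
  · intro c hc
    simp [hc.symm]

variable [Fintype 𝒳]

theorem tsum_ctxWeight_length {q : 𝒳 → List 𝒳 → ℝ≥0∞} (hq : ∀ a, rootMass (offWeight q) a = 1)
    (a b : 𝒳) (k : ℕ) :
    ∑' C : List (TreeFrame 𝒳), (if C.length = k ∧ ctxRoot a C = b then ctxWeight q a C else 0)
      = (offMean q ^ k) a b := by
  have hforest (g : List 𝒳 → ℝ≥0∞) :
      ∑' ts : List (PTree 𝒳), g (ts.map PTree.root) * (ts.map (offWeight q)).prod = ∑' c, g c := by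
    rw [tsum_forest]
    refine tsum_congr fun c => ?_
    rw [List.map_congr_left (g := fun _ => 1) fun a _ => hq a]
    simp
  induction k generalizing b with
  | zero =>
    rw [ENNReal.tsum_list_eq]
    simp [ctxRoot, ctxWeight, Matrix.one_apply]
  | succ k ih =>
    rw [ENNReal.tsum_list_eq, pow_succ, Matrix.mul_apply]
    simp only [List.length_nil, List.length_cons, Nat.add_right_cancel_iff, ctxRoot_cons, ctxWeight,
      ← ih, offMean_apply]
    simp only [(Nat.succ_ne_zero k).symm, false_and, if_false, zero_add]
    rw [ENNReal.tsum_comm]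
    simp_rw [← ENNReal.tsum_mul_right]
    rw [← Summable.tsum_finsetSum fun _ _ => ENNReal.summable]
    refine tsum_congr fun C => ?_
    by_cases hC : C.length = k
    · simp only [hC, true_and]
      rw [Finset.sum_eq_single (ctxRoot a C) (fun b' _ hb' => by simp [hb'.symm]) (by simp)]
      simp only [if_true]
      rw [ENNReal.tsum_prod', tsum_eq_single b]
      · rw [← tsum_split, mul_comm, ← ENNReal.tsum_mul_right, ENNReal.tsum_prod']
        simp only [if_true]
        rw [← hforest]
        refine tsum_congr fun l => ?_
        rw [← ENNReal.tsum_mul_right, ← hforest, ← ENNReal.tsum_mul_right]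
        refine tsum_congr fun r => ?_
        ring
      · intro b' hb'
        simp [hb']
    · simp [hC]

theorem matStar_le_tsum_returnMass {q : 𝒳 → List 𝒳 → ℝ≥0∞}
    (hq : ∀ a, rootMass (offWeight q) a = 1) (a : 𝒳) :
    matStar (offMean q) a a ≤ ∑' n, returnMass q a (n + 1) := by
  simp only [matStar, Matrix.of_apply, ← tsum_ctxWeight_length hq, returnMass]
  rw [ENNReal.tsum_comm, ENNReal.tsum_comm (α := ℕ)]
  refine ENNReal.tsum_le_tsum fun C => ?_
  cases C with
  | nil => simp
  | cons F C =>
    rw [tsum_eq_single C.length]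
    · refine le_trans ?_ (ENNReal.le_tsum (ctxSize (F :: C) - 1))
      have : ctxSize (F :: C) - 1 + 1 = ctxSize (F :: C) :=
        Nat.sub_add_cancel (by simp only [ctxSize]; omega)
      simp [this]
    · intro n hn
      simp [hn.symm]

end Contexts

section MeanMatrix

variable {𝒳 : Type*} [Fintype 𝒳] [DecidableEq 𝒳]

theorem matStar_eq_top_of_mulVec_eq {A : Matrix 𝒳 𝒳 ℝ≥0∞} {u : 𝒳 → ℝ≥0∞} (hu : ∀ a, u a ≠ 0)
    (hu' : ∀ a, u a ≠ ∞) (hA : A.mulVec u = u) {a : 𝒳} (ha : ∀ b, 0 < matStar A b a) :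
    matStar A a a = ∞ := by
  by_contra htop
  have hpow (k : ℕ) : (A ^ k).mulVec u = u := by
    induction k with
    | zero => simp
    | succ k ih => rw [pow_succ, ← Matrix.mulVec_mulVec, hA, ih]
  have hfin (b : 𝒳) : ∑' k : ℕ, (A ^ (k + 1)) a b ≠ ∞ := by
    obtain ⟨j, hj⟩ : ∃ j : ℕ, (A ^ (j + 1)) b a ≠ 0 := by
      by_contra! h
      have := ha b
      simp [matStar, h] at this
    have hle : (∑' k : ℕ, (A ^ (k + 1)) a b) * (A ^ (j + 1)) b a ≤ matStar A a a := by
      rw [← ENNReal.tsum_mul_right]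
      refine le_trans (ENNReal.tsum_le_tsum fun k => ?_)
        (ENNReal.tsum_comp_le_tsum_of_injective (add_left_injective (j + 1))
          fun k => (A ^ (k + 1)) a a)
      rw [show k + (j + 1) + 1 = (k + 1) + (j + 1) by ring, pow_add A (k + 1), Matrix.mul_apply]
      exact Finset.single_le_sum (f := fun e => (A ^ (k + 1)) a e * (A ^ (j + 1)) e a)
        (fun _ _ => zero_le) (Finset.mem_univ b)
    intro h
    rw [h, ENNReal.top_mul hj] at hle
    exact htop (top_le_iff.1 hle)
  have hsum : ∑' k : ℕ, ((A ^ (k + 1)).mulVec u) a = ∑ b, (∑' k : ℕ, (A ^ (k + 1)) a b) * u b := by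
    simp_rw [← ENNReal.tsum_mul_right]
    rw [← Summable.tsum_finsetSum fun _ _ => ENNReal.summable]
    rfl
  simp_rw [hpow] at hsum
  rw [ENNReal.tsum_const_eq_top_of_ne_zero (hu a)] at hsum
  exact ENNReal.sum_ne_top.2 (fun b _ => ENNReal.mul_ne_top (hfin b) (hu' b)) hsum.symm

theorem matStar_eq_zero_of_closed {A : Matrix 𝒳 𝒳 ℝ≥0∞} {D : 𝒳 → Prop}
    (h : ∀ a b, ¬ D a → D b → A b a = 0) {a b : 𝒳} (ha : ¬ D a) (hb : D b) :
    matStar A b a = 0 := by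
  have hpow (k : ℕ) : ∀ a, ¬ D a → (A ^ k) b a = 0 := by
    induction k with
    | zero =>
      intro a ha
      rw [pow_zero, Matrix.one_apply_ne]
      rintro rfl
      exact ha hb
    | succ k ih =>
      intro a ha
      rw [pow_succ, Matrix.mul_apply]
      refine Finset.sum_eq_zero fun e _ => ?_
      by_cases he : D e
      · rw [h a e ha he, mul_zero]
      · rw [ih e he, zero_mul]
  simp [matStar, hpow _ a ha]

theorem matStar_pos_trans {A : Matrix 𝒳 𝒳 ℝ≥0∞} {a b c : 𝒳} (hab : 0 < matStar A a b)
    (hbc : 0 < matStar A b c) : 0 < matStar A a c := by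
  have key (a b : 𝒳) : 0 < matStar A a b ↔ ∃ k : ℕ, (A ^ (k + 1)) a b ≠ 0 := by
    simp [matStar, pos_iff_ne_zero]
  rw [key] at *
  obtain ⟨i, hi⟩ := hab
  obtain ⟨j, hj⟩ := hbc
  refine ⟨i + 1 + j, ?_⟩
  rw [add_assoc, pow_add, Matrix.mul_apply]
  refine fun h => mul_ne_zero hi hj ?_
  exact Finset.sum_eq_zero_iff.1 h b (Finset.mem_univ b)

theorem le_matStar (A : Matrix 𝒳 𝒳 ℝ≥0∞) (a b : 𝒳) : A a b ≤ matStar A a b := by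
  simpa [matStar] using ENNReal.le_tsum (f := fun k : ℕ => (A ^ (k + 1)) a b) 0

theorem sum_map_eq_sum_mult (x : 𝒳 → ℝ) (c : List 𝒳) :
    (c.map x).sum = ∑ b, (mult b c : ℝ) * x b := by
  induction c with
  | nil => simp [mult]
  | cons a c ih =>
    have h (b : 𝒳) : (mult b (a :: c) : ℝ) = mult b c + if a = b then 1 else 0 := by
      simp [mult, List.count_cons]
    simp [ih, h, add_mul, Finset.sum_add_distrib, add_comm]

end MeanMatrix

section Extinction

variable {𝒳 : Type*}

/-- The offspring kernel with values in `[0, ∞]`. -/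
noncomputable def ennKernel (𝒬 : 𝒳 → List 𝒳 → ℝ) (a : 𝒳) (c : List 𝒳) : ℝ≥0∞ :=
  ENNReal.ofReal (𝒬 a c)

theorem offWeight_ne_zero_iff {q : 𝒳 → List 𝒳 → ℝ≥0∞} {a : 𝒳} {ts : List (PTree 𝒳)} :
    offWeight q (.node a ts) ≠ 0 ↔
      q a (ts.map PTree.root) ≠ 0 ∧ ∀ t ∈ ts, offWeight q t ≠ 0 := by
  rw [offWeight_node, mul_ne_zero_iff, ne_eq (List.prod _), List.prod_eq_zero_iff]
  simp

theorem offWeight_eq_zero_of_forall_exists {q : 𝒳 → List 𝒳 → ℝ≥0∞} {D : 𝒳 → Prop}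
    (h : ∀ a c, D a → q a c ≠ 0 → ∃ b ∈ c, D b) (t : PTree 𝒳) (ht : D t.root) :
    offWeight q t = 0 := by
  induction t using PTree.induction_node with
  | h a ts ih =>
    by_contra hne
    obtain ⟨h1, h2⟩ := offWeight_ne_zero_iff.1 hne
    obtain ⟨b, hb, hDb⟩ := h a _ ht h1
    obtain ⟨t, htts, rfl⟩ := List.mem_map.1 hb
    exact h2 t htts (ih t htts hDb)

theorem one_sub_prod_le_sum {x : 𝒳 → ℝ} (h0 : ∀ a, 0 ≤ x a) (h1 : ∀ a, x a ≤ 1) (c : List 𝒳) :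
    0 ≤ (c.map x).prod ∧ (c.map x).prod ≤ 1 ∧
      1 - (c.map x).prod ≤ (c.map fun a => 1 - x a).sum := by
  induction c with
  | nil => simp
  | cons a c ih =>
    obtain ⟨i1, i2, i3⟩ := ih
    simp only [List.map_cons, List.prod_cons, List.sum_cons]
    refine ⟨mul_nonneg (h0 a) i1, mul_le_one₀ (h1 a) i1 i2, ?_⟩
    nlinarith [mul_nonneg (sub_nonneg.2 (h1 a)) (sub_nonneg.2 i2)]

theorem eq_one_of_prod_eq_one {x : 𝒳 → ℝ} (h0 : ∀ a, 0 ≤ x a) (h1 : ∀ a, x a ≤ 1) {c : List 𝒳}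
    (h : (c.map x).prod = 1) : ∀ b ∈ c, x b = 1 := by
  induction c with
  | nil => simp
  | cons a c ih =>
    obtain ⟨i1, i2, -⟩ := one_sub_prod_le_sum h0 h1 c
    simp only [List.map_cons, List.prod_cons] at h
    have ha : x a = 1 := le_antisymm (h1 a) (h ▸ mul_le_of_le_one_right (h0 a) i2)
    rw [ha, one_mul] at h
    simpa [ha] using ih h

theorem countP_le_one_of_one_sub_prod_eq {x : 𝒳 → ℝ} (h0 : ∀ a, 0 ≤ x a) (h1 : ∀ a, x a ≤ 1)
    {c : List 𝒳} (h : 1 - (c.map x).prod = (c.map fun a => 1 - x a).sum) :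
    (c.map fun a => if x a < 1 then (1 : ℝ) else 0).sum ≤ 1 := by
  induction c with
  | nil => simp
  | cons a c ih =>
    obtain ⟨i1, i2, i3⟩ := one_sub_prod_le_sum h0 h1 c
    simp only [List.map_cons, List.prod_cons, List.sum_cons] at h ⊢
    by_cases ha : x a < 1
    · have hc : (c.map x).prod = 1 := by nlinarith
      have hall := eq_one_of_prod_eq_one h0 h1 hc
      have : (c.map fun a => if x a < 1 then (1 : ℝ) else 0).sum = 0 :=
        List.sum_eq_zero (by
          simp only [List.mem_map]
          rintro _ ⟨b, hb, rfl⟩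
          simp [hall b hb])
      rw [this]
      simp [ha]
    · have ha' : x a = 1 := le_antisymm (h1 a) (not_lt.1 ha)
      simp only [ha', one_mul, sub_self, zero_add] at h
      simpa [ha] using ih h

theorem summable_mul_length {p : List 𝒳 → ℝ} (hp : ∀ c, 0 ≤ p c)
    (h : Summable fun c : List 𝒳 => p c * Real.exp (1 * c.length)) :
    Summable fun c : List 𝒳 => p c * (c.length : ℝ) := by
  refine Summable.of_nonneg_of_le (fun c => by have := hp c; positivity) (fun c => ?_) h
  refine mul_le_mul_of_nonneg_left ?_ (hp c)
  rw [one_mul]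
  linarith [Real.add_one_le_exp (c.length : ℝ)]

variable [DecidableEq 𝒳]

theorem summable_mul_mult {p : List 𝒳 → ℝ} (hp : ∀ c, 0 ≤ p c)
    (h : Summable fun c : List 𝒳 => p c * (c.length : ℝ)) (a : 𝒳) :
    Summable fun c : List 𝒳 => p c * (mult a c : ℝ) := by
  refine Summable.of_nonneg_of_le (fun c => by have := hp c; positivity) (fun c => ?_) h
  exact mul_le_mul_of_nonneg_left (by exact_mod_cast List.count_le_length) (hp c)

theorem meanMat_eq_ofReal {𝒬 : 𝒳 → List 𝒳 → ℝ} (hQ : ∀ a c, 0 ≤ 𝒬 a c)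
    (hlen : ∀ a, Summable fun c : List 𝒳 => 𝒬 a c * (c.length : ℝ)) (a b : 𝒳) :
    meanMat 𝒬 a b = ENNReal.ofReal (meanMatR 𝒬 a b) := by
  simp only [meanMat, meanMatR, Matrix.of_apply]
  rw [ENNReal.ofReal_tsum_of_nonneg (fun c => by have := hQ b c; positivity)
    (summable_mul_mult (hQ b) (hlen b) a)]
  refine tsum_congr fun c => ?_
  rw [ENNReal.ofReal_mul (hQ b c), ENNReal.ofReal_natCast]

variable [Fintype 𝒳]

/-- A critical kernel admits no strictly superharmonic function. -/
theorem eq_sum_map_of_le {𝒬 : 𝒳 → List 𝒳 → ℝ} (hQ : ∀ a c, 0 ≤ 𝒬 a c)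
    (hlen : ∀ a, Summable fun c : List 𝒳 => 𝒬 a c * (c.length : ℝ)) (hcrit : CriticalKernel 𝒬)
    {x : 𝒳 → ℝ} {h : 𝒳 → List 𝒳 → ℝ} (hsum : ∀ a, HasSum (fun c => 𝒬 a c * h a c) (x a))
    (hle : ∀ a c, 𝒬 a c ≠ 0 → h a c ≤ (c.map x).sum) :
    ∀ a c, 𝒬 a c ≠ 0 → h a c = (c.map x).sum := by
  obtain ⟨u, hu, hAu⟩ := hcrit
  have hmean (a : 𝒳) :
      HasSum (fun c => 𝒬 a c * (c.map x).sum) (∑ b, meanMatR 𝒬 b a * x b) := by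
    have := hasSum_sum (s := Finset.univ) fun (b : 𝒳) _ =>
      (summable_mul_mult (hQ a) (hlen a) b).hasSum.mul_right (x b)
    simp_rw [sum_map_eq_sum_mult, Finset.mul_sum, ← mul_assoc]
    exact this
  have hdiff (a : 𝒳) := (hmean a).sub (hsum a)
  have hnn (a : 𝒳) (c : List 𝒳) : 0 ≤ 𝒬 a c * (c.map x).sum - 𝒬 a c * h a c := by
    by_cases h0 : 𝒬 a c = 0
    · simp [h0]
    · rw [← mul_sub]
      exact mul_nonneg (hQ a c) (sub_nonneg.2 (hle a c h0))
  have htot : ∑ a, u a * (∑ b, meanMatR 𝒬 b a * x b - x a) = 0 := by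
    simp_rw [mul_sub, Finset.sum_sub_distrib, Finset.mul_sum]
    rw [Finset.sum_comm, sub_eq_zero]
    refine Finset.sum_congr rfl fun b _ => ?_
    conv_rhs => rw [← hAu b, Finset.sum_mul]
    exact Finset.sum_congr rfl fun a _ => by ring
  intro a c hc
  have hz := (Finset.sum_eq_zero_iff_of_nonneg fun a _ =>
    mul_nonneg (hu a).le ((hdiff a).nonneg (hnn a))).1 htot a (Finset.mem_univ a)
  have hz' := hdiff a
  rw [(mul_eq_zero.1 hz).resolve_left (hu a).ne'] at hz'
  have := congrFun ((hasSum_zero_iff_of_nonneg (hnn a)).1 hz') c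
  simp only [Pi.zero_apply, ← mul_sub, mul_eq_zero, hc, false_or] at this
  linarith

theorem rootMass_eq_one {𝒬 : 𝒳 → List 𝒳 → ℝ} (hQ : ∀ a c, 0 ≤ 𝒬 a c)
    (hQ1 : ∀ a, HasSum (𝒬 a) 1)
    (hlen : ∀ a, Summable fun c : List 𝒳 => 𝒬 a c * (c.length : ℝ)) (hcrit : CriticalKernel 𝒬)
    {t : PTree 𝒳} (ht : offWeight (ennKernel 𝒬) t ≠ 0)
    (hreach : ∀ b, 0 < matStar (meanMat 𝒬) b t.root) (a : 𝒳) :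
    rootMass (offWeight (ennKernel 𝒬)) a = 1 := by
  set T := rootMass (offWeight (ennKernel 𝒬)) with hT
  have hT1 : ∀ a, T a ≤ 1 := rootMass_offWeight_le_one fun a => by
    rw [← ENNReal.ofReal_one, ← (hQ1 a).tsum_eq, ENNReal.ofReal_tsum_of_nonneg (hQ a)
      (hQ1 a).summable]
    rfl
  set x : 𝒳 → ℝ := fun a => (T a).toReal with hx
  have hTx (a : 𝒳) : T a = ENNReal.ofReal (x a) :=
    (ENNReal.ofReal_toReal (ne_top_of_le_ne_top ENNReal.one_ne_top (hT1 a))).symm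
  have hx0 (a : 𝒳) : 0 ≤ x a := ENNReal.toReal_nonneg
  have hx1 (a : 𝒳) : x a ≤ 1 := by
    simpa using ENNReal.toReal_mono ENNReal.one_ne_top (hT1 a)
  have hprod (c : List 𝒳) : (c.map T).prod = ENNReal.ofReal (c.map x).prod := by
    induction c with
    | nil => simp
    | cons b c ih => simp [ih, hTx, ENNReal.ofReal_mul (hx0 b)]
  have hpp (c : List 𝒳) := one_sub_prod_le_sum hx0 hx1 c
  have hsummable (a : 𝒳) : Summable fun c => 𝒬 a c * (c.map x).prod :=
    Summable.of_nonneg_of_le (fun c => mul_nonneg (hQ a c) (hpp c).1)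
      (fun c => mul_le_of_le_one_right (hQ a c) (hpp c).2.1) (hQ1 a).summable
  have hfix (a : 𝒳) : HasSum (fun c => 𝒬 a c * (c.map x).prod) (x a) := by
    rw [(hsummable a).hasSum_iff]
    have h := rootMass_offWeight (ennKernel 𝒬) a
    rw [← hT, hTx] at h
    simp_rw [hprod, ennKernel, ← ENNReal.ofReal_mul (hQ a _)] at h
    rw [← ENNReal.ofReal_tsum_of_nonneg (fun c => mul_nonneg (hQ a c) (hpp c).1)
      (hsummable a)] at h
    exact ((ENNReal.ofReal_eq_ofReal_iff (hx0 a)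
      (tsum_nonneg fun c => mul_nonneg (hQ a c) (hpp c).1)).1 h).symm
  have hdef (a : 𝒳) : HasSum (fun c => 𝒬 a c * (1 - (c.map x).prod)) (1 - x a) := by
    simpa only [mul_sub, mul_one] using (hQ1 a).sub (hfix a)
  have heq := eq_sum_map_of_le hQ hlen hcrit hdef fun a c _ => (hpp c).2.2
  by_contra hne
  have ha : x a < 1 := lt_of_le_of_ne (hx1 a) fun h => hne (by rw [hTx, h, ENNReal.ofReal_one])
  let y : 𝒳 → ℝ := fun a => if x a < 1 then 1 else 0
  have hclosed (b : 𝒳) (hb : ¬ x b < 1) (c : List 𝒳) (hc : 𝒬 b c ≠ 0) : ∀ e ∈ c, x e = 1 := by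
    have h := hdef b
    rw [le_antisymm (hx1 b) (not_lt.1 hb), sub_self] at h
    have := congrFun ((hasSum_zero_iff_of_nonneg fun c =>
      mul_nonneg (hQ b c) (sub_nonneg.2 (hpp c).2.1)).1 h) c
    simp only [Pi.zero_apply, mul_eq_zero, hc, false_or] at this
    exact eq_one_of_prod_eq_one hx0 hx1 (by linarith)
  have hroot : x t.root < 1 := by
    by_contra hr
    refine (hreach a).ne' (matStar_eq_zero_of_closed (D := fun a => x a < 1) ?_ hr ha)
    intro b e hb he
    simp only [meanMat, Matrix.of_apply, ENNReal.tsum_eq_zero, mul_eq_zero,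
      ENNReal.ofReal_eq_zero, Nat.cast_eq_zero]
    intro c
    by_cases hc : 𝒬 b c = 0
    · exact Or.inl hc.le
    · exact Or.inr (List.count_eq_zero.2 fun hec => he.ne (hclosed b hb c hc e hec))
  have hone := eq_sum_map_of_le hQ hlen hcrit (x := fun a => - y a) (h := fun a _ => - y a)
    (fun a => by simpa using (hQ1 a).mul_right (- y a)) fun b c hc => by
      have hneg : (c.map fun a => - y a).sum = - (c.map y).sum := by
        simp [sum_map_eq_sum_mult]
      rw [hneg, neg_le_neg_iff]
      by_cases hb : x b < 1
      · simp only [y, hb, if_true]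
        exact countP_le_one_of_one_sub_prod_eq hx0 hx1 (heq b c hc)
      · simp only [y, hb, if_false]
        refine (List.sum_eq_zero ?_).le
        simp only [List.mem_map]
        rintro _ ⟨e, he, rfl⟩
        simp [hclosed b hb c hc e he]
  refine ht (offWeight_eq_zero_of_forall_exists (D := fun a => x a < 1) (fun b c hb hc => ?_) t
    hroot)
  have hc' : 𝒬 b c ≠ 0 := fun h => hc (by simp [ennKernel, h])
  have h := hone b c hc'
  by_contra! hno
  have hz : (c.map fun a => - y a).sum = 0 := List.sum_eq_zero (by
    simp only [List.mem_map]
    rintro _ ⟨e, he, rfl⟩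
    simp [y, hno e he])
  rw [hz] at h
  simp [y, hb] at h

theorem exists_size_le_of_transient {𝒬 : 𝒳 → List 𝒳 → ℝ}
    {Xr Xt : Finset 𝒳} (hWI : WeaklyIrred (meanMat 𝒬) Xr Xt) (htrans : BoundedTransient 𝒬 Xt) :
    ∃ N, ∀ t, offWeight (ennKernel 𝒬) t ≠ 0 → t.root ∈ Xt → t.size ≤ N := by
  obtain ⟨B, hB⟩ := htrans
  let r : 𝒳 → 𝒳 → Prop := fun a b => b ∈ Xt ∧ 0 < matStar (meanMat 𝒬) a b
  have : IsTrans 𝒳 r := ⟨fun a b c hab hbc => ⟨hbc.1, matStar_pos_trans hab.2 hbc.2⟩⟩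
  have : Std.Irrefl r := ⟨fun a ha => ha.2.ne' (hWI.trans_zero a a ha.1 (Or.inl rfl))⟩
  have hwf := Finite.wellFounded_of_trans_of_irrefl r
  have hchild {b : 𝒳} {c : List 𝒳} (hb : b ∈ Xt) (hc : ennKernel 𝒬 b c ≠ 0) {a : 𝒳}
      (ha : a ∈ c) : r a b := by
    refine ⟨hb, lt_of_lt_of_le ?_ (le_matStar _ a b)⟩
    refine lt_of_lt_of_le ?_ (ENNReal.le_tsum c)
    refine pos_iff_ne_zero.2 (mul_ne_zero hc ?_)
    simpa [mult, List.count_eq_zero] using ha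
  have key : ∀ b, b ∈ Xt → ∃ N, ∀ t, offWeight (ennKernel 𝒬) t ≠ 0 → t.root = b →
      t.size ≤ N := by
    intro b
    induction b using hwf.induction with
    | h b ih =>
      intro hb
      have hmem (a : 𝒳) (h : r a b) : a ∈ Xt := by
        by_contra ha
        exact h.2.ne' (hWI.trans_zero a b hb (Or.inr ((hWI.compl a).2 ha)))
      have ih' : ∀ a, ∃ N, r a b → ∀ t, offWeight (ennKernel 𝒬) t ≠ 0 → t.root = a →
          t.size ≤ N := fun a => by
        by_cases h : r a b
        · obtain ⟨N, hN⟩ := ih a h (hmem a h)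
          exact ⟨N, fun _ => hN⟩
        · exact ⟨0, fun h' => absurd h' h⟩
      choose N hN using ih'
      refine ⟨1 + B * ∑ a, N a, ?_⟩
      rintro ⟨b', ts⟩ ht rfl
      obtain ⟨h1, h2⟩ := offWeight_ne_zero_iff.1 ht
      rw [PTree.size_node]
      have hlen : ts.length ≤ B := by
        have hall : (ts.map PTree.root).countP (fun a => decide (a ∈ Xt)) = ts.length := by
          rw [List.countP_eq_length.2, List.length_map]
          intro a ha
          simpa using hmem a (hchild hb h1 ha)
        rw [← hall]
        exact hB b' _ fun h => h1 (by simp [ennKernel, h])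
      have hsum : (ts.map PTree.size).sum ≤ ts.length * ∑ a, N a := by
        have := List.sum_le_card_nsmul (ts.map PTree.size) (∑ a, N a) (by
          simp only [List.mem_map]
          rintro _ ⟨t, htts, rfl⟩
          refine (hN t.root (hchild hb h1 (List.mem_map_of_mem htts)) t (h2 t htts) rfl).trans ?_
          exact Finset.single_le_sum (f := N) (fun _ _ => Nat.zero_le _) (Finset.mem_univ _))
        simpa using this
      have := Nat.mul_le_mul_right (∑ a, N a) hlen
      omega
  have key' : ∀ b, ∃ N, b ∈ Xt → ∀ t, offWeight (ennKernel 𝒬) t ≠ 0 → t.root = b →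
      t.size ≤ N := fun b => by
    by_cases h : b ∈ Xt
    · obtain ⟨N, hN⟩ := key b h
      exact ⟨N, fun _ => hN⟩
    · exact ⟨0, fun h' => absurd h' h⟩
  choose N hN using key'
  refine ⟨∑ a, N a, fun t ht htr => (hN t.root htr t ht rfl).trans ?_⟩
  exact Finset.single_le_sum (f := N) (fun _ _ => Nat.zero_le _) (Finset.mem_univ _)

end Extinction

section SizeLowerBound

theorem eventually_mul_exp_neg_le {c ε : ℝ} (hc : 0 < c) (hε : 0 < ε) :
    ∀ᶠ n : ℕ in atTop, (n : ℝ) * Real.exp (-(2 * ε * n)) ≤ c * Real.exp (-(ε * n)) := by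
  have h1 := (Real.tendsto_pow_mul_exp_neg_atTop_nhds_zero 1).comp
    (tendsto_natCast_atTop_atTop.const_mul_atTop hε : Tendsto (fun n : ℕ => ε * (n : ℝ)) _ _)
  filter_upwards [h1.eventually_le_const (mul_pos hε hc)] with n hn
  simp only [Function.comp_apply, pow_one, mul_assoc] at hn
  rw [show -(2 * ε * (n : ℝ)) = -(ε * n) + -(ε * n) by ring, Real.exp_add, ← mul_assoc]
  exact mul_le_mul_of_nonneg_right (le_of_mul_le_mul_left hn hε) (Real.exp_nonneg _)

variable {𝒳 : Type*}

theorem ofReal_mgwWeight {μ0 : 𝒳 → ℝ} {𝒬 : 𝒳 → List 𝒳 → ℝ} (hμ : ∀ a, 0 ≤ μ0 a)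
    (hQ : ∀ a c, 0 ≤ 𝒬 a c) (t : PTree 𝒳) :
    ENNReal.ofReal (mgwWeight μ0 𝒬 t) =
      ENNReal.ofReal (μ0 t.root) * offWeight (ennKernel 𝒬) t := by
  rw [mgwWeight, ENNReal.ofReal_mul (hμ _), offWeight]
  congr 1
  induction t.subtrees with
  | nil => simp
  | cons s l ih => simp [ih, ENNReal.ofReal_mul (hQ _ _), ennKernel]

variable [DecidableEq 𝒳]

theorem mul_le_mul_treeMass {μ0 : 𝒳 → ℝ} {𝒬 : 𝒳 → List 𝒳 → ℝ} (hμ : ∀ a, 0 ≤ μ0 a)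
    (hQ : ∀ a c, 0 ≤ 𝒬 a c) (t : PTree 𝒳) (m : ℕ) :
    returnMass (ennKernel 𝒬) t.root m * ENNReal.ofReal (mgwWeight μ0 𝒬 t) ≤
      ((m + t.size : ℕ) : ℝ≥0∞) * treeMass (mgwWeight μ0 𝒬) (m + t.size) := by
  rw [ofReal_mgwWeight hμ hQ, mul_left_comm]
  refine (mul_le_mul_right (returnMass_mul_offWeight_le (ennKernel 𝒬) t m) _).trans ?_
  rw [mul_left_comm, ← ENNReal.tsum_mul_left]
  refine mul_le_mul_right (ENNReal.tsum_le_tsum fun s => ?_) _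
  by_cases h : s.size = m + t.size <;> by_cases h' : s.root = t.root <;>
    simp [h, h', ofReal_mgwWeight hμ hQ]

variable [Fintype 𝒳]

theorem matStar_eq_top {𝒬 : 𝒳 → List 𝒳 → ℝ} (hQ : ∀ a c, 0 ≤ 𝒬 a c)
    (hlen : ∀ a, Summable fun c : List 𝒳 => 𝒬 a c * (c.length : ℝ)) (hcrit : CriticalKernel 𝒬)
    {a : 𝒳} (ha : ∀ b, 0 < matStar (meanMat 𝒬) b a) : matStar (meanMat 𝒬) a a = ∞ := by
  obtain ⟨u, hu, hAu⟩ := hcrit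
  refine matStar_eq_top_of_mulVec_eq (u := fun a => ENNReal.ofReal (u a)) (fun b => ?_)
    (fun b => ENNReal.ofReal_ne_top) ?_ ha
  · simpa using hu b
  · ext b
    rw [← hAu b, ENNReal.ofReal_sum_of_nonneg]
    · simp only [Matrix.mulVec, dotProduct, meanMat_eq_ofReal hQ hlen]
      refine Finset.sum_congr rfl fun e _ => ?_
      rw [ENNReal.ofReal_mul' (hu e).le]
    · intro e _
      refine mul_nonneg (tsum_nonneg fun c => ?_) (hu e).le
      have := hQ e c
      positivity

theorem exists_le_returnMass {𝒬 : 𝒳 → List 𝒳 → ℝ} (hQ : ∀ a c, 0 ≤ 𝒬 a c)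
    (hQ1 : ∀ a, HasSum (𝒬 a) 1)
    (hlen : ∀ a, Summable fun c : List 𝒳 => 𝒬 a c * (c.length : ℝ)) (hcrit : CriticalKernel 𝒬)
    {t : PTree 𝒳} (ht : offWeight (ennKernel 𝒬) t ≠ 0)
    (hreach : ∀ b, 0 < matStar (meanMat 𝒬) b t.root) {ε : ℝ} (hε : 0 < ε) :
    ∃ n : ℕ, 0 < n ∧ ENNReal.ofReal (Real.exp (-(ε * n))) ≤ returnMass (ennKernel 𝒬) t.root n := by
  by_contra! h
  have htop := matStar_le_tsum_returnMass (rootMass_eq_one hQ hQ1 hlen hcrit ht hreach) t.root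
  rw [show offMean (ennKernel 𝒬) = meanMat 𝒬 from rfl, matStar_eq_top hQ hlen hcrit hreach,
    top_le_iff] at htop
  have hsum : Summable fun n : ℕ => Real.exp (-(ε * n)) := by
    refine (summable_geometric_of_lt_one (Real.exp_nonneg (-ε))
      (Real.exp_lt_one_iff.2 (neg_lt_zero.2 hε))).congr fun n => ?_
    rw [← Real.exp_nat_mul]
    congr 1
    ring
  have hle : ∑' n, returnMass (ennKernel 𝒬) t.root (n + 1) ≤
      ∑' n : ℕ, ENNReal.ofReal (Real.exp (-(ε * n))) :=
    (ENNReal.tsum_le_tsum fun n => (h (n + 1) n.succ_pos).le).trans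
      (ENNReal.tsum_comp_le_tsum_of_injective (add_left_injective 1)
        fun n : ℕ => ENNReal.ofReal (Real.exp (-(ε * n))))
  rw [htop, top_le_iff, ← ENNReal.ofReal_tsum_of_nonneg (fun _ => Real.exp_nonneg _) hsum] at hle
  exact ENNReal.ofReal_ne_top hle

theorem eventually_le_treeMass_of_root {μ0 : 𝒳 → ℝ} {𝒬 : 𝒳 → List 𝒳 → ℝ} (hμ : ∀ a, 0 ≤ μ0 a)
    (hQ : ∀ a c, 0 ≤ 𝒬 a c) (hQ1 : ∀ a, HasSum (𝒬 a) 1)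
    (hlen : ∀ a, Summable fun c : List 𝒳 => 𝒬 a c * (c.length : ℝ)) (hcrit : CriticalKernel 𝒬)
    {a : 𝒳} (hreach : ∀ b, 0 < matStar (meanMat 𝒬) b a) {ε : ℝ} (hε : 0 < ε) :
    ∀ᶠ n : ℕ in atTop, (∃ t : PTree 𝒳, t.size = n ∧ t.root = a ∧ 0 < mgwWeight μ0 𝒬 t) →
      ENNReal.ofReal (Real.exp (-(2 * ε * n))) ≤ treeMass (mgwWeight μ0 𝒬) n := by
  have hne {t : PTree 𝒳} (ht : 0 < mgwWeight μ0 𝒬 t) : offWeight (ennKernel 𝒬) t ≠ 0 := by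
    have := ofReal_mgwWeight hμ hQ t
    intro h
    rw [h, mul_zero, ENNReal.ofReal_eq_zero] at this
    linarith
  by_cases hex : ∃ t : PTree 𝒳, t.root = a ∧ 0 < mgwWeight μ0 𝒬 t
  swap
  · exact Eventually.of_forall fun n ⟨t, _, h⟩ => absurd ⟨t, h⟩ hex
  obtain ⟨t0, rfl, ht0⟩ := hex
  obtain ⟨d, hd, hret⟩ := exists_le_returnMass hQ hQ1 hlen hcrit (hne ht0) hreach hε
  have hres : ∀ r : Fin d, ∀ᶠ n : ℕ in atTop, n % d = r →
      (∃ t : PTree 𝒳, t.size = n ∧ t.root = t0.root ∧ 0 < mgwWeight μ0 𝒬 t) →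
      ENNReal.ofReal (Real.exp (-(2 * ε * n))) ≤ treeMass (mgwWeight μ0 𝒬) n := by
    intro r
    by_cases hr : ∃ t : PTree 𝒳, t.size % d = r ∧ t.root = t0.root ∧ 0 < mgwWeight μ0 𝒬 t
    swap
    · refine Eventually.of_forall fun n hn ⟨t, h1, h2⟩ => absurd ⟨t, ?_, h2⟩ hr
      rw [h1, hn]
    obtain ⟨t, hmod, hroot, htpos⟩ := hr
    filter_upwards [eventually_ge_atTop t.size, eventually_mul_exp_neg_le htpos hε]
      with n hn hexp hnr _
    obtain ⟨k, hk⟩ := (Nat.modEq_iff_dvd' hn).1 (hmod.trans hnr.symm)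
    have hnk : k * d + t.size = n := by rw [mul_comm, ← hk]; omega
    have hmain := mul_le_mul_treeMass hμ hQ t (k * d)
    rw [hnk, hroot] at hmain
    have hn0 : (n : ℝ≥0∞) ≠ 0 := by
      have := t.size_pos
      exact_mod_cast (by omega : n ≠ 0)
    rw [← ENNReal.mul_le_mul_iff_right hn0 (ENNReal.natCast_ne_top n)]
    refine le_trans ?_ hmain
    refine le_trans ?_ (mul_le_mul_left
      ((pow_le_pow_left₀ zero_le hret k).trans (returnMass_pow_le _ _ _ _)) _)
    rw [← ENNReal.ofReal_natCast, ← ENNReal.ofReal_mul (Nat.cast_nonneg n),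
      ← ENNReal.ofReal_pow (Real.exp_nonneg _), ← ENNReal.ofReal_mul (by positivity)]
    refine ENNReal.ofReal_le_ofReal (hexp.trans ?_)
    rw [mul_comm, ← Real.exp_nat_mul]
    refine mul_le_mul_of_nonneg_right (Real.exp_le_exp.2 ?_) htpos.le
    have : ((k * d : ℕ) : ℝ) ≤ n := by exact_mod_cast (by omega : k * d ≤ n)
    push_cast at this
    nlinarith
  filter_upwards [eventually_all.2 hres] with n hn
  exact hn ⟨n % d, Nat.mod_lt _ hd⟩ rfl

theorem eventually_le_treeMass {μ0 : 𝒳 → ℝ} {𝒬 : 𝒳 → List 𝒳 → ℝ} (hμ : ∀ a, 0 ≤ μ0 a)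
    (hQ : ∀ a c, 0 ≤ 𝒬 a c) (hQ1 : ∀ a, HasSum (𝒬 a) 1)
    (hlen : ∀ a, Summable fun c : List 𝒳 => 𝒬 a c * (c.length : ℝ)) (hcrit : CriticalKernel 𝒬)
    {Xr Xt : Finset 𝒳} (hWI : WeaklyIrred (meanMat 𝒬) Xr Xt) (htrans : BoundedTransient 𝒬 Xt)
    {ε : ℝ} (hε : 0 < ε) :
    ∀ᶠ n : ℕ in atTop, n ∈ sizeSupport (mgwWeight μ0 𝒬) →
      ENNReal.ofReal (Real.exp (-(ε * n))) ≤ treeMass (mgwWeight μ0 𝒬) n := by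
  obtain ⟨N, hN⟩ := exists_size_le_of_transient hWI htrans
  have hall : ∀ a : Xr, ∀ᶠ n : ℕ in atTop,
      (∃ t : PTree 𝒳, t.size = n ∧ t.root = a ∧ 0 < mgwWeight μ0 𝒬 t) →
      ENNReal.ofReal (Real.exp (-(2 * (ε / 2) * n))) ≤ treeMass (mgwWeight μ0 𝒬) n := fun a =>
    eventually_le_treeMass_of_root hμ hQ hQ1 hlen hcrit
      (fun b => hWI.rec_pos b a a.2) (half_pos hε)
  filter_upwards [eventually_all.2 hall, eventually_gt_atTop N] with n hn hnN hnS
  obtain ⟨t, ht⟩ : ∃ t : PTree 𝒳, t.size = n ∧ 0 < mgwWeight μ0 𝒬 t := by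
    by_contra! h
    refine (show 0 < treeMass (mgwWeight μ0 𝒬) n from hnS).ne' ?_
    refine ENNReal.tsum_eq_zero.2 fun t => ?_
    split_ifs with hs
    · exact ENNReal.ofReal_eq_zero.2 (h t hs)
    · rfl
  have hroot : t.root ∈ Xr := by
    rw [hWI.compl]
    intro hr
    have hw := ofReal_mgwWeight hμ hQ t
    refine (hN t (fun h => ?_) hr).not_gt (ht.1 ▸ hnN)
    rw [h, mul_zero, ENNReal.ofReal_eq_zero] at hw
    exact hw.not_gt ht.2
  have := hn ⟨t.root, hroot⟩ ⟨t, ht.1, rfl, ht.2⟩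
  rwa [mul_div_cancel₀ _ two_ne_zero] at this

end SizeLowerBound

section Superlinear

variable {𝒳 : Type*} [Fintype 𝒳]

/-- If all exponential moments of the offspring number are finite, then so is `E exp φ` for some
superlinear `φ`. -/
theorem exists_superlinear {𝒬 : 𝒳 → List 𝒳 → ℝ} (hQ : ∀ a c, 0 ≤ 𝒬 a c)
    (hQ1 : ∀ a, HasSum (𝒬 a) 1)
    (hexp : ∀ (a : 𝒳) (η : ℝ), 0 < η →
      Summable fun c : List 𝒳 => 𝒬 a c * Real.exp (η * c.length)) :
    ∃ φ : ℕ → ℝ, (∀ k, 0 ≤ φ k) ∧ (∀ l : ℕ, ∃ B, ∀ k : ℕ, (l : ℝ) * k ≤ φ k + B) ∧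
      ∃ L, 0 ≤ L ∧ ∀ a, ∑' c : List 𝒳, ennKernel 𝒬 a c * ENNReal.ofReal (Real.exp (φ c.length)) ≤
        ENNReal.ofReal (Real.exp L) := by
  have hsum (a : 𝒳) (l : ℕ) : Summable fun c : List 𝒳 => 𝒬 a c * Real.exp (l * c.length) := by
    rcases Nat.eq_zero_or_pos l with rfl | hl
    · simpa using (hQ1 a).summable
    · exact hexp a l (by exact_mod_cast hl)
  have hnn (a : 𝒳) (l : ℕ) (c : List 𝒳) : 0 ≤ 𝒬 a c * Real.exp (l * c.length) :=
    mul_nonneg (hQ a c) (Real.exp_nonneg _)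
  let E : ℕ → ℝ := fun l => ∑ a, ∑' c : List 𝒳, 𝒬 a c * Real.exp (l * c.length)
  have hE (l : ℕ) : 0 ≤ E l := Finset.sum_nonneg fun a _ => tsum_nonneg (hnn a l)
  let w : ℕ → ℝ := fun l => (l.factorial : ℝ)⁻¹ * (1 + E l)⁻¹
  have hfac (l : ℕ) : (0 : ℝ) < (l.factorial : ℝ)⁻¹ := by positivity
  have hEpos (l : ℕ) : 0 < (1 + E l)⁻¹ := inv_pos.2 (by linarith [hE l])
  have hw (l : ℕ) : 0 < w l := mul_pos (hfac l) (hEpos l)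
  have hwE (l : ℕ) : w l * E l ≤ (l.factorial : ℝ)⁻¹ := by
    rw [mul_assoc]
    refine mul_le_of_le_one_right (hfac l).le ?_
    rw [inv_mul_le_one₀ (by linarith [hE l])]
    linarith
  have hwle (l : ℕ) : w l ≤ (l.factorial : ℝ)⁻¹ :=
    mul_le_of_le_one_right (hfac l).le (inv_le_one_of_one_le₀ (by linarith [hE l]))
  have hterm (k : ℕ) : Summable fun l : ℕ => w l * Real.exp (l * k) := by
    refine Summable.of_nonneg_of_le (fun l => mul_nonneg (hw l).le (Real.exp_nonneg _))
      (fun l => ?_) (Real.summable_pow_div_factorial (Real.exp k))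
    rw [← Real.exp_nat_mul, div_eq_inv_mul]
    exact mul_le_mul_of_nonneg_right (hwle l) (Real.exp_nonneg _)
  have htnn (k l : ℕ) : 0 ≤ w l * Real.exp (l * k) := mul_nonneg (hw l).le (Real.exp_nonneg _)
  let G : ℕ → ℝ := fun k => 1 + ∑' l : ℕ, w l * Real.exp (l * k)
  have hG (k : ℕ) : 1 ≤ G k := le_add_of_nonneg_right (tsum_nonneg (htnn k))
  refine ⟨fun k => Real.log (G k), fun k => Real.log_nonneg (hG k), fun l => ⟨-Real.log (w l),
    fun k => ?_⟩, Real.log (1 + Real.exp 1), Real.log_nonneg (by linarith [Real.exp_pos 1]),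
    fun a => ?_⟩
  · have h1 : w l * Real.exp (l * k) ≤ G k :=
      ((hterm k).le_tsum l fun j _ => htnn k j).trans (by simp [G])
    have h2 := Real.log_le_log (mul_pos (hw l) (Real.exp_pos _)) h1
    rw [Real.log_mul (hw l).ne' (Real.exp_pos _).ne', Real.log_exp] at h2
    linarith
  · have hexpG (k : ℕ) : ENNReal.ofReal (Real.exp (Real.log (G k))) =
        1 + ∑' l : ℕ, ENNReal.ofReal (w l) * ENNReal.ofReal (Real.exp (l * k)) := by
      rw [Real.exp_log (by linarith [hG k]), ENNReal.ofReal_add zero_le_one (tsum_nonneg (htnn k)),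
        ENNReal.ofReal_one, ENNReal.ofReal_tsum_of_nonneg (htnn k) (hterm k)]
      simp_rw [ENNReal.ofReal_mul (hw _).le]
    rw [Real.exp_log (by linarith [Real.exp_pos 1]), ENNReal.ofReal_add zero_le_one
      (Real.exp_nonneg 1), ENNReal.ofReal_one]
    simp_rw [hexpG, mul_add, mul_one]
    rw [ENNReal.tsum_add]
    refine add_le_add ?_ ?_
    · rw [← ENNReal.ofReal_one, ← (hQ1 a).tsum_eq, ENNReal.ofReal_tsum_of_nonneg (hQ a)
        (hQ1 a).summable]
      rfl
    · simp_rw [← ENNReal.tsum_mul_left]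
      rw [ENNReal.tsum_comm]
      have hl (l : ℕ) : ∑' c : List 𝒳, ennKernel 𝒬 a c *
          (ENNReal.ofReal (w l) * ENNReal.ofReal (Real.exp (l * c.length))) ≤
          ENNReal.ofReal ((l.factorial : ℝ)⁻¹) := by
        have hcomm (c : List 𝒳) : ennKernel 𝒬 a c *
            (ENNReal.ofReal (w l) * ENNReal.ofReal (Real.exp (l * c.length))) =
            ENNReal.ofReal (w l) * ENNReal.ofReal (𝒬 a c * Real.exp (l * c.length)) := by
          rw [mul_left_comm, ennKernel, ENNReal.ofReal_mul (hQ a c)]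
        rw [tsum_congr hcomm, ENNReal.tsum_mul_left, ← ENNReal.ofReal_tsum_of_nonneg (hnn a l) (hsum a l),
          ← ENNReal.ofReal_mul (hw l).le]
        refine ENNReal.ofReal_le_ofReal ((mul_le_mul_of_nonneg_left ?_ (hw l).le).trans (hwE l))
        exact Finset.single_le_sum (f := fun a => ∑' c : List 𝒳, 𝒬 a c * Real.exp (l * c.length))
          (fun a _ => tsum_nonneg (hnn a l)) (Finset.mem_univ a)
      refine (ENNReal.tsum_le_tsum hl).trans ?_
      have hs := Real.summable_pow_div_factorial 1
      have he : Real.exp 1 = ∑' l : ℕ, (l.factorial : ℝ)⁻¹ := by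
        rw [Real.exp_eq_exp_ℝ, NormedSpace.exp_eq_tsum_div]
        simp
      rw [he, ENNReal.ofReal_tsum_of_nonneg (fun l => (hfac l).le) (by simpa using hs)]

theorem exists_mul_le_of_superlinear {φ : ℕ → ℝ}
    (hφ : ∀ l : ℕ, ∃ B, ∀ k : ℕ, (l : ℝ) * k ≤ φ k + B) {C η : ℝ} (hC : 0 ≤ C) (hη : 0 < η) :
    ∃ K : ℕ, ∀ k, K ≤ k → C * (1 + k) ≤ η * φ k := by
  obtain ⟨l, hl⟩ := exists_nat_ge ((2 * C + 1) / η)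
  rw [div_le_iff₀' hη] at hl
  obtain ⟨B, hB⟩ := hφ l
  obtain ⟨K, hK⟩ := exists_nat_ge (C + η * B)
  refine ⟨K, fun k hk => ?_⟩
  have h1 : (K : ℝ) ≤ k := by exact_mod_cast hk
  have h2 := mul_le_mul_of_nonneg_left (hB k) hη.le
  have h3 := mul_le_mul_of_nonneg_right hl (Nat.cast_nonneg (α := ℝ) k)
  nlinarith [mul_nonneg hC (Nat.cast_nonneg (α := ℝ) k)]

end Superlinear

section Compactness

variable {𝒳 : Type*}

/-- Subprobability vectors with a bounded integral of `φ(length)`. -/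
def momentBall (φ : ℕ → ℝ) (R : ℝ) : Set (𝒳 × List 𝒳 → ℝ) :=
  {ν | (∀ x, 0 ≤ ν x) ∧ (∀ s : Finset (𝒳 × List 𝒳), ∑ x ∈ s, ν x ≤ 1) ∧
    ∀ s : Finset (𝒳 × List 𝒳), ∑ x ∈ s, ν x * φ x.2.length ≤ R}

theorem isCompact_momentBall (φ : ℕ → ℝ) (R : ℝ) :
    IsCompact (momentBall φ R : Set (𝒳 × List 𝒳 → ℝ)) := by
  refine IsCompact.of_isClosed_subset
    (isCompact_univ_pi fun _ : 𝒳 × List 𝒳 => isCompact_Icc (a := (0 : ℝ)) (b := 1)) ?_ ?_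
  · simp only [momentBall, Set.ofPred_and, Set.ofPred_forall]
    refine IsClosed.inter (isClosed_iInter fun x => isClosed_le (by fun_prop) (by fun_prop))
      (IsClosed.inter ?_ ?_) <;>
    exact isClosed_iInter fun s => isClosed_le (by fun_prop) (by fun_prop)
  · rintro ν ⟨h0, h1, -⟩ x -
    exact ⟨h0 x, by simpa using h1 {x}⟩

variable {φ : ℕ → ℝ} {R : ℝ}

theorem summable_of_mem_momentBall (hφ : ∀ l : ℕ, ∃ B, ∀ k : ℕ, (l : ℝ) * k ≤ φ k + B)
    {ν : 𝒳 × List 𝒳 → ℝ} (hν : ν ∈ momentBall φ R) {f : 𝒳 × List 𝒳 → ℝ} {C : ℝ}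
    (hf : ∀ x, |f x| ≤ C * (1 + x.2.length)) : Summable fun x => ν x * f x := by
  obtain ⟨h0, h1, h2⟩ := hν
  obtain ⟨B, hB⟩ := hφ 1
  have hC : 0 ≤ C ∨ IsEmpty 𝒳 := by
    rcases isEmpty_or_nonempty 𝒳 with h | ⟨⟨a⟩⟩
    · exact Or.inr h
    · exact Or.inl (by simpa using (abs_nonneg _).trans (hf (a, [])))
  rcases hC with hC | hC
  swap
  · exact summable_empty
  have hs1 : Summable ν := summable_of_sum_le h0 h1
  have hs2 : Summable fun x : 𝒳 × List 𝒳 => ν x * (x.2.length : ℝ) := by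
    refine summable_of_sum_le (c := R + |B|) (fun x => mul_nonneg (h0 x) (Nat.cast_nonneg _))
      fun s => ?_
    have hle : ∑ x ∈ s, ν x * (x.2.length : ℝ) ≤ ∑ x ∈ s, (ν x * φ x.2.length + |B| * ν x) := by
      refine Finset.sum_le_sum fun x _ => ?_
      have h := hB x.2.length
      rw [Nat.cast_one, one_mul] at h
      nlinarith [mul_le_mul_of_nonneg_left (h.trans (add_le_add_right (le_abs_self B) _)) (h0 x)]
    rw [Finset.sum_add_distrib, ← Finset.mul_sum] at hle
    have := mul_le_of_le_one_right (abs_nonneg B) (h1 s)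
    linarith [h2 s]
  refine Summable.of_norm_bounded ((hs1.add hs2).mul_left C) fun x => ?_
  rw [Real.norm_eq_abs, abs_mul, abs_of_nonneg (h0 x)]
  nlinarith [mul_le_mul_of_nonneg_left (hf x) (h0 x)]

variable [Fintype 𝒳]

theorem continuousOn_tsum_momentBall
    (hφ : ∀ l : ℕ, ∃ B, ∀ k : ℕ, (l : ℝ) * k ≤ φ k + B) {f : 𝒳 × List 𝒳 → ℝ} {C : ℝ}
    (hC : 0 ≤ C) (hf : ∀ x, |f x| ≤ C * (1 + x.2.length)) :
    ContinuousOn (fun ν : 𝒳 × List 𝒳 → ℝ => ∑' x, ν x * f x) (momentBall φ R) := by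
  have hunif : TendstoUniformlyOn (fun (s : Finset (𝒳 × List 𝒳)) (ν : 𝒳 × List 𝒳 → ℝ) =>
      ∑ x ∈ s, ν x * f x) (fun ν => ∑' x, ν x * f x) atTop (momentBall φ R) := by
    rw [Metric.tendstoUniformlyOn_iff]
    intro ε hε
    obtain ⟨K, hK⟩ := exists_mul_le_of_superlinear hφ hC
      (show 0 < ε / (2 * (|R| + 1)) by positivity)
    have hfin : {x : 𝒳 × List 𝒳 | x.2.length < K}.Finite :=
      (Set.finite_univ.prod (List.finite_length_lt 𝒳 K)).subset fun x hx => ⟨trivial, hx⟩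
    classical
    filter_upwards [eventually_ge_atTop hfin.toFinset] with s hs ν hν
    have hlim := (summable_of_mem_momentBall hφ hν hf).hasSum
    refine lt_of_le_of_lt ?_ (half_lt_self hε)
    have hlim' : Tendsto (fun t => dist (∑ x ∈ t, ν x * f x) (∑ x ∈ s, ν x * f x)) atTop
        (nhds (dist (∑' x, ν x * f x) (∑ x ∈ s, ν x * f x))) := hlim.dist tendsto_const_nhds
    refine le_of_tendsto hlim' ?_
    filter_upwards [eventually_ge_atTop s] with t ht
    rw [Real.dist_eq, ← Finset.sum_sdiff ht, add_sub_cancel_right]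
    refine (Finset.abs_sum_le_sum_abs _ _).trans ?_
    have hle : ∑ x ∈ t \ s, |ν x * f x| ≤
        ∑ x ∈ t \ s, ε / (2 * (|R| + 1)) * (ν x * φ x.2.length) := by
      refine Finset.sum_le_sum fun x hx => ?_
      have hxK : K ≤ x.2.length := by
        by_contra h
        exact (Finset.mem_sdiff.1 hx).2 (hs (hfin.mem_toFinset.2 (not_le.1 h)))
      rw [abs_mul, abs_of_nonneg (hν.1 x), mul_left_comm]
      exact mul_le_mul_of_nonneg_left ((hf x).trans (hK _ hxK)) (hν.1 x)
    refine hle.trans ?_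
    rw [← Finset.mul_sum]
    have hR : ∑ x ∈ t \ s, ν x * φ x.2.length ≤ |R| + 1 :=
      (hν.2.2 _).trans ((le_abs_self R).trans (by linarith))
    refine (mul_le_mul_of_nonneg_left hR (by positivity)).trans (le_of_eq ?_)
    have : |R| + 1 ≠ 0 := by positivity
    field_simp
  exact hunif.continuousOn (Frequently.of_forall fun s => by fun_prop)

variable [DecidableEq 𝒳]

theorem exists_bound_of_mem_offTests {f : 𝒳 × List 𝒳 → ℝ} (hf : f ∈ offTests 𝒳) :
    ∃ C, 0 ≤ C ∧ ∀ x, |f x| ≤ C * (1 + x.2.length) := by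
  rcases hf with ⟨M, hM⟩ | ⟨a, b, rfl⟩
  · refine ⟨|M|, abs_nonneg M, fun x => (hM x).trans ((le_abs_self M).trans ?_)⟩
    exact le_mul_of_one_le_right (abs_nonneg M) (by simp)
  · refine ⟨1, zero_le_one, fun x => ?_⟩
    have h : (mult a x.2 : ℝ) ≤ x.2.length := by exact_mod_cast List.count_le_length
    dsimp only
    split_ifs
    · rw [mul_one, abs_of_nonneg (Nat.cast_nonneg _)]
      linarith
    · simp
      positivity

theorem isCompact_setOf_moment_le
    (hφ : ∀ l : ℕ, ∃ B, ∀ k : ℕ, (l : ℝ) * k ≤ φ k + B) :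
    IsCompact {ν : MSpace 𝒳 |
      ∀ s : Finset (𝒳 × List 𝒳), ∑ x ∈ s, ν.1 x * φ x.2.length ≤ R} := by
  let P : Set (𝒳 × List 𝒳 → ℝ) := momentBall φ R ∩ (fun ν => ∑' x, ν x * 1) ⁻¹' {1}
  have hP : IsCompact P := (isCompact_momentBall φ R).of_isClosed_subset
    ((continuousOn_tsum_momentBall hφ zero_le_one
      fun x => by simp).preimage_isClosed_of_isClosed
      (isCompact_momentBall φ R).isClosed isClosed_singleton) Set.inter_subset_left
  have hoff (ν : P) : IsOffMeasure ν.1 := by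
    obtain ⟨ν, hν, h1⟩ := ν
    refine ⟨hν.1, ?_, ?_⟩
    · have hs : Summable ν := by
        simpa using summable_of_mem_momentBall hφ hν (f := fun _ => 1) (C := 1) fun x => by simp
      rw [hs.hasSum_iff]
      simpa using h1
    · simpa only [mul_comm] using summable_of_mem_momentBall hφ hν
        (f := fun x => (x.2.length : ℝ)) (C := 1) fun x => by simp
  have : CompactSpace P := isCompact_iff_compactSpace.1 hP
  let ι : P → MSpace 𝒳 := fun ν => ⟨ν.1, hoff ν⟩
  have hcont : Continuous ι := by
    refine continuous_induced_rng.2 (continuous_pi fun f => ?_)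
    obtain ⟨C, hC, hfC⟩ := exists_bound_of_mem_offTests f.2
    exact ((continuousOn_tsum_momentBall hφ hC hfC).mono
      Set.inter_subset_left).domRestrict
  suffices h : {ν : MSpace 𝒳 |
      ∀ s : Finset (𝒳 × List 𝒳), ∑ x ∈ s, ν.1 x * φ x.2.length ≤ R} = Set.range ι from
    h ▸ isCompact_range hcont
  refine Set.ext fun ν => ?_
  constructor
  · intro hν
    refine ⟨⟨ν.1, ⟨ν.2.nonneg, fun s => ?_, hν⟩, ?_⟩, rfl⟩
    · exact sum_le_hasSum s (fun x _ => ν.2.nonneg x) ν.2.hasSum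
    · simpa using ν.2.hasSum.tsum_eq
  · rintro ⟨ν, rfl⟩
    exact ν.2.1.2.2

end Compactness

section ExponentialTilting

variable {𝒳 : Type*}

/-- The sum of `h` over the pairs (type, offspring) of all vertices of a tree. -/
noncomputable def PTree.offSum (h : 𝒳 × List 𝒳 → ℝ) (t : PTree 𝒳) : ℝ :=
  (t.subtrees.map fun s => h (s.root, s.childLabels)).sum

namespace PTree

theorem offSum_node (h : 𝒳 × List 𝒳 → ℝ) (a : 𝒳) (ts : List (PTree 𝒳)) :
    offSum h (node a ts) = h (a, ts.map root) + (ts.map (offSum h)).sum := by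
  simp only [offSum, subtrees_node, List.map_cons, List.sum_cons, List.map_flatten,
    List.sum_flatten, List.map_map]
  rfl

theorem offSum_sub_const (h : 𝒳 × List 𝒳 → ℝ) (L : ℝ) (t : PTree 𝒳) :
    offSum (fun x => h x - L) t = offSum h t - L * t.size := by
  rw [offSum, offSum, size]
  induction t.subtrees with
  | nil => simp
  | cons s l ih =>
    simp only [List.map_cons, List.sum_cons, ih, List.length_cons, Nat.cast_add, Nat.cast_one]
    ring

/-- Charging each vertex the costs of its children is charging each vertex its own cost, except
for the cost of the root. -/
theorem offSum_sub_sum_map (g : 𝒳 × List 𝒳 → ℝ) (U : 𝒳 → ℝ) (t : PTree 𝒳) :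
    offSum (fun x => g x - (x.2.map U).sum) t = offSum (fun x => g x - U x.1) t + U t.root := by
  induction t using PTree.induction_node with
  | h a ts ih =>
    rw [offSum_node, offSum_node, List.map_congr_left ih, List.sum_map_add, root, List.map_map]
    simp only [Function.comp_def]
    ring

end PTree

open PTree

theorem offWeight_mul_exp (q : 𝒳 → List 𝒳 → ℝ≥0∞) (h : 𝒳 × List 𝒳 → ℝ) (t : PTree 𝒳) :
    offWeight (fun a c => q a c * ENNReal.ofReal (Real.exp (h (a, c)))) t =
      offWeight q t * ENNReal.ofReal (Real.exp (offSum h t)) := by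
  rw [offWeight, offWeight, offSum]
  induction t.subtrees with
  | nil => simp
  | cons s l ih =>
    simp only [List.map_cons, List.prod_cons, List.sum_cons, ih, Real.exp_add,
      ENNReal.ofReal_mul (Real.exp_nonneg _)]
    ring

/-- The exponential moment of `offSum h`, summed over all root types. -/
noncomputable def tiltMass (𝒬 : 𝒳 → List 𝒳 → ℝ) (h : 𝒳 × List 𝒳 → ℝ) : ℝ≥0∞ :=
  ∑' t : PTree 𝒳, offWeight (ennKernel 𝒬) t * ENNReal.ofReal (Real.exp (offSum h t))

open Classical in
theorem tsum_ite_mgwWeight_le {μ0 : 𝒳 → ℝ} {𝒬 : 𝒳 → List 𝒳 → ℝ} (hμ : ∀ a, 0 ≤ μ0 a)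
    (hμ1 : ∀ a, μ0 a ≤ 1) (hQ : ∀ a c, 0 ≤ 𝒬 a c) {T : Finset (𝒳 × List 𝒳 → ℝ)} {α : ℝ}
    {E : Set (PTree 𝒳)} (hE : ∀ t ∈ E, ∃ h ∈ T, α * t.size ≤ offSum h t) (n : ℕ) :
    ∑' t : PTree 𝒳, (if t.size = n ∧ t ∈ E then ENNReal.ofReal (mgwWeight μ0 𝒬 t) else 0) ≤
      (∑ h ∈ T, tiltMass 𝒬 h) * ENNReal.ofReal (Real.exp (-(α * n))) := by
  simp_rw [tiltMass]
  rw [← Summable.tsum_finsetSum fun _ _ => ENNReal.summable, ← ENNReal.tsum_mul_right]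
  refine ENNReal.tsum_le_tsum fun t => ?_
  split_ifs with h
  swap
  · exact zero_le
  obtain ⟨rfl, ht⟩ := h
  obtain ⟨f, hf, hle⟩ := hE t ht
  calc ENNReal.ofReal (mgwWeight μ0 𝒬 t) ≤ offWeight (ennKernel 𝒬) t := by
        rw [ofReal_mgwWeight hμ hQ]
        exact mul_le_of_le_one_left' (ENNReal.ofReal_le_one.2 (hμ1 _))
    _ ≤ offWeight (ennKernel 𝒬) t * (ENNReal.ofReal (Real.exp (offSum f t)) *
          ENNReal.ofReal (Real.exp (-(α * t.size)))) := by
        refine le_mul_of_one_le_right' ?_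
        rw [← ENNReal.ofReal_mul (Real.exp_nonneg _), ← Real.exp_add, ENNReal.one_le_ofReal]
        exact Real.one_le_exp (by linarith)
    _ ≤ _ := by
        rw [← mul_assoc]
        refine mul_le_mul_left ?_ _
        exact Finset.single_le_sum (f := fun h => offWeight (ennKernel 𝒬) t *
          ENNReal.ofReal (Real.exp (offSum h t))) (fun _ _ => zero_le) hf

variable [Fintype 𝒳]

theorem tiltMass_ne_top_of_tsum_le_one {𝒬 : 𝒳 → List 𝒳 → ℝ} {h : 𝒳 × List 𝒳 → ℝ}
    (hh : ∀ a, ∑' c, ennKernel 𝒬 a c * ENNReal.ofReal (Real.exp (h (a, c))) ≤ 1) :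
    tiltMass 𝒬 h ≠ ∞ := by
  classical
  rw [tiltMass, ← tsum_congr (offWeight_mul_exp (ennKernel 𝒬) h)]
  exact ne_top_of_le_ne_top (ENNReal.natCast_ne_top _) (tsum_offWeight_le_card hh)

theorem tiltMass_sub_const_ne_top {𝒬 : 𝒳 → List 𝒳 → ℝ} {f : 𝒳 × List 𝒳 → ℝ} {L : ℝ}
    (hf : ∀ a, ∑' c, ennKernel 𝒬 a c * ENNReal.ofReal (Real.exp (f (a, c))) ≤
      ENNReal.ofReal (Real.exp L)) : tiltMass 𝒬 (fun x => f x - L) ≠ ∞ := by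
  refine tiltMass_ne_top_of_tsum_le_one fun a => ?_
  simp_rw [sub_eq_add_neg, Real.exp_add, ENNReal.ofReal_mul (Real.exp_nonneg _), ← mul_assoc]
  rw [ENNReal.tsum_mul_right]
  refine (mul_le_mul_left (hf a) _).trans ?_
  rw [← ENNReal.ofReal_mul (Real.exp_nonneg _), ← Real.exp_add]
  simp

theorem tiltMass_sub_sum_Ug_ne_top {𝒬 : 𝒳 → List 𝒳 → ℝ} (hQ : ∀ a c, 0 ≤ 𝒬 a c)
    (hQ1 : ∀ a, HasSum (𝒬 a) 1) {g : 𝒳 × List 𝒳 → ℝ} {M : ℝ} (hg : ∀ x, |g x| ≤ M) :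
    tiltMass 𝒬 (fun x => g x - (x.2.map (Ug 𝒬 g)).sum) ≠ ∞ := by
  have hnn (a : 𝒳) (c : List 𝒳) : 0 ≤ 𝒬 a c * Real.exp (g (a, c)) :=
    mul_nonneg (hQ a c) (Real.exp_nonneg _)
  have hle (a : 𝒳) (c : List 𝒳) : 𝒬 a c * Real.exp (g (a, c)) ≤ 𝒬 a c * Real.exp M :=
    mul_le_mul_of_nonneg_left (Real.exp_le_exp.2 (abs_le.1 (hg _)).2) (hQ a c)
  have hsum (a : 𝒳) : Summable fun c => 𝒬 a c * Real.exp (g (a, c)) :=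
    Summable.of_nonneg_of_le (hnn a) (hle a) ((hQ1 a).summable.mul_right _)
  have hupper (a : 𝒳) : ∑' c, 𝒬 a c * Real.exp (g (a, c)) ≤ Real.exp M := by
    have h := (hsum a).tsum_le_tsum (hle a) ((hQ1 a).summable.mul_right _)
    rwa [tsum_mul_right, (hQ1 a).tsum_eq, one_mul] at h
  have hpos (a : 𝒳) : 0 < ∑' c, 𝒬 a c * Real.exp (g (a, c)) := by
    have h := ((hQ1 a).summable.mul_right (Real.exp (-M))).tsum_le_tsum (fun c =>
      mul_le_mul_of_nonneg_left (Real.exp_le_exp.2 (abs_le.1 (hg (a, c))).1) (hQ a c)) (hsum a)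
    rw [tsum_mul_right, (hQ1 a).tsum_eq, one_mul] at h
    exact (Real.exp_pos _).trans_le h
  have hU (a : 𝒳) : Real.exp (Ug 𝒬 g a) = ∑' c, 𝒬 a c * Real.exp (g (a, c)) :=
    Real.exp_log (hpos a)
  have hUM (a : 𝒳) : Ug 𝒬 g a ≤ M := by
    rw [← Real.exp_le_exp, hU]
    exact hupper a
  have htilt : tiltMass 𝒬 (fun x => g x - Ug 𝒬 g x.1) ≠ ∞ := by
    refine tiltMass_ne_top_of_tsum_le_one fun a => ?_
    dsimp only
    simp_rw [sub_eq_add_neg, Real.exp_add, ENNReal.ofReal_mul (Real.exp_nonneg _), ← mul_assoc]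
    simp only [ennKernel, ← ENNReal.ofReal_mul (hQ a _)]
    rw [ENNReal.tsum_mul_right, ← ENNReal.ofReal_tsum_of_nonneg (hnn a) (hsum a), ← hU,
      ← ENNReal.ofReal_mul (Real.exp_nonneg _), ← Real.exp_add]
    simp
  refine ne_top_of_le_ne_top (ENNReal.mul_ne_top htilt
    (ENNReal.ofReal_ne_top (r := Real.exp M))) ?_
  rw [tiltMass, tiltMass, ← ENNReal.tsum_mul_right]
  refine ENNReal.tsum_le_tsum fun t => ?_
  rw [offSum_sub_sum_map, Real.exp_add, ENNReal.ofReal_mul (Real.exp_nonneg _), ← mul_assoc]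
  exact mul_le_mul_right (ENNReal.ofReal_le_ofReal (Real.exp_le_exp.2 (hUM _))) _

end ExponentialTilting

section Covering

variable {𝒳 : Type*} [DecidableEq 𝒳]

theorem hasSum_empOff_mul (t : PTree 𝒳) (f : 𝒳 × List 𝒳 → ℝ) :
    HasSum (fun x => empOff t x * f x) (t.offSum f / t.size) := by
  have key (l : List (PTree 𝒳)) : HasSum (fun x : 𝒳 × List 𝒳 =>
      ((l.filter (fun s => s.root = x.1 ∧ s.childLabels = x.2)).length : ℝ) * f x)
      (l.map fun s => f (s.root, s.childLabels)).sum := by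
    induction l with
    | nil => simp
    | cons s l ih =>
      rw [List.map_cons, List.sum_cons]
      refine ((hasSum_ite_eq (s.root, s.childLabels) (f (s.root, s.childLabels))).add
        ih).congr_fun fun x => ?_
      rw [List.filter_cons]
      by_cases h : x = (s.root, s.childLabels)
      · subst h
        simp
        ring
      · have h' : ¬ (s.root = x.1 ∧ s.childLabels = x.2) := fun h' =>
          h (Prod.ext h'.1.symm h'.2.symm)
        simp [h, h']
  exact ((key t.subtrees).div_const (t.size : ℝ)).congr_fun fun x => (div_mul_eq_mul_div _ _ _)

variable [Fintype 𝒳]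

theorem MSpace.summable_mul_of_mem_offTests (ν : MSpace 𝒳) {f : 𝒳 × List 𝒳 → ℝ}
    (hf : f ∈ offTests 𝒳) : Summable fun x => ν.1 x * f x := by
  obtain ⟨C, -, hC⟩ := exists_bound_of_mem_offTests hf
  refine Summable.of_norm_bounded ((ν.2.hasSum.summable.add ν.2.moment).mul_left C) fun x => ?_
  rw [Real.norm_eq_abs, abs_mul, abs_of_nonneg (ν.2.nonneg x)]
  nlinarith [mul_le_mul_of_nonneg_left (hC x) (ν.2.nonneg x)]

theorem MSpace.continuous_tsum_of_mem_offTests {f : 𝒳 × List 𝒳 → ℝ} (hf : f ∈ offTests 𝒳) :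
    Continuous fun ν : MSpace 𝒳 => ∑' x, ν.1 x * f x := by
  have h : Continuous fun (ν : MSpace 𝒳) (f : offTests 𝒳) => ∑' x, ν.1 x * f.1 x :=
    continuous_induced_dom
  exact (continuous_apply (⟨f, hf⟩ : offTests 𝒳)).comp h

theorem MSpace.continuous_tsum_sub_sum_map {g : 𝒳 × List 𝒳 → ℝ} {M : ℝ} (hg : ∀ x, |g x| ≤ M)
    (U : 𝒳 → ℝ) :
    Continuous fun ν : MSpace 𝒳 => ∑' x, ν.1 x * (g x - (x.2.map U).sum) := by
  have hgt : g ∈ offTests 𝒳 := Or.inl ⟨M, hg⟩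
  have hmt (a b : 𝒳) : (fun x : 𝒳 × List 𝒳 => (mult a x.2 : ℝ) * (if x.1 = b then 1 else 0)) ∈
    offTests 𝒳 := Or.inr ⟨a, b, rfl⟩
  have heq (ν : MSpace 𝒳) : ∑' x, ν.1 x * (g x - (x.2.map U).sum) = ∑' x, ν.1 x * g x -
      ∑ a, ∑ b, U a * ∑' x, ν.1 x * ((mult a x.2 : ℝ) * (if x.1 = b then 1 else 0)) := by
    have hs (a b : 𝒳) := (ν.summable_mul_of_mem_offTests (hmt a b)).mul_left (U a)
    simp_rw [← tsum_mul_left]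
    rw [Finset.sum_congr rfl fun a _ => (Summable.tsum_finsetSum fun b _ => hs a b).symm,
      ← Summable.tsum_finsetSum fun a _ => summable_sum fun b _ => hs a b,
      ← (ν.summable_mul_of_mem_offTests hgt).tsum_sub
        (summable_sum fun a _ => summable_sum fun b _ => hs a b)]
    refine tsum_congr fun x => ?_
    rw [mul_sub, sum_map_eq_sum_mult, Finset.mul_sum]
    congr 1
    refine Finset.sum_congr rfl fun a _ => ?_
    rw [← Finset.mul_sum, ← Finset.mul_sum, ← Finset.mul_sum, Finset.sum_ite_eq]
    simp
    ring
  simp_rw [heq]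
  refine (continuous_tsum_of_mem_offTests hgt).sub (continuous_finsetSum _ fun a _ =>
    continuous_finsetSum _ fun b _ => (continuous_tsum_of_mem_offTests (hmt a b)).const_mul _)

/-- Trees whose empirical offspring measure lies in a closed set are covered by finitely many
half-spaces with finite exponential moments. -/
theorem exists_finset_tiltMass_ne_top {𝒬 : 𝒳 → List 𝒳 → ℝ} (hQ : ∀ a c, 0 ≤ 𝒬 a c)
    (hQ1 : ∀ a, HasSum (𝒬 a) 1)
    (hexp : ∀ (a : 𝒳) (η : ℝ), 0 < η →
      Summable fun c : List 𝒳 => 𝒬 a c * Real.exp (η * c.length))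
    {F : Set (MSpace 𝒳)} (hF : IsClosed F) {α : ℝ}
    (hα : (α : EReal) < ⨅ ν ∈ F, offRateVar 𝒬 ν.1) :
    ∃ T : Finset (𝒳 × List 𝒳 → ℝ), (∀ h ∈ T, tiltMass 𝒬 h ≠ ∞) ∧
      ∀ t : PTree 𝒳, (∃ h : IsOffMeasure (empOff t), (⟨empOff t, h⟩ : MSpace 𝒳) ∈ F) →
        ∃ h ∈ T, α * t.size ≤ t.offSum h := by
  classical
  obtain ⟨φ, hφ0, hφ, L, -, hφL⟩ := exists_superlinear hQ hQ1 hexp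
  have hg : ∀ ν ∈ F, ∃ g : 𝒳 × List 𝒳 → ℝ, (∃ M, ∀ x, |g x| ≤ M) ∧
      α < ∑' x, ν.1 x * (g x - (x.2.map (Ug 𝒬 g)).sum) := by
    intro ν hν
    obtain ⟨g, hg⟩ := lt_iSup_iff.1 (hα.trans_le (iInf₂_le ν hν))
    exact ⟨g.1, g.2, EReal.coe_lt_coe_iff.1 hg⟩
  choose! g hgM hgα using hg
  obtain ⟨s, hsF, hs⟩ := ((isCompact_setOf_moment_le (𝒳 := 𝒳) (R := α + L) hφ).inter_left
    hF).elim_nhds_subcover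
    (fun ν => {ν' : MSpace 𝒳 | α < ∑' x, ν'.1 x * (g ν x - (x.2.map (Ug 𝒬 (g ν))).sum)})
    fun ν hν => by
      obtain ⟨M, hM⟩ := hgM ν hν.1
      exact (isOpen_lt continuous_const
        (MSpace.continuous_tsum_sub_sum_map hM _)).mem_nhds (hgα ν hν.1)
  refine ⟨insert (fun x => φ x.2.length - L)
    (s.image fun ν x => g ν x - (x.2.map (Ug 𝒬 (g ν))).sum), ?_, ?_⟩
  · intro h hh
    rcases Finset.mem_insert.1 hh with rfl | hh
    · exact tiltMass_sub_const_ne_top (f := fun x => φ x.2.length) hφL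
    · obtain ⟨ν, hν, rfl⟩ := Finset.mem_image.1 hh
      obtain ⟨M, hM⟩ := hgM ν (hsF ν hν).1
      exact tiltMass_sub_sum_Ug_ne_top hQ hQ1 hM
  · rintro t ⟨hoff, htF⟩
    have hsize : (0 : ℝ) < t.size := by exact_mod_cast t.size_pos
    by_cases hK : ∀ s : Finset (𝒳 × List 𝒳), ∑ x ∈ s, empOff t x * φ x.2.length ≤ α + L
    · obtain ⟨ν, hν, hlt⟩ := Set.mem_iUnion₂.1 (hs ⟨htF, hK⟩)
      refine ⟨_, Finset.mem_insert_of_mem (Finset.mem_image_of_mem _ hν), ?_⟩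
      replace hlt : α < ∑' x, empOff t x * (g ν x - (x.2.map (Ug 𝒬 (g ν))).sum) := hlt
      rw [(hasSum_empOff_mul t _).tsum_eq, lt_div_iff₀ hsize] at hlt
      exact hlt.le
    · push Not at hK
      obtain ⟨r, hr⟩ := hK
      refine ⟨_, Finset.mem_insert_self _ _, ?_⟩
      have h := hr.trans_le (sum_le_hasSum r
        (fun x _ => mul_nonneg (hoff.nonneg x) (hφ0 _)) (hasSum_empOff_mul t _))
      rw [lt_div_iff₀ hsize] at h
      rw [PTree.offSum_sub_const (fun x => φ x.2.length)]
      linarith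

end Covering

section LogarithmicAsymptotics

theorem elog_le_of_le_exp {x : ℝ≥0∞} {r : ℝ} (h : x ≤ ENNReal.ofReal (Real.exp r)) :
    elog x ≤ r := by
  rw [elog]
  have hx : x ≠ ∞ := ne_top_of_le_ne_top ENNReal.ofReal_ne_top h
  split_ifs with h0
  · exact bot_le
  · rw [EReal.coe_le_coe_iff, Real.log_le_iff_le_exp (ENNReal.toReal_pos h0 hx)]
    exact ENNReal.toReal_le_of_le_ofReal (Real.exp_nonneg r) h

theorem inv_mul_elog_le {x : ℝ≥0∞} {z : ℝ} {n : ℕ} (hn : 0 < n)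
    (h : x ≤ ENNReal.ofReal (Real.exp (z * n))) :
    (((n : ℝ)⁻¹ : ℝ) : EReal) * elog x ≤ z := by
  have hn' : (n : ℝ) ≠ 0 := by positivity
  refine (mul_le_mul_of_nonneg_left (elog_le_of_le_exp h)
    (EReal.coe_nonneg.2 (by positivity))).trans (le_of_eq ?_)
  rw [← EReal.coe_mul]
  congr 1
  field_simp

theorem eventually_le_ofReal_exp_mul {C : ℝ≥0∞} (hC : C ≠ ∞) {ε : ℝ} (hε : 0 < ε) :
    ∀ᶠ n : ℕ in atTop, C ≤ ENNReal.ofReal (Real.exp (ε * n)) := by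
  have h : Tendsto (fun n : ℕ => Real.exp (ε * n)) atTop atTop :=
    Real.tendsto_exp_atTop.comp (tendsto_natCast_atTop_atTop.const_mul_atTop hε)
  filter_upwards [h.eventually_ge_atTop C.toReal] with n hn
  exact ENNReal.le_ofReal_iff_toReal_le hC (Real.exp_nonneg _) |>.2 hn

end LogarithmicAsymptotics

section Statement10

variable {𝒳 : Type*} [Fintype 𝒳] [DecidableEq 𝒳]

theorem variational_upper_bound_empirical_offspring_measure
    (𝒬 : 𝒳 → List 𝒳 → ℝ) (h𝒬_nonneg : ∀ a c, 0 ≤ 𝒬 a c) (h𝒬_sum : ∀ a, HasSum (𝒬 a) 1)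
    (hexp : ∀ (a : 𝒳) (η : ℝ), 0 < η →
      Summable (fun c : List 𝒳 => 𝒬 a c * Real.exp (η * c.length)))
    (Xr Xt : Finset 𝒳) (hWI : WeaklyIrred (meanMat 𝒬) Xr Xt)
    (htrans : BoundedTransient 𝒬 Xt)
    (hcrit : CriticalKernel 𝒬)
    (μ0 : 𝒳 → ℝ) (hμ0_nonneg : ∀ a, 0 ≤ μ0 a) (hμ0_sum : ∑ a, μ0 a = 1)
    (hμ0r : 0 < ∑ a ∈ Xr, μ0 a)
    (S : Set ℕ) (hS : S = sizeSupport (mgwWeight μ0 𝒬)) :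
    ∀ F : Set (MSpace 𝒳), IsClosed F →
      Filter.limsup
        (fun n : ℕ => (((n : ℝ)⁻¹ : ℝ) : EReal) *
          elog (condP (mgwWeight μ0 𝒬) n
            {t | ∃ h : IsOffMeasure (empOff t), (⟨empOff t, h⟩ : MSpace 𝒳) ∈ F}))
        (Filter.atTop ⊓ Filter.principal S)
        ≤ - ⨅ ν ∈ F, offRateVar 𝒬 ν.1 := by
  subst hS
  intro F hF
  have hμ1 (a : 𝒳) : μ0 a ≤ 1 :=
    hμ0_sum ▸ Finset.single_le_sum (fun b _ => hμ0_nonneg b) (Finset.mem_univ a)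
  have hlen (a : 𝒳) : Summable fun c : List 𝒳 => 𝒬 a c * (c.length : ℝ) :=
    summable_mul_length (h𝒬_nonneg a) (hexp a 1 one_pos)
  rw [← EReal.le_of_forall_lt_iff_le]
  intro z hz
  obtain ⟨α, hzα, hα⟩ := EReal.lt_iff_exists_real_btwn.1 (EReal.neg_lt_comm.1 hz)
  rw [← EReal.coe_neg, EReal.coe_lt_coe_iff] at hzα
  obtain ⟨T, hT, hcover⟩ := exists_finset_tiltMass_ne_top h𝒬_nonneg h𝒬_sum hexp hF hα
  have hε : 0 < (α + z) / 2 := by linarith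
  refine limsup_le_of_le (by isBoundedDefault) (eventually_inf_principal.2 ?_)
  filter_upwards [eventually_le_treeMass (μ0 := μ0) hμ0_nonneg h𝒬_nonneg h𝒬_sum hlen hcrit hWI
    htrans hε, eventually_le_ofReal_exp_mul (ENNReal.sum_ne_top.2 hT) hε,
    eventually_gt_atTop 0] with n hn hC hn0 hnS
  refine inv_mul_elog_le hn0 ?_
  refine (ENNReal.div_le_div (tsum_ite_mgwWeight_le hμ0_nonneg hμ1 h𝒬_nonneg hcover n)
    (hn hnS)).trans (ENNReal.div_le_of_le_mul ?_)
  refine (mul_le_mul_left hC _).trans (le_of_eq ?_)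
  rw [← ENNReal.ofReal_mul (Real.exp_nonneg _), ← ENNReal.ofReal_mul (Real.exp_nonneg _),
    ← Real.exp_add, ← Real.exp_add]
  congr 2
  ring

end Statement10
end

section
/- Let 𝒬 be the offspring kernel of a weakly irreducible, critical multitype Galton-Watson tree, O an open subset of ℳ(𝒳 × 𝒳*), and ν ∈ O with J(ν) < ∞. Then for every δ > 0 there exists ν̃ ∈ O with J(ν̃) ≤ J(ν) + δ, such that the 𝒳-marginal ν̃₁ is strictly positive and there is y > 0 with ν̃(c|a) ≤ 𝒬{c|a}/y for all (a,c) ∈ 𝒳 × 𝒳*, where ν̃(c|a) = ν̃(a,c)/ν̃₁(a). -/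
open scoped ENNReal NNReal BigOperators
open Filter

section RelativeEntropy

open InformationTheory

lemma relEnt_term_eq_mul_klFun {s t : ℝ} (ht : t ≠ 0) :
    s * Real.log (s / t) + t - s = t * klFun (s / t) := by
  rw [klFun_apply]
  field_simp

lemma relEnt_term_nonneg {s t : ℝ} (hs : 0 ≤ s) (ht : 0 ≤ t) (hst : t = 0 → s = 0) :
    0 ≤ s * Real.log (s / t) + t - s := by
  rcases ht.eq_or_lt' with h | h
  · simp [h, hst h]
  · rw [relEnt_term_eq_mul_klFun h.ne']
    exact mul_nonneg ht (klFun_nonneg (by positivity))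

lemma relEnt_term_add_le {s t r : ℝ} (hs : 0 ≤ s) (ht : 0 ≤ t) (hst : t = 0 → s = 0)
    (hr : 0 ≤ r) :
    (s + r) * Real.log ((s + r) / (t + r)) + (t + r) - (s + r) ≤
      s * Real.log (s / t) + t - s := by
  rcases ht.eq_or_lt' with h | h
  · rcases eq_or_ne r 0 with hr0 | hr0 <;> simp [h, hst h, hr0]
  · have htr : 0 < t + r := by positivity
    rw [relEnt_term_eq_mul_klFun htr.ne', relEnt_term_eq_mul_klFun h.ne']
    have hconv := convexOn_klFun.2 (show s / t ∈ Set.Ici 0 from Set.mem_Ici.2 (by positivity))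
      (show (1 : ℝ) ∈ Set.Ici 0 from Set.mem_Ici.2 zero_le_one)
      (show 0 ≤ t / (t + r) by positivity) (show 0 ≤ r / (t + r) by positivity)
      (by field_simp)
    have hpt : (t / (t + r)) • (s / t) + (r / (t + r)) • (1 : ℝ) = (s + r) / (t + r) := by
      simp only [smul_eq_mul]
      field_simp
    rw [hpt] at hconv
    simp only [smul_eq_mul, klFun_one, mul_zero, add_zero] at hconv
    calc (t + r) * klFun ((s + r) / (t + r))
        ≤ (t + r) * (t / (t + r) * klFun (s / t)) := by gcongr
      _ = t * klFun (s / t) := by field_simp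

variable {α : Type*} {ν ρ : α → ℝ}

lemma relEnt_mix_le {π : α → ℝ} {ε : ℝ} (hν : ∀ x, 0 ≤ ν x) (hρ : ∀ x, 0 ≤ ρ x)
    (hπ : ∀ x, 0 ≤ π x) (hε₀ : 0 < ε) (hε₁ : ε ≤ 1) :
    relEnt (fun x => (1 - ε) * ν x + ε * π x) (fun x => (1 - ε) * ρ x + ε * π x) ≤
      relEnt ν ρ := by
  by_cases hac : ∀ x, ρ x = 0 → ν x = 0
  swap
  · simp [relEnt, hac]
  have hε : 0 ≤ 1 - ε := by linarith
  have hac' : ∀ x, (1 - ε) * ρ x + ε * π x = 0 → (1 - ε) * ν x + ε * π x = 0 := by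
    intro x hx
    have h1 : 0 ≤ (1 - ε) * ρ x := mul_nonneg hε (hρ x)
    have h2 : 0 ≤ ε * π x := mul_nonneg hε₀.le (hπ x)
    have h3 : (1 - ε) * ρ x = 0 := by linarith
    have h4 : ε * π x = 0 := by linarith
    rcases mul_eq_zero.1 h3 with h | h
    · simp [h, h4]
    · simp [hac x h, h4]
  rw [relEnt, if_pos hac', relEnt, if_pos hac]
  refine ENNReal.tsum_le_tsum fun x => ENNReal.ofReal_le_ofReal ?_
  have hterm := relEnt_term_nonneg (hν x) (hρ x) (hac x)
  have hst : (1 - ε) * ρ x = 0 → (1 - ε) * ν x = 0 := by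
    intro h
    rcases mul_eq_zero.1 h with h | h
    · simp [h]
    · simp [hac x h]
  refine (relEnt_term_add_le (mul_nonneg hε (hν x)) (mul_nonneg hε (hρ x)) hst
    (mul_nonneg hε₀.le (hπ x))).trans ?_
  rcases eq_or_ne (1 - ε) 0 with h | h
  · simpa [h] using hterm
  · rw [mul_div_mul_left _ _ h]
    nlinarith

lemma absolutelyContinuous_of_relEnt_ne_top (h : relEnt ν ρ ≠ ∞) (x : α) (hx : ρ x = 0) :
    ν x = 0 := by
  by_contra hne
  exact h (if_neg fun hall => hne (hall x hx))

lemma summable_mul_log_of_relEnt_ne_top (hν : ∀ x, 0 ≤ ν x) (hρ : ∀ x, 0 ≤ ρ x)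
    (hνs : Summable ν) (hρs : Summable ρ) (h : relEnt ν ρ ≠ ∞) :
    Summable fun x => ν x * Real.log (ν x / ρ x) := by
  have hac := absolutelyContinuous_of_relEnt_ne_top h
  rw [relEnt, if_pos hac] at h
  have hs := ENNReal.summable_toReal h
  simp only [ENNReal.toReal_ofReal (relEnt_term_nonneg (hν _) (hρ _) (hac _))] at hs
  refine ((hs.sub hρs).add hνs).congr fun x => ?_
  ring

lemma relEnt_eq_ofReal_tsum {m : ℝ} (hν : ∀ x, 0 ≤ ν x) (hρ : ∀ x, 0 ≤ ρ x)
    (hac : ∀ x, ρ x = 0 → ν x = 0) (hνs : HasSum ν m) (hρs : HasSum ρ m)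
    (hlog : Summable fun x => ν x * Real.log (ν x / ρ x)) :
    relEnt ν ρ = ENNReal.ofReal (∑' x, ν x * Real.log (ν x / ρ x)) := by
  have hsum := (hlog.hasSum.add hρs).sub hνs
  rw [relEnt, if_pos hac, ← ENNReal.ofReal_tsum_of_nonneg
    (fun x => relEnt_term_nonneg (hν x) (hρ x) (hac x)) hsum.summable, hsum.tsum_eq]
  congr 1
  ring

end RelativeEntropy

section FiniteCorrection

/-- If `∑ x, ν x • T x = 0`, then the partial sums over finite sets can be compensated using
only finitely many points of the support of `ν`, with weights tending to zero. -/
lemma exists_finite_correction {α E : Type*} [NormedAddCommGroup E]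
    [NormedSpace ℝ E] [FiniteDimensional ℝ E] {ν : α → ℝ} {T : α → E}
    (h : HasSum (fun x => ν x • T x) 0) :
    ∃ (I : Finset α) (β : Finset α → α → ℝ), (∀ x ∈ I, ν x ≠ 0) ∧
      (∀ x, Tendsto (fun F => β F x) atTop (nhds 0)) ∧
      ∀ F, ∑ x ∈ I, β F x • T x = ∑ x ∈ F, ν x • T x := by
  classical
  obtain ⟨κ, a, ha, hspan, hli⟩ :=
    exists_linearIndependent' ℝ (fun x : {x // ν x ≠ 0} => T x)
  have := hli.finite
  have := Fintype.ofFinite κ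
  let Φ : (κ → ℝ) →ₗ[ℝ] E := Fintype.linearCombination ℝ fun k => T (a k)
  have hrange : LinearMap.range Φ = Submodule.span ℝ (Set.range fun x : {x // ν x ≠ 0} => T x) := by
    rw [← hspan]
    exact Fintype.range_linearCombination ℝ _
  obtain ⟨g₀, hg₀⟩ := Φ.rangeRestrict.exists_rightInverse_of_surjective Φ.range_rangeRestrict
  obtain ⟨g, hg⟩ := LinearMap.exists_extend g₀
  have hΦg : ∀ v ∈ LinearMap.range Φ, Φ (g v) = v := by
    intro v hv
    have h1 : g v = g₀ ⟨v, hv⟩ := by rw [← hg]; rfl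
    have h2 := congrArg Subtype.val (LinearMap.congr_fun hg₀ ⟨v, hv⟩)
    rw [h1]
    exact h2
  have hmem : ∀ F : Finset α, ∑ x ∈ F, ν x • T x ∈ LinearMap.range Φ := by
    intro F
    rw [hrange]
    refine Submodule.sum_mem _ fun x _ => ?_
    by_cases hx : ν x = 0
    · simp [hx]
    · exact Submodule.smul_mem _ _ (Submodule.subset_span ⟨⟨x, hx⟩, rfl⟩)
  refine ⟨Finset.univ.image fun k => (a k : α),
    fun F x => ∑ k, if (a k : α) = x then g (∑ z ∈ F, ν z • T z) k else 0, ?_, ?_, ?_⟩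
  · intro x hx
    obtain ⟨k, -, rfl⟩ := Finset.mem_image.1 hx
    exact (a k).2
  · intro x
    have hgt : Tendsto (fun F => g (∑ z ∈ F, ν z • T z)) atTop (nhds 0) := by
      have := (LinearMap.continuous_of_finiteDimensional g).tendsto 0
      rw [map_zero] at this
      exact this.comp h
    rw [tendsto_pi_nhds] at hgt
    have hterm : ∀ k, Tendsto (fun F => if (a k : α) = x then g (∑ z ∈ F, ν z • T z) k else 0)
        atTop (nhds 0) := by
      intro k
      split_ifs
      · exact hgt k
      · exact tendsto_const_nhds
    simpa using tendsto_finsetSum Finset.univ fun k _ => hterm k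
  · intro F
    have hinj : Function.Injective fun k => (a k : α) := Subtype.val_injective.comp ha
    rw [Finset.sum_image fun _ _ _ _ hxy => hinj hxy]
    simp only [hinj.eq_iff, Finset.sum_ite_eq', Finset.mem_univ, if_true]
    exact hΦg _ (hmem F)

lemma sum_truncate_smul {α M : Type*} [DecidableEq α] [AddCommGroup M] [Module ℝ M]
    {I F : Finset α} (hIF : I ⊆ F) (ν β : α → ℝ) (v : α → M) :
    ∑ x ∈ F, (if x ∈ F then ν x - (if x ∈ I then β x else 0) else 0) • v x =
      ∑ x ∈ F, ν x • v x - ∑ x ∈ I, β x • v x := by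
  have hI : ∑ x ∈ I, β x • v x = ∑ x ∈ F, (if x ∈ I then β x else 0) • v x := by
    rw [← Finset.sum_subset hIF fun x _ hx => by simp [hx]]
    exact Finset.sum_congr rfl fun x hx => by simp [hx]
  rw [hI, ← Finset.sum_sub_distrib]
  exact Finset.sum_congr rfl fun x hx => by simp [hx, sub_smul]

/-- A probability vector annihilating `T` is approximated by finitely supported probability
vectors annihilating `T`. -/
lemma exists_finitely_supported_approximation {α E : Type*} [NormedAddCommGroup E]
    [NormedSpace ℝ E] [FiniteDimensional ℝ E] {ν : α → ℝ} {T : α → E} (hν : ∀ x, 0 ≤ ν x)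
    (hν₁ : HasSum ν 1) (hT : HasSum (fun x => ν x • T x) 0) :
    ∃ μ : Finset α → α → ℝ, (∀ F, ∀ x ∉ F, μ F x = 0) ∧
      (∀ᶠ F in atTop, ∀ x, 0 ≤ μ F x) ∧
      (∀ᶠ F in atTop, ∑ x ∈ F, μ F x = 1) ∧
      (∀ᶠ F in atTop, ∑ x ∈ F, μ F x • T x = 0) ∧
      (∀ f : α → ℝ, Summable (fun x => ν x * f x) →
        Tendsto (fun F => ∑' x, μ F x * f x) atTop (nhds (∑' x, ν x * f x))) ∧
      ∀ c, 1 < c → ∀ᶠ F in atTop, ∀ x, μ F x ≤ c * ν x := by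
  classical
  obtain ⟨I, β, hI, hβ, hβT⟩ := exists_finite_correction hT
  let w : Finset α → α → ℝ := fun F x =>
    if x ∈ F then ν x - (if x ∈ I then β F x else 0) else 0
  let Z : Finset α → ℝ := fun F => ∑ x ∈ F, w F x
  have hIF : ∀ᶠ F in atTop, I ⊆ F := eventually_ge_atTop I
  have hsum : ∀ f : α → ℝ, Summable (fun x => ν x * f x) →
      Tendsto (fun F => ∑ x ∈ F, w F x * f x) atTop (nhds (∑' x, ν x * f x)) := by
    intro f hf
    have hcorr : Tendsto (fun F => ∑ x ∈ I, β F x * f x) atTop (nhds 0) := by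
      simpa using tendsto_finsetSum I fun x _ => (hβ x).mul_const (f x)
    have hlim := Tendsto.sub hf.hasSum hcorr
    rw [sub_zero] at hlim
    refine hlim.congr' ?_
    filter_upwards [hIF] with F hF
    exact (sum_truncate_smul hF ν (β F) f).symm
  have hZ : Tendsto Z atTop (nhds 1) := by
    simpa [hν₁.tsum_eq] using hsum (fun _ => 1) (by simpa using hν₁.summable)
  have hZpos : ∀ᶠ F in atTop, 0 < Z F := hZ.eventually_const_lt one_pos
  have hβν : ∀ᶠ F in atTop, ∀ x ∈ I, β F x < ν x :=
    (eventually_all_finset I).2 fun x hx =>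
      (hβ x).eventually_lt_const ((hν x).lt_of_ne' (hI x hx))
  refine ⟨fun F x => w F x / Z F, fun F x hx => by simp [w, hx], ?_, ?_, ?_, ?_, ?_⟩
  · filter_upwards [hZpos, hβν] with F hZF hβF x
    refine div_nonneg ?_ hZF.le
    simp only [w]
    split_ifs with h1 h2
    · linarith [hβF x h2]
    · simpa using hν x
    · exact le_rfl
  · filter_upwards [hZpos] with F hZF
    rw [← Finset.sum_div]
    exact div_self hZF.ne'
  · filter_upwards [hIF] with F hF
    simp only [div_eq_inv_mul, mul_smul, ← Finset.smul_sum]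
    rw [sum_truncate_smul hF ν (β F) T, hβT, sub_self, smul_zero]
  · intro f hf
    have hlim := (hsum f hf).div hZ one_ne_zero
    rw [div_one] at hlim
    refine hlim.congr fun F => ?_
    rw [tsum_eq_sum (s := F) fun x hx => by simp [w, hx], Pi.div_apply, Finset.sum_div]
    exact Finset.sum_congr rfl fun x _ => by ring
  · intro c hc
    have hx : ∀ᶠ F in atTop, ∀ x ∈ I, w F x / Z F < c * ν x := by
      refine (eventually_all_finset I).2 fun x hx => ?_
      have hpos : 0 < ν x := (hν x).lt_of_ne' (hI x hx)
      have hlim : Tendsto (fun F => (ν x - β F x) / Z F) atTop (nhds (ν x)) := by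
        have hdiv := ((tendsto_const_nhds (x := ν x)).sub (hβ x)).div hZ one_ne_zero
        rwa [sub_zero, div_one] at hdiv
      filter_upwards [hIF, hlim.eventually_lt_const (show ν x < c * ν x by nlinarith)]
        with F hF hlt
      simpa [w, hF hx, hx] using hlt
    have hcZ : Tendsto (fun F => c * Z F) atTop (nhds c) := by simpa using hZ.const_mul c
    filter_upwards [hx, hZpos, hcZ.eventually_const_lt hc] with F hxF hZF hcF x
    by_cases hxI : x ∈ I
    · exact (hxF x hxI).le
    · rw [div_le_iff₀ hZF]
      have hwx : w F x ≤ ν x := by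
        simp only [w, hxI, if_false, sub_zero]
        split_ifs
        exacts [le_rfl, hν x]
      nlinarith [hν x]

end FiniteCorrection

section OffspringMeasures

variable {𝒳 : Type*}

lemma marg1_mul_kernel {𝒬 : 𝒳 → List 𝒳 → ℝ} (h𝒬 : ∀ a, HasSum (𝒬 a) 1) (s : 𝒳 → ℝ) (a : 𝒳) :
    marg1 (fun x => s x.1 * 𝒬 x.1 x.2) a = s a := by
  simpa [marg1] using ((h𝒬 a).mul_left (s a)).tsum_eq

lemma marg1_nonneg {μ : 𝒳 × List 𝒳 → ℝ} (h : ∀ x, 0 ≤ μ x) (a : 𝒳) : 0 ≤ marg1 μ a :=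
  tsum_nonneg fun _ => h _

lemma le_marg1 {μ : 𝒳 × List 𝒳 → ℝ} (h : ∀ x, 0 ≤ μ x) (hs : Summable μ) (x : 𝒳 × List 𝒳) :
    μ x ≤ marg1 μ x.1 :=
  (hs.prod_factor x.1).le_tsum x.2 fun _ _ => h _

lemma IsOffMeasure.summable_mult [DecidableEq 𝒳] {μ : 𝒳 × List 𝒳 → ℝ} (h : IsOffMeasure μ)
    (a : 𝒳) :
    Summable fun x : 𝒳 × List 𝒳 => (mult a x.2 : ℝ) * μ x := by
  refine h.moment.of_nonneg_of_le (fun x => mul_nonneg (Nat.cast_nonneg _) (h.nonneg x))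
    fun x => ?_
  have : (mult a x.2 : ℝ) ≤ x.2.length := by exact_mod_cast List.count_le_length
  exact mul_le_mul_of_nonneg_right this (h.nonneg x)

lemma IsOffMeasure.mix {μ π : 𝒳 × List 𝒳 → ℝ} (hμ : IsOffMeasure μ) (hπ : IsOffMeasure π)
    {ε : ℝ} (h₀ : 0 ≤ ε) (h₁ : ε ≤ 1) : IsOffMeasure fun x => (1 - ε) * μ x + ε * π x where
  nonneg x := add_nonneg (mul_nonneg (by linarith) (hμ.nonneg x)) (mul_nonneg h₀ (hπ.nonneg x))
  hasSum := by simpa using (hμ.hasSum.mul_left (1 - ε)).add (hπ.hasSum.mul_left ε)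
  moment := ((hμ.moment.mul_left (1 - ε)).add (hπ.moment.mul_left ε)).congr fun x => by ring

lemma marg1_mix {μ π : 𝒳 × List 𝒳 → ℝ} (hμ : Summable μ) (hπ : Summable π) (ε : ℝ) (a : 𝒳) :
    marg1 (fun x => (1 - ε) * μ x + ε * π x) a = (1 - ε) * marg1 μ a + ε * marg1 π a :=
  (((hμ.prod_factor a).hasSum.mul_left (1 - ε)).add
    ((hπ.prod_factor a).hasSum.mul_left ε)).tsum_eq

lemma isOffMeasure_of_finite_support {μ : 𝒳 × List 𝒳 → ℝ} {F : Finset (𝒳 × List 𝒳)}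
    (hF : ∀ x ∉ F, μ x = 0) (h₀ : ∀ x, 0 ≤ μ x) (h₁ : ∑ x ∈ F, μ x = 1) : IsOffMeasure μ where
  nonneg := h₀
  hasSum := h₁ ▸ hasSum_sum_of_ne_finset_zero hF
  moment := (hasSum_sum_of_ne_finset_zero (s := F) fun x hx => by simp [hF x hx]).summable

lemma summable_length_of_exp {𝒬 : 𝒳 → List 𝒳 → ℝ} (h𝒬_nonneg : ∀ a c, 0 ≤ 𝒬 a c) {a : 𝒳}
    (h : Summable fun c : List 𝒳 => 𝒬 a c * Real.exp (1 * c.length)) :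
    Summable fun c : List 𝒳 => (c.length : ℝ) * 𝒬 a c := by
  refine h.of_nonneg_of_le (fun c => mul_nonneg (Nat.cast_nonneg _) (h𝒬_nonneg a c)) fun c => ?_
  rw [mul_comm, one_mul]
  exact mul_le_mul_of_nonneg_left
    ((le_add_of_nonneg_right zero_le_one).trans (Real.add_one_le_exp _)) (h𝒬_nonneg a c)

lemma exists_dominating_const {𝒬 : 𝒳 → List 𝒳 → ℝ}
    (h𝒬_nonneg : ∀ a c, 0 ≤ 𝒬 a c) {μ : 𝒳 × List 𝒳 → ℝ}
    (hμ : IsOffMeasure μ) {F : Finset (𝒳 × List 𝒳)} (hF : ∀ x ∉ F, μ x = 0)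
    (hac : ∀ a c, 𝒬 a c = 0 → μ (a, c) = 0) :
    ∃ y : ℝ, 0 < y ∧ ∀ a c, μ (a, c) / marg1 μ a ≤ 𝒬 a c / y := by
  have hsmall : ∀ᶠ y in nhdsWithin (0 : ℝ) (Set.Ioi 0),
      ∀ x ∈ F, 0 < 𝒬 x.1 x.2 → y < 𝒬 x.1 x.2 := by
    refine (eventually_all_finset F).2 fun x _ => ?_
    by_cases hx : 0 < 𝒬 x.1 x.2
    · filter_upwards [nhdsWithin_le_nhds (eventually_lt_nhds hx)] with y hy _
      exact hy
    · exact Eventually.of_forall fun y h => absurd h hx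
  obtain ⟨y, hy, hy₀⟩ := (hsmall.and self_mem_nhdsWithin).exists
  have hy₀ : 0 < y := hy₀
  refine ⟨y, hy₀, fun a c => ?_⟩
  rcases (h𝒬_nonneg a c).eq_or_lt' with h | h
  · simp [h, hac a c h]
  by_cases hx : (a, c) ∈ F
  · calc μ (a, c) / marg1 μ a ≤ 1 :=
          div_le_one_of_le₀ (le_marg1 hμ.nonneg hμ.hasSum.summable (a, c))
            (marg1_nonneg hμ.nonneg a)
      _ ≤ 𝒬 a c / y := (one_le_div hy₀).2 (hy _ hx h).le
  · rw [hF _ hx, zero_div]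
    positivity

lemma shiftInv_of_offRate_ne_top [DecidableEq 𝒳] {𝒬 : 𝒳 → List 𝒳 → ℝ}
    {μ : 𝒳 × List 𝒳 → ℝ} (h : offRate 𝒬 μ ≠ ∞) : ShiftInv μ := by
  by_contra hs
  exact h (if_neg hs)

variable [Fintype 𝒳] [DecidableEq 𝒳]

lemma hasSum_prod_of_fintype {f : 𝒳 × List 𝒳 → ℝ} {s : 𝒳 → ℝ}
    (h : ∀ a, HasSum (fun c => f (a, c)) (s a)) : HasSum f (∑ a, s a) := by
  have hfib : ∀ a, HasSum (fun x : 𝒳 × List 𝒳 => if x.1 = a then f x else 0) (s a) := by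
    intro a
    refine ((Prod.mk_right_injective a).hasSum_iff ?_).1 ?_
    · rintro ⟨b, c⟩ hx
      refine if_neg ?_
      rintro rfl
      exact hx ⟨c, rfl⟩
    · simpa [Function.comp_def] using h a
  simpa using hasSum_sum fun a (_ : a ∈ Finset.univ) => hfib a

lemma marg1_eq_tsum {μ : 𝒳 × List 𝒳 → ℝ} (h : Summable μ) (a : 𝒳) :
    marg1 μ a = ∑' x, μ x * (if x.1 = a then 1 else 0) := by
  have hs : ∀ b, HasSum (fun c => μ (b, c) * (if b = a then 1 else 0))
      (marg1 μ b * (if b = a then 1 else 0)) := fun b =>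
    (h.prod_factor b).hasSum.mul_right _
  have := hasSum_prod_of_fintype (f := fun x => μ x * (if x.1 = a then 1 else 0)) hs
  rw [this.tsum_eq]
  simp

lemma sum_marg1 {μ : 𝒳 × List 𝒳 → ℝ} (h : Summable μ) : ∑ a, marg1 μ a = ∑' x, μ x :=
  (hasSum_prod_of_fintype fun a => (h.prod_factor a).hasSum).tsum_eq.symm

lemma hasSum_mul_kernel {𝒬 : 𝒳 → List 𝒳 → ℝ} (h𝒬 : ∀ a, HasSum (𝒬 a) 1) (s : 𝒳 → ℝ) :
    HasSum (fun x : 𝒳 × List 𝒳 => s x.1 * 𝒬 x.1 x.2) (∑ a, s a) :=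
  hasSum_prod_of_fintype fun a => by simpa using (h𝒬 a).mul_left (s a)

lemma IsOffMeasure.summable_mul_test {μ : 𝒳 × List 𝒳 → ℝ} (h : IsOffMeasure μ)
    (f : offTests 𝒳) : Summable fun x => μ x * f.1 x := by
  obtain ⟨f, ⟨M, hM⟩ | ⟨a, b, rfl⟩⟩ := f
  · refine (h.hasSum.summable.mul_right M).of_norm_bounded fun x => ?_
    rw [norm_mul, Real.norm_of_nonneg (h.nonneg x)]
    exact mul_le_mul_of_nonneg_left (hM x) (h.nonneg x)
  · refine (h.summable_mult a).of_norm_bounded fun x => ?_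
    have hx := h.nonneg x
    dsimp only
    split_ifs
    · rw [Real.norm_of_nonneg (by positivity)]
      linarith
    · simp only [mul_zero, norm_zero]
      positivity

/-- Convergence of measures in `ℳ(𝒳 × 𝒳*)`, for families that are only eventually in the
space. -/
lemma eventually_mem_of_tendsto {ι : Type*} {l : Filter ι} {μ : ι → 𝒳 × List 𝒳 → ℝ}
    {O : Set (MSpace 𝒳)} (hO : IsOpen O) {ν : MSpace 𝒳} (hν : ν ∈ O)
    (h : ∀ f : offTests 𝒳, Tendsto (fun i => ∑' x, μ i x * f.1 x) l
      (nhds (∑' x, ν.1 x * f.1 x))) :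
    ∀ᶠ i in l, ∀ hi : IsOffMeasure (μ i), (⟨μ i, hi⟩ : MSpace 𝒳) ∈ O := by
  obtain ⟨U, hU, rfl⟩ := isOpen_induced_iff.1 hO
  filter_upwards [(tendsto_pi_nhds.2 h).eventually (hU.mem_nhds hν)] with i hi hμ
  exact hi

lemma isOffMeasure_mul_kernel {𝒬 : 𝒳 → List 𝒳 → ℝ} (h𝒬_nonneg : ∀ a c, 0 ≤ 𝒬 a c)
    (h𝒬_sum : ∀ a, HasSum (𝒬 a) 1)
    (h𝒬_length : ∀ a, Summable fun c : List 𝒳 => (c.length : ℝ) * 𝒬 a c)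
    {s : 𝒳 → ℝ} (hs : ∀ a, 0 ≤ s a) (hs₁ : ∑ a, s a = 1) :
    IsOffMeasure fun x : 𝒳 × List 𝒳 => s x.1 * 𝒬 x.1 x.2 where
  nonneg x := mul_nonneg (hs _) (h𝒬_nonneg _ _)
  hasSum := hs₁ ▸ hasSum_mul_kernel h𝒬_sum s
  moment := (hasSum_prod_of_fintype fun a =>
    (((h𝒬_length a).mul_left (s a)).congr fun c => by ring).hasSum).summable

lemma shiftInv_mul_kernel {𝒬 : 𝒳 → List 𝒳 → ℝ} (h𝒬_nonneg : ∀ a c, 0 ≤ 𝒬 a c)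
    (h𝒬_sum : ∀ a, HasSum (𝒬 a) 1)
    (h𝒬_length : ∀ a, Summable fun c : List 𝒳 => (c.length : ℝ) * 𝒬 a c)
    {s : 𝒳 → ℝ} (hs : ∀ a, ∑ b, meanMatR 𝒬 a b * s b = s a) :
    ShiftInv fun x : 𝒳 × List 𝒳 => s x.1 * 𝒬 x.1 x.2 := by
  intro a
  rw [marg1_mul_kernel h𝒬_sum, ← hs a]
  refine (hasSum_prod_of_fintype fun b => ?_).tsum_eq.symm
  have hsum : Summable fun c => 𝒬 b c * (mult a c : ℝ) := by
    refine (h𝒬_length b).of_nonneg_of_le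
      (fun c => mul_nonneg (h𝒬_nonneg b c) (Nat.cast_nonneg _)) fun c => ?_
    rw [mul_comm]
    have : (mult a c : ℝ) ≤ c.length := by exact_mod_cast List.count_le_length
    exact mul_le_mul_of_nonneg_right this (h𝒬_nonneg b c)
  refine (hsum.hasSum.mul_right (s b)).congr_fun fun c => ?_
  ring

end OffspringMeasures

section Approximation

variable {𝒳 : Type*} [Fintype 𝒳] [DecidableEq 𝒳] {𝒬 : 𝒳 → List 𝒳 → ℝ}

lemma shiftInv_iff_hasSum {μ : 𝒳 × List 𝒳 → ℝ} (h : IsOffMeasure μ) :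
    ShiftInv μ ↔
      HasSum (fun x => μ x • fun a => (if x.1 = a then (1 : ℝ) else 0) - mult a x.2) 0 := by
  rw [Pi.hasSum]
  refine forall_congr' fun a => ?_
  have hind : Summable fun x : 𝒳 × List 𝒳 => μ x * (if x.1 = a then 1 else 0) := by
    refine h.hasSum.summable.of_nonneg_of_le (fun x => ?_) fun x => ?_
    · have := h.nonneg x
      positivity
    · split_ifs <;> simp [h.nonneg x]
  have hsub := hind.hasSum.sub (h.summable_mult a).hasSum
  rw [← marg1_eq_tsum h.hasSum.summable] at hsub
  have heq : (fun x : 𝒳 × List 𝒳 => (μ x • fun a => (if x.1 = a then (1 : ℝ) else 0) -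
      mult a x.2) a) = fun x => μ x * (if x.1 = a then 1 else 0) - mult a x.2 * μ x := by
    funext x
    simp only [Pi.smul_apply, smul_eq_mul]
    ring
  rw [heq, Pi.zero_apply]
  refine ⟨fun hμ => ?_, fun hμ => sub_eq_zero.1 (hsub.unique hμ)⟩
  rwa [hμ, sub_self] at hsub

lemma ShiftInv.mix {μ π : 𝒳 × List 𝒳 → ℝ} (hμ : IsOffMeasure μ) (hπ : IsOffMeasure π)
    (hμs : ShiftInv μ) (hπs : ShiftInv π) {ε : ℝ} (h₀ : 0 ≤ ε) (h₁ : ε ≤ 1) :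
    ShiftInv fun x => (1 - ε) * μ x + ε * π x := by
  rw [shiftInv_iff_hasSum hμ] at hμs
  rw [shiftInv_iff_hasSum hπ] at hπs
  rw [shiftInv_iff_hasSum (hμ.mix hπ h₀ h₁)]
  simpa [add_smul, mul_smul] using (hμs.const_smul (1 - ε)).add (hπs.const_smul ε)

lemma exists_fully_supported_approximation (h𝒬_nonneg : ∀ a c, 0 ≤ 𝒬 a c)
    (h𝒬_sum : ∀ a, HasSum (𝒬 a) 1)
    (h𝒬_length : ∀ a, Summable fun c : List 𝒳 => (c.length : ℝ) * 𝒬 a c)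
    (hcrit : CriticalKernel 𝒬) {O : Set (MSpace 𝒳)} (hO : IsOpen O) {ν : MSpace 𝒳}
    (hν : ν ∈ O) (hfin : offRate 𝒬 ν.1 ≠ ∞) :
    ∃ μ ∈ O, offRate 𝒬 μ.1 ≤ offRate 𝒬 ν.1 ∧ (∀ a, 0 < marg1 μ.1 a) ∧
      ∀ a c, 0 < 𝒬 a c → 0 < μ.1 (a, c) := by
  obtain ⟨u, hu, hAu⟩ := hcrit
  have hne : (Finset.univ : Finset 𝒳).Nonempty := by
    by_contra hempty
    have h0 := sum_marg1 ν.2.hasSum.summable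
    rw [Finset.not_nonempty_iff_eq_empty.1 hempty, ν.2.hasSum.tsum_eq] at h0
    simp at h0
  have hU : 0 < ∑ a, u a := Finset.sum_pos (fun a _ => hu a) hne
  let s : 𝒳 → ℝ := fun a => u a / ∑ b, u b
  have hs : ∀ a, 0 < s a := fun a => div_pos (hu a) hU
  have hs₁ : ∑ a, s a = 1 := by rw [← Finset.sum_div, div_self hU.ne']
  have hAs : ∀ a, ∑ b, meanMatR 𝒬 a b * s b = s a := fun a => by
    simp only [s, ← mul_div_assoc, ← Finset.sum_div, hAu]
  let π : 𝒳 × List 𝒳 → ℝ := fun x => s x.1 * 𝒬 x.1 x.2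
  have hπ : IsOffMeasure π :=
    isOffMeasure_mul_kernel h𝒬_nonneg h𝒬_sum h𝒬_length (fun a => (hs a).le) hs₁
  have hπs : ShiftInv π := shiftInv_mul_kernel h𝒬_nonneg h𝒬_sum h𝒬_length hAs
  have hνs := shiftInv_of_offRate_ne_top hfin
  have hmem := eventually_mem_of_tendsto (l := nhdsWithin (0 : ℝ) (Set.Ioi 0))
    (μ := fun ε x => (1 - ε) * ν.1 x + ε * π x) hO hν fun f => by
      have heq : ∀ ε : ℝ, ∑' x, ((1 - ε) * ν.1 x + ε * π x) * f.1 x =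
          (1 - ε) * ∑' x, ν.1 x * f.1 x + ε * ∑' x, π x * f.1 x := fun ε => by
        rw [← (((ν.2.summable_mul_test f).hasSum.mul_left (1 - ε)).add
          ((hπ.summable_mul_test f).hasSum.mul_left ε)).tsum_eq]
        exact tsum_congr fun x => by ring
      simp only [heq]
      refine tendsto_nhdsWithin_of_tendsto_nhds ?_
      have hcont : Continuous fun ε : ℝ =>
        (1 - ε) * ∑' x, ν.1 x * f.1 x + ε * ∑' x, π x * f.1 x := by fun_prop
      simpa using hcont.tendsto 0
  obtain ⟨ε, hεO, hε⟩ := (hmem.and (Ioo_mem_nhdsGT one_pos)).exists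
  have hmix := ν.2.mix hπ hε.1.le hε.2.le
  have hε' : 0 ≤ 1 - ε := by linarith [hε.2]
  have hmarg : ∀ a, marg1 (fun x => (1 - ε) * ν.1 x + ε * π x) a =
      (1 - ε) * marg1 ν.1 a + ε * s a := fun a => by
    rw [marg1_mix ν.2.hasSum.summable hπ.hasSum.summable, marg1_mul_kernel h𝒬_sum]
  refine ⟨⟨_, hmix⟩, hεO hmix, ?_, fun a => ?_, fun a c hac => ?_⟩
  · rw [offRate, if_pos (hνs.mix ν.2 hπ hπs hε.1.le hε.2.le), offRate, if_pos hνs]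
    convert relEnt_mix_le (π := π) ν.2.nonneg
      (fun x => mul_nonneg (marg1_nonneg ν.2.nonneg x.1) (h𝒬_nonneg x.1 x.2)) hπ.nonneg
      hε.1 hε.2.le using 2
    funext x
    rw [hmarg]
    simp only [π]
    ring
  · rw [hmarg]
    exact add_pos_of_nonneg_of_pos (mul_nonneg hε' (marg1_nonneg ν.2.nonneg a))
      (mul_pos hε.1 (hs a))
  · exact add_pos_of_nonneg_of_pos (mul_nonneg hε' (ν.2.nonneg _))
      (mul_pos hε.1 (mul_pos (hs a) hac))

lemma exists_finitely_supported_offMeasure (h𝒬_nonneg : ∀ a c, 0 ≤ 𝒬 a c)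
    (h𝒬_sum : ∀ a, HasSum (𝒬 a) 1) {O : Set (MSpace 𝒳)} (hO : IsOpen O) {ν : MSpace 𝒳}
    (hν : ν ∈ O) (hfin : offRate 𝒬 ν.1 ≠ ∞) (hmarg : ∀ a, 0 < marg1 ν.1 a)
    (hpos : ∀ a c, 0 < 𝒬 a c → 0 < ν.1 (a, c)) {δ : ℝ} (hδ : 0 < δ) :
    ∃ μ ∈ O, offRate 𝒬 μ.1 ≤ offRate 𝒬 ν.1 + ENNReal.ofReal δ ∧ (∀ a, 0 < marg1 μ.1 a) ∧
      ∃ y : ℝ, 0 < y ∧ ∀ a c, μ.1 (a, c) / marg1 μ.1 a ≤ 𝒬 a c / y := by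
  have hνs := shiftInv_of_offRate_ne_top hfin
  have hνsum := ν.2.hasSum.summable
  rw [offRate, if_pos hνs] at hfin ⊢
  have hρ : ∀ {κ : 𝒳 × List 𝒳 → ℝ}, IsOffMeasure κ →
      HasSum (fun x : 𝒳 × List 𝒳 => marg1 κ x.1 * 𝒬 x.1 x.2) 1 := fun {κ} hκ => by
    rw [← hκ.hasSum.tsum_eq, ← sum_marg1 hκ.hasSum.summable]
    exact hasSum_mul_kernel h𝒬_sum _
  have hρ₀ : ∀ {κ : 𝒳 × List 𝒳 → ℝ}, IsOffMeasure κ → ∀ x : 𝒳 × List 𝒳,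
      0 ≤ marg1 κ x.1 * 𝒬 x.1 x.2 := fun hκ x =>
    mul_nonneg (marg1_nonneg hκ.nonneg _) (h𝒬_nonneg _ _)
  have hac := absolutelyContinuous_of_relEnt_ne_top hfin
  have hlog := summable_mul_log_of_relEnt_ne_top ν.2.nonneg (hρ₀ ν.2) hνsum
    (hρ ν.2).summable hfin
  rw [relEnt_eq_ofReal_tsum ν.2.nonneg (hρ₀ ν.2) hac ν.2.hasSum (hρ ν.2) hlog]
  obtain ⟨μ, hF, hμ₀, hμ₁, hμT, hlim, hdom⟩ := exists_finitely_supported_approximation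
    ν.2.nonneg ν.2.hasSum ((shiftInv_iff_hasSum ν.2).1 hνs)
  have hmem := eventually_mem_of_tendsto hO hν fun f => hlim f.1 (ν.2.summable_mul_test f)
  have hc : 1 < Real.exp (δ / 4) := Real.one_lt_exp_iff.2 (by positivity)
  have hlim_marg : ∀ a, ∀ᶠ F in atTop,
      marg1 ν.1 a / Real.exp (δ / 4) < ∑' x, μ F x * (if x.1 = a then 1 else 0) := by
    intro a
    refine (hlim _ ?_).eventually_const_lt ?_
    · exact ν.2.summable_mul_test ⟨fun x => if x.1 = a then 1 else 0,
        Or.inl ⟨1, fun x => by dsimp only; split_ifs <;> simp⟩⟩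
    · rw [← marg1_eq_tsum hνsum]
      exact div_lt_self (hmarg a) hc
  obtain ⟨F, hμO, hμ₀, hμ₁, hμT, hdomF, hmargF, hlogF⟩ := (hmem.and (hμ₀.and (hμ₁.and
    (hμT.and ((hdom _ hc).and ((eventually_all.2 hlim_marg).and
    ((hlim _ hlog).eventually_lt_const
      (lt_add_of_pos_right _ (half_pos hδ))))))))).exists
  have hμ := isOffMeasure_of_finite_support (hF F) hμ₀ hμ₁
  have hμs : ShiftInv (μ F) := by
    rw [shiftInv_iff_hasSum hμ, ← hμT]
    exact hasSum_sum_of_ne_finset_zero fun x hx => by rw [hF F x hx, zero_smul]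
  have hμmarg : ∀ a, marg1 ν.1 a / Real.exp (δ / 4) < marg1 (μ F) a := fun a => by
    rw [marg1_eq_tsum hμ.hasSum.summable]
    exact hmargF a
  have hμpos : ∀ a, 0 < marg1 (μ F) a := fun a =>
    (div_pos (hmarg a) (Real.exp_pos _)).trans (hμmarg a)
  have hμac : ∀ a c, 𝒬 a c = 0 → μ F (a, c) = 0 := fun a c h => by
    have h1 := hdomF (a, c)
    rw [hac (a, c) (by simp [h]), mul_zero] at h1
    exact le_antisymm h1 (hμ₀ _)
  refine ⟨⟨μ F, hμ⟩, hμO hμ, ?_, hμpos, exists_dominating_const h𝒬_nonneg hμ (hF F) hμac⟩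
  have hfinsum : ∀ f : 𝒳 × List 𝒳 → ℝ, Summable fun x => μ F x * f x := fun f =>
    (hasSum_sum_of_ne_finset_zero (s := F) fun x hx => by rw [hF F x hx, zero_mul]).summable
  rw [offRate, if_pos hμs, relEnt_eq_ofReal_tsum hμ₀ (hρ₀ hμ) (fun x hx => hμac _ _
    ((mul_eq_zero.1 hx).resolve_left (hμpos _).ne')) hμ.hasSum (hρ hμ) (hfinsum _)]
  refine (ENNReal.ofReal_le_ofReal ?_).trans ENNReal.ofReal_add_le
  have hbound : ∑' x, μ F x * Real.log (μ F x / (marg1 (μ F) x.1 * 𝒬 x.1 x.2)) ≤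
      ∑' x, (μ F x * Real.log (ν.1 x / (marg1 ν.1 x.1 * 𝒬 x.1 x.2)) + μ F x * (δ / 2)) := by
    refine (hfinsum _).tsum_le_tsum (fun x => ?_) ((hfinsum _).add (hfinsum _))
    rw [← mul_add]
    rcases (hμ₀ x).eq_or_lt' with h | h
    · simp [h]
    refine mul_le_mul_of_nonneg_left ?_ h.le
    have hq : 0 < 𝒬 x.1 x.2 := (h𝒬_nonneg _ _).lt_of_ne' fun hq => h.ne' (hμac _ _ hq)
    have hνx : 0 < ν.1 x := hpos _ _ hq
    have hm := hμpos x.1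
    have hn := hmarg x.1
    rw [show δ / 2 = Real.log (Real.exp (δ / 4) * Real.exp (δ / 4)) by
        rw [← Real.exp_add, Real.log_exp]; ring,
      ← Real.log_mul (by positivity) (by positivity)]
    refine Real.log_le_log (by positivity) ?_
    have hle := (div_lt_iff₀ (Real.exp_pos _)).1 (hμmarg x.1)
    rw [div_mul_eq_mul_div, div_le_div_iff₀ (by positivity) (by positivity)]
    calc μ F x * (marg1 ν.1 x.1 * 𝒬 x.1 x.2)
        ≤ (Real.exp (δ / 4) * ν.1 x) *
            ((marg1 (μ F) x.1 * Real.exp (δ / 4)) * 𝒬 x.1 x.2) := by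
          gcongr
          exact hdomF x
      _ = ν.1 x * (Real.exp (δ / 4) * Real.exp (δ / 4)) *
            (marg1 (μ F) x.1 * 𝒬 x.1 x.2) := by ring
  rw [(hfinsum _).tsum_add (hfinsum _), tsum_mul_right, hμ.hasSum.tsum_eq] at hbound
  linarith

end Approximation

section Statement13

variable {𝒳 : Type*} [Fintype 𝒳] [DecidableEq 𝒳]

theorem approximation_by_dominated_shift_invariant_measures
    (𝒬 : 𝒳 → List 𝒳 → ℝ) (h𝒬_nonneg : ∀ a c, 0 ≤ 𝒬 a c) (h𝒬_sum : ∀ a, HasSum (𝒬 a) 1)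
    (hexp : ∀ (a : 𝒳) (η : ℝ), 0 < η →
      Summable (fun c : List 𝒳 => 𝒬 a c * Real.exp (η * c.length)))
    (Xr Xt : Finset 𝒳) (hWI : WeaklyIrred (meanMat 𝒬) Xr Xt)
    (htrans : BoundedTransient 𝒬 Xt)
    (hcrit : CriticalKernel 𝒬)
    (O : Set (MSpace 𝒳)) (hO : IsOpen O) (ν : MSpace 𝒳) (hν : ν ∈ O)
    (hfin : offRate 𝒬 ν.1 ≠ ∞) :
    ∀ δ : ℝ, 0 < δ →
      ∃ νt : MSpace 𝒳, νt ∈ O ∧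
        offRate 𝒬 νt.1 ≤ offRate 𝒬 ν.1 + ENNReal.ofReal δ ∧
        (∀ a, 0 < marg1 νt.1 a) ∧
        ∃ y : ℝ, 0 < y ∧ ∀ (a : 𝒳) (c : List 𝒳),
          νt.1 (a, c) / marg1 νt.1 a ≤ 𝒬 a c / y := by
  intro δ hδ
  have h𝒬_length := fun a => summable_length_of_exp h𝒬_nonneg (hexp a 1 one_pos)
  obtain ⟨μ, hμO, hμJ, hμ₁, hμ⟩ := exists_fully_supported_approximation h𝒬_nonneg h𝒬_sum
    h𝒬_length hcrit hO hν hfin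
  obtain ⟨νt, hνtO, hνtJ, hνt⟩ := exists_finitely_supported_offMeasure h𝒬_nonneg h𝒬_sum hO hμO
    (ne_top_of_le_ne_top hfin hμJ) hμ₁ hμ hδ
  exact ⟨νt, hνtO, hνtJ.trans (by gcongr), hνt⟩

end Statement13
end

section
/- Let φ : 𝒳 → [0,∞) with z = ∑_b φ(b), and let q be the probability measure on 𝒳* given by q(c) = p(n) ∏_{i=1}^{n} q̂(a_i) for c = (n, a₁,…,a_n), where q̂ is a probability vector on the finite set 𝒳 and p is a probability measure on the nonnegative integers with mean one and all exponential moments finite. Define Ĩ(φ, q) = inf{ H(ν̃ ∥ q) : ν̃ ∈ ℳ(𝒳*), φ(b) = ∑_{c∈𝒳*} m(b,c) ν̃(c) for all b ∈ 𝒳 }. Then Ĩ(φ, q) = z H(φ/z ∥ q̂) + I_p(z), where I_p(z) = sup_λ {λz − log ∑_n p(n) e^{λn}} (and for z = 0 the first term is 0 and Ĩ(φ,q) = −log p(0) = I_p(0)). -/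
open scoped ENNReal NNReal BigOperators
open Filter

section Statement15

variable {𝒳 : Type*} [Fintype 𝒳] [DecidableEq 𝒳]

/-- Membership in `ℳ(𝒳*)`: a probability measure on `𝒳*` with finite mean length. -/
structure IsStarMeasure (ν : List 𝒳 → ℝ) : Prop where
  nonneg : ∀ c, 0 ≤ ν c
  hasSum : HasSum ν 1
  moment : Summable (fun c : List 𝒳 => (c.length : ℝ) * ν c)

/-- `Ĩ(φ, q) = inf { H(ν̃ ‖ q) : ν̃ ∈ ℳ(𝒳*), φ(b) = ∑_c m(b,c) ν̃(c) for all b }`. -/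
noncomputable def Itilde (φ : 𝒳 → ℝ) (q : List 𝒳 → ℝ) : ℝ≥0∞ :=
  ⨅ νt : {νt : List 𝒳 → ℝ // IsStarMeasure νt ∧
      ∀ b : 𝒳, φ b = ∑' c : List 𝒳, (mult b c : ℝ) * νt c},
    relEnt νt.1 q

/-- The product offspring law `q(c) = p(n) ∏_{i=1}^n q̂(a_i)` for `c = (n,a₁,…,a_n)`. -/
noncomputable def prodLaw (p : ℕ → ℝ) (qhat : 𝒳 → ℝ) (c : List 𝒳) : ℝ :=
  p c.length * (c.map qhat).prod

omit [DecidableEq 𝒳] in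
lemma List.sum_ofFn_succ_eq (n : ℕ) (F : List 𝒳 → ℝ) :
    ∑ f : Fin (n + 1) → 𝒳, F (List.ofFn f)
      = ∑ a, ∑ f : Fin n → 𝒳, F (a :: List.ofFn f) := by
  rw [← (Fin.consEquiv (fun _ => 𝒳)).sum_comp, Fintype.sum_prod_type]
  simp [List.ofFn_succ, Fin.consEquiv]

omit [DecidableEq 𝒳] in
lemma List.hasSum_of_hasSum_ofFn {F : List 𝒳 → ℝ} (hF : ∀ c, 0 ≤ F c) {A : ℝ}
    (h : HasSum (fun n : ℕ => ∑ f : Fin n → 𝒳, F (List.ofFn f)) A) : HasSum F A := by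
  rw [← List.equivSigmaTuple.symm.hasSum_iff]
  have hfib : ∀ n : ℕ, HasSum
      (fun f : Fin n → 𝒳 => (F ∘ List.equivSigmaTuple.symm) (⟨n, f⟩ : Σ n, Fin n → 𝒳))
      (∑ f : Fin n → 𝒳, F (List.ofFn f)) := fun n => hasSum_fintype _
  refine HasSum.sigma_of_hasSum h hfib ?_
  refine (summable_sigma_of_nonneg fun _ => hF _).2 ⟨fun n => (hfib n).summable, ?_⟩
  exact h.summable.congr fun n => (hfib n).tsum_eq.symm

omit [DecidableEq 𝒳] in
lemma sum_prod_map_ofFn {w : 𝒳 → ℝ} (hw : ∑ b, w b = 1) (n : ℕ) :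
    ∑ f : Fin n → 𝒳, ((List.ofFn f).map w).prod = 1 := by
  induction n with
  | zero => simp
  | succ n ih =>
    rw [List.sum_ofFn_succ_eq n (fun c => (c.map w).prod)]
    simp only [List.map_cons, List.prod_cons, ← Finset.mul_sum, ih, mul_one, hw]

lemma sum_mult_mul_prod_map_ofFn {w : 𝒳 → ℝ} (hw : ∑ b, w b = 1) (b : 𝒳) (n : ℕ) :
    ∑ f : Fin n → 𝒳, (mult b (List.ofFn f) : ℝ) * ((List.ofFn f).map w).prod = n * w b := by
  induction n with
  | zero => simp [mult]
  | succ n ih =>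
    rw [List.sum_ofFn_succ_eq n (fun c => (mult b c : ℝ) * (c.map w).prod)]
    have key : ∀ a : 𝒳, ∑ f : Fin n → 𝒳,
        (mult b (a :: List.ofFn f) : ℝ) * ((a :: List.ofFn f).map w).prod
        = w a * (n * w b) + if a = b then w a else 0 := by
      intro a
      have hterm : ∀ f : Fin n → 𝒳,
          (mult b (a :: List.ofFn f) : ℝ) * ((a :: List.ofFn f).map w).prod
          = w a * ((mult b (List.ofFn f) : ℝ) * ((List.ofFn f).map w).prod)
            + (if a = b then w a else 0) * ((List.ofFn f).map w).prod := by
        intro f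
        simp only [mult, List.count_cons, List.map_cons, List.prod_cons, beq_iff_eq]
        split_ifs <;> push_cast <;> ring
      simp only [hterm, Finset.sum_add_distrib, ← Finset.mul_sum, ih, sum_prod_map_ofFn hw, mul_one]
    simp only [key, Finset.sum_add_distrib, ← Finset.sum_mul, hw, Finset.sum_ite_eq',
      Finset.mem_univ, if_true]
    push_cast
    ring

omit [Fintype 𝒳] [DecidableEq 𝒳] in
lemma prodLaw_nonneg {p : ℕ → ℝ} (hp : ∀ n, 0 ≤ p n) {w : 𝒳 → ℝ} (hw : ∀ b, 0 ≤ w b)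
    (c : List 𝒳) : 0 ≤ prodLaw p w c :=
  mul_nonneg (hp _) (List.prod_nonneg (by simpa using fun a _ => hw a))

omit [DecidableEq 𝒳] in
lemma hasSum_prodLaw {p : ℕ → ℝ} (hp : ∀ n, 0 ≤ p n) {w : 𝒳 → ℝ} (hw : ∀ b, 0 ≤ w b)
    (hw1 : ∑ b, w b = 1) {A : ℝ} (hA : HasSum p A) : HasSum (prodLaw p w) A := by
  refine List.hasSum_of_hasSum_ofFn (prodLaw_nonneg hp hw) ?_
  simpa only [prodLaw, List.length_ofFn, ← Finset.mul_sum, sum_prod_map_ofFn hw1, mul_one] using hA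

lemma hasSum_mult_mul_prodLaw {p : ℕ → ℝ} (hp : ∀ n, 0 ≤ p n) {w : 𝒳 → ℝ} (hw : ∀ b, 0 ≤ w b)
    (hw1 : ∑ b, w b = 1) {z : ℝ} (hz : HasSum (fun n : ℕ => (n : ℝ) * p n) z) (b : 𝒳) :
    HasSum (fun c => (mult b c : ℝ) * prodLaw p w c) (z * w b) := by
  refine List.hasSum_of_hasSum_ofFn
    (fun c => mul_nonneg (Nat.cast_nonneg _) (prodLaw_nonneg hp hw c)) ?_
  have hterm : ∀ n : ℕ, ∑ f : Fin n → 𝒳, (mult b (List.ofFn f) : ℝ) * prodLaw p w (List.ofFn f)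
      = (n : ℝ) * p n * w b := by
    intro n
    simp only [prodLaw, List.length_ofFn, mul_left_comm _ (p n), ← Finset.mul_sum,
      sum_mult_mul_prod_map_ofFn hw1]
    ring
  simpa only [hterm] using hz.mul_right (w b)

omit [DecidableEq 𝒳] in
lemma isStarMeasure_prodLaw {p : ℕ → ℝ} (hp : ∀ n, 0 ≤ p n) (hp1 : HasSum p 1)
    (hmean : Summable (fun n : ℕ => (n : ℝ) * p n)) {w : 𝒳 → ℝ} (hw : ∀ b, 0 ≤ w b)
    (hw1 : ∑ b, w b = 1) : IsStarMeasure (prodLaw p w) where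
  nonneg := prodLaw_nonneg hp hw
  hasSum := hasSum_prodLaw hp hw hw1 hp1
  moment := by
    have h := (hasSum_prodLaw (fun n => mul_nonneg n.cast_nonneg (hp n)) hw hw1
      hmean.hasSum).summable
    exact h.congr fun c => by rw [prodLaw, prodLaw, mul_assoc]

lemma sum_mult (c : List 𝒳) : ∑ b, mult b c = c.length := by
  induction c with
  | nil => simp [mult]
  | cons a c ih =>
    simp only [mult] at ih
    simp [mult, List.count_cons, Finset.sum_add_distrib, ih]

lemma prod_map_eq_mul_exp {w v : 𝒳 → ℝ} (hw : ∀ b, 0 ≤ w b) (hv : ∀ b, 0 ≤ v b) {c : List 𝒳}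
    (hc : ∀ a ∈ c, w a ≠ 0 ∧ v a ≠ 0) :
    (c.map w).prod
      = (c.map v).prod * Real.exp (∑ b, (mult b c : ℝ) * Real.log (w b / v b)) := by
  induction c with
  | nil => simp [mult]
  | cons a c ih =>
    have ha := hc a (by simp)
    have hwa := lt_of_le_of_ne (hw a) ha.1.symm
    have hva := lt_of_le_of_ne (hv a) ha.2.symm
    have hsum : ∑ b, (mult b (a :: c) : ℝ) * Real.log (w b / v b)
        = ∑ b, (mult b c : ℝ) * Real.log (w b / v b) + Real.log (w a / v a) := by
      simp [mult, List.count_cons, Finset.sum_add_distrib, add_mul]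
    rw [hsum, Real.exp_add, Real.exp_log (div_pos hwa hva), List.map_cons, List.map_cons,
      List.prod_cons, List.prod_cons, ih fun x hx => hc x (by simp [hx])]
    field_simp

omit [Fintype 𝒳] in
lemma IsStarMeasure.summable_mult {ν : List 𝒳 → ℝ} (hν : IsStarMeasure ν) (b : 𝒳) :
    Summable (fun c => (mult b c : ℝ) * ν c) :=
  hν.moment.of_nonneg_of_le (fun c => mul_nonneg (Nat.cast_nonneg _) (hν.nonneg c))
    fun c => mul_le_mul_of_nonneg_right (by exact_mod_cast List.count_le_length) (hν.nonneg c)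

lemma IsStarMeasure.hasSum_mul_affine {ν : List 𝒳 → ℝ} (hν : IsStarMeasure ν) {φ : 𝒳 → ℝ}
    (hφ : ∀ b, φ b = ∑' c : List 𝒳, (mult b c : ℝ) * ν c) (C : ℝ) (L : 𝒳 → ℝ) :
    HasSum (fun c => ν c * (C + ∑ b, (mult b c : ℝ) * L b)) (C + ∑ b, φ b * L b) := by
  have h1 : HasSum (fun c => ∑ b, (mult b c : ℝ) * ν c * L b) (∑ b, φ b * L b) :=
    hasSum_sum fun b _ => by
      have := (hν.summable_mult b).hasSum
      rw [← hφ b] at this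
      exact this.mul_right (L b)
  have h2 := (hν.hasSum.mul_right C).add h1
  rw [one_mul] at h2
  refine h2.congr_fun fun c => ?_
  rw [mul_add, Finset.mul_sum]
  congr 1
  exact Finset.sum_congr rfl fun b _ => by ring

lemma mul_log_div_add_sub_nonneg {x y : ℝ} (hx : 0 ≤ x) (hy : 0 ≤ y) (hxy : y = 0 → x = 0) :
    0 ≤ x * Real.log (x / y) + y - x := by
  rcases hx.eq_or_lt with rfl | hx
  · simpa using hy
  have hy : 0 < y := lt_of_le_of_ne hy fun h => hx.ne' (hxy h.symm)
  have h := Real.log_le_sub_one_of_pos (div_pos hy hx)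
  rw [← inv_div, Real.log_inv] at h
  have h2 := mul_le_mul_of_nonneg_left h hx.le
  have h3 : x * ((x / y)⁻¹ - 1) = y - x := by field_simp
  linarith

lemma ofReal_le_tsum_ofReal {α : Type*} {u : α → ℝ} {s : ℝ} (hu : HasSum u s) :
    ENNReal.ofReal s ≤ ∑' a, ENNReal.ofReal (u a) := by
  have h : Tendsto (fun t : Finset α => ENNReal.ofReal (∑ a ∈ t, u a)) atTop
      (nhds (ENNReal.ofReal s)) := (ENNReal.continuous_ofReal.tendsto s).comp hu
  refine le_of_tendsto' h fun t => ?_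
  calc ENNReal.ofReal (∑ a ∈ t, u a) ≤ ∑ a ∈ t, ENNReal.ofReal (u a) :=
        Finset.le_sum_of_subadditive _ ENNReal.ofReal_zero.le (fun _ _ => ENNReal.ofReal_add_le) t u
    _ ≤ _ := ENNReal.sum_le_tsum t

lemma ofReal_le_relEnt {α : Type*} {ν q μ h : α → ℝ} (hν : ∀ a, 0 ≤ ν a)
    (hμ : ∀ a, 0 ≤ μ a) (hμq : ∀ a, ν a ≠ 0 → q a ≠ 0 → μ a = q a * Real.exp (h a))
    (hq1 : HasSum q 1) (hμ1 : HasSum μ 1) {s : ℝ} (hs : HasSum (fun a => ν a * h a) s) :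
    ENNReal.ofReal s ≤ relEnt ν q := by
  unfold relEnt
  split_ifs with hac
  swap
  · exact le_top
  have hu := (hs.add hq1).sub hμ1
  rw [add_sub_cancel_right] at hu
  refine (ofReal_le_tsum_ofReal hu).trans (ENNReal.tsum_le_tsum fun a => ENNReal.ofReal_le_ofReal ?_)
  by_cases hνa : ν a = 0
  · simpa [hνa] using hμ a
  have hqa : q a ≠ 0 := fun h0 => hνa (hac a h0)
  have hpos := mul_log_div_add_sub_nonneg (hν a) (hμ a)
    (fun h0 => absurd h0 (by rw [hμq a hνa hqa]; positivity))
  rw [hμq a hνa hqa, ← div_div, Real.log_div (div_ne_zero hνa hqa) (Real.exp_ne_zero _),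
    Real.log_exp] at hpos
  rw [hμq a hνa hqa]
  linarith

lemma relEnt_eq_ofReal {α : Type*} {ν q h : α → ℝ} (hν : ∀ a, 0 ≤ ν a) (hq : ∀ a, 0 ≤ q a)
    (hνq : ∀ a, ν a ≠ 0 → q a ≠ 0 ∧ ν a = q a * Real.exp (h a))
    (hν1 : HasSum ν 1) (hq1 : HasSum q 1) {s : ℝ} (hs : HasSum (fun a => ν a * h a) s) :
    0 ≤ s ∧ relEnt ν q = ENNReal.ofReal s := by
  have hac : ∀ a, q a = 0 → ν a = 0 := fun a h0 => by_contra fun h1 => (hνq a h1).1 h0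
  have hnn := fun a => mul_log_div_add_sub_nonneg (hν a) (hq a) (hac a)
  have hu : HasSum (fun a => ν a * Real.log (ν a / q a) + q a - ν a) s := by
    have hu := (hs.add hq1).sub hν1
    rw [add_sub_cancel_right] at hu
    refine hu.congr_fun fun a => ?_
    congr 2
    by_cases hνa : ν a = 0
    · simp [hνa]
    · obtain ⟨hqa, he⟩ := hνq a hνa
      rw [he, mul_div_cancel_left₀ _ hqa, Real.log_exp]
  refine ⟨hu.nonneg hnn, ?_⟩
  rw [relEnt, if_pos hac, ← ENNReal.ofReal_tsum_of_nonneg hnn hu.summable, hu.tsum_eq]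

section Cramer

variable {p : ℕ → ℝ} (hp : ∀ n, 0 ≤ p n) (hp1 : HasSum p 1)
  (hexp : ∀ lam : ℝ, Summable (fun n : ℕ => p n * Real.exp (lam * n)))

include hp hp1 in
lemma exists_pos_of_hasSum_one : ∃ n, 0 < p n := by
  by_contra! h
  have h0 : p = 0 := funext fun n => le_antisymm (h n) (hp n)
  rw [h0] at hp1
  exact zero_ne_one (hasSum_zero.unique hp1)

include hp hp1 hexp in
lemma tsum_mul_exp_pos (lam : ℝ) : 0 < ∑' n : ℕ, p n * Real.exp (lam * n) := by
  obtain ⟨n, hn⟩ := exists_pos_of_hasSum_one hp hp1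
  exact (hexp lam).tsum_pos (fun k => mul_nonneg (hp k) (Real.exp_pos _).le) n
    (mul_pos hn (Real.exp_pos _))

include hp hexp in
lemma summable_natCast_mul_mul_exp (lam : ℝ) :
    Summable (fun n : ℕ => (n : ℝ) * (p n * Real.exp (lam * n))) := by
  refine (hexp (lam + 1)).of_nonneg_of_le
    (fun n => mul_nonneg n.cast_nonneg (mul_nonneg (hp n) (Real.exp_pos _).le)) fun n => ?_
  have h1 : (n : ℝ) ≤ Real.exp n := by linarith [Real.add_one_le_exp (n : ℝ)]
  calc (n : ℝ) * (p n * Real.exp (lam * n))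
      ≤ Real.exp n * (p n * Real.exp (lam * n)) :=
        mul_le_mul_of_nonneg_right h1 (mul_nonneg (hp n) (Real.exp_pos _).le)
    _ = p n * Real.exp ((lam + 1) * n) := by rw [add_mul, one_mul, Real.exp_add]; ring

include hp hexp in
lemma hasDerivAt_tsum_mul_exp (lam : ℝ) :
    HasDerivAt (fun l : ℝ => ∑' n : ℕ, p n * Real.exp (l * n))
      (∑' n : ℕ, (n : ℝ) * (p n * Real.exp (lam * n))) lam := by
  refine hasDerivAt_tsum_of_isPreconnected (t := Set.Iio (lam + 1))
    (g := fun (n : ℕ) (l : ℝ) => p n * Real.exp (l * n))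
    (g' := fun (n : ℕ) (l : ℝ) => (n : ℝ) * (p n * Real.exp (l * n)))
    (summable_natCast_mul_mul_exp hp hexp (lam + 1)) isOpen_Iio isPreconnected_Iio
    (fun n l _ => ?_) (fun n l hl => ?_) (y₀ := lam) (by simp) (hexp lam) (by simp)
  · have h := (((hasDerivAt_id l).mul_const (n : ℝ)).exp).const_mul (p n)
    exact h.congr_deriv (by simp only [id]; ring)
  · have := hp n
    rw [Real.norm_of_nonneg (by positivity)]
    have hl : l ≤ lam + 1 := le_of_lt hl
    gcongr

lemma le_cramerRate (lam z : ℝ) :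
    ((lam * z - Real.log (∑' n : ℕ, p n * Real.exp (lam * n)) : ℝ) : EReal) ≤ cramerRate p z :=
  le_iSup (fun lam : ℝ =>
    ((lam * z - Real.log (∑' n : ℕ, p n * Real.exp (lam * n)) : ℝ) : EReal)) lam

include hp hexp in
/-- If `p` charges both sides of `z`, some exponential tilt of `p` has mean `z`. -/
lemma exists_tsum_natCast_mul_mul_exp_eq {z : ℝ} {m n : ℕ} (hm : z < m) (hpm : 0 < p m)
    (hn : (n : ℝ) < z) (hpn : 0 < p n) :
    ∃ lam : ℝ, ∑' k : ℕ, (k : ℝ) * (p k * Real.exp (lam * k))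
      = z * ∑' k : ℕ, p k * Real.exp (lam * k) := by
  set M : ℝ → ℝ := fun l => ∑' k : ℕ, p k * Real.exp (l * k) with hM
  set f : ℝ → ℝ := fun l => M l * Real.exp (-(l * z)) with hf
  have hder : ∀ l, HasDerivAt f ((∑' k : ℕ, (k : ℝ) * (p k * Real.exp (l * k)))
      * Real.exp (-(l * z)) + M l * (Real.exp (-(l * z)) * (-(1 * z)))) l := fun l =>
    (hasDerivAt_tsum_mul_exp hp hexp l).mul (((hasDerivAt_id l).mul_const z).neg.exp)
  have hcont : Continuous f := continuous_iff_continuousAt.2 fun l => (hder l).continuousAt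
  have hlow : ∀ (k : ℕ) (l : ℝ), p k * Real.exp (l * (k - z)) ≤ f l := by
    intro k l
    have h1 : p k * Real.exp (l * k) ≤ M l :=
      (hexp l).le_tsum k fun j _ => mul_nonneg (hp j) (Real.exp_pos _).le
    calc p k * Real.exp (l * (k - z)) = p k * Real.exp (l * k) * Real.exp (-(l * z)) := by
          rw [mul_assoc, ← Real.exp_add]; ring_nf
      _ ≤ f l := mul_le_mul_of_nonneg_right h1 (Real.exp_pos _).le
  have hlim : Tendsto f (cocompact ℝ) atTop := by
    rw [cocompact_eq_atBot_atTop, tendsto_sup]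
    constructor
    · refine tendsto_atTop_mono (hlow n) ((Real.tendsto_exp_atTop.comp ?_).const_mul_atTop hpn)
      exact tendsto_id.atBot_mul_const_of_neg (sub_neg.2 hn)
    · refine tendsto_atTop_mono (hlow m) ((Real.tendsto_exp_atTop.comp ?_).const_mul_atTop hpm)
      exact tendsto_id.atTop_mul_const (sub_pos.2 hm)
  obtain ⟨l, hl⟩ := hcont.exists_forall_le hlim
  have h0 := IsLocalMin.hasDerivAt_eq_zero (Eventually.of_forall hl) (hder l)
  refine ⟨l, ?_⟩
  have he := Real.exp_pos (-(l * z))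
  have : Real.exp (-(l * z)) * ((∑' k : ℕ, (k : ℝ) * (p k * Real.exp (l * k))) - z * M l) = 0 := by
    linarith
  rcases mul_eq_zero.1 this with h | h
  · exact absurd h he.ne'
  · linarith

include hp hp1 hexp in
/-- If `p` is carried by one side of `z` and the Cramér rate at `z` is finite, then `p` has an
atom at `z` whose mass is at least `exp (-I_p(z))`. -/
lemma exists_atom_of_one_sided {z s : ℝ} (hs : s ≠ 0)
    (hside : ∀ n : ℕ, p n ≠ 0 → s * (n - z) ≤ 0) (htop : cramerRate p z ≠ ⊤) :
    ∃ k : ℕ, (k : ℝ) = z ∧ 0 < p k ∧ ((-Real.log (p k) : ℝ) : EReal) ≤ cramerRate p z := by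
  have hbot : cramerRate p z ≠ ⊥ := fun h =>
    EReal.coe_ne_bot _ (le_bot_iff.1 (h ▸ le_cramerRate (p := p) 0 z))
  obtain ⟨v, hv⟩ : ∃ v : ℝ, cramerRate p z = v := ⟨_, (EReal.coe_toReal htop hbot).symm⟩
  set G : ℝ → ℝ := fun t => ∑' n : ℕ, p n * Real.exp (t * (s * (n - z))) with hG
  have hGlow : ∀ t, Real.exp (-v) ≤ G t := by
    intro t
    have h1 := le_cramerRate (p := p) (t * s) z
    rw [hv, EReal.coe_le_coe_iff] at h1
    have hMpos := tsum_mul_exp_pos hp hp1 hexp (t * s)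
    have h2 : G t = (∑' n : ℕ, p n * Real.exp (t * s * n)) * Real.exp (-(t * s * z)) := by
      rw [← tsum_mul_right]
      refine tsum_congr fun n => ?_
      rw [mul_assoc, ← Real.exp_add]
      ring_nf
    rw [h2, ← Real.exp_log hMpos, ← Real.exp_add]
    exact Real.exp_le_exp.2 (by linarith)
  have hGlim : Tendsto G atTop (nhds (∑' n : ℕ, if (n : ℝ) = z then p n else 0)) := by
    refine tendsto_tsum_of_dominated_convergence hp1.summable (fun n => ?_) ?_
    · split_ifs with hn
      · simp [hn]
      · by_cases hpn : p n = 0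
        · simp [hpn]
        · have hneg : s * (n - z) < 0 :=
            lt_of_le_of_ne (hside n hpn) (mul_ne_zero hs (sub_ne_zero.2 hn))
          simpa using (Real.tendsto_exp_atBot.comp
            (tendsto_id.atTop_mul_const_of_neg hneg)).const_mul (p n)
    · filter_upwards [eventually_ge_atTop 0] with t ht n
      rw [Real.norm_of_nonneg (mul_nonneg (hp n) (Real.exp_pos _).le)]
      by_cases hpn : p n = 0
      · simp [hpn]
      · exact mul_le_of_le_one_right (hp n)
          (Real.exp_le_one_iff.2 (mul_nonpos_of_nonneg_of_nonpos ht (hside n hpn)))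
  have hle := ge_of_tendsto' hGlim hGlow
  by_cases hk : ∃ k : ℕ, (k : ℝ) = z
  · obtain ⟨k, rfl⟩ := hk
    simp only [Nat.cast_inj, tsum_ite_eq] at hle
    have hpk : 0 < p k := (Real.exp_pos _).trans_le hle
    refine ⟨k, rfl, hpk, ?_⟩
    rw [hv, EReal.coe_le_coe_iff]
    linarith [(Real.le_log_iff_exp_le hpk).2 hle]
  · push Not at hk
    simp only [hk, if_false, tsum_zero] at hle
    exact absurd hle (not_le.2 (Real.exp_pos _))

include hp hp1 hexp in
/-- If the Cramér rate at `z` is finite, it bounds `C + lam * z` for some probability vector with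
mean `z` whose density with respect to `p` is `exp (C + lam * n)` on its support. -/
lemma exists_tilt_of_cramerRate_ne_top {z : ℝ} (htop : cramerRate p z ≠ ⊤) :
    ∃ (r : ℕ → ℝ) (C lam : ℝ), (∀ n, 0 ≤ r n) ∧ HasSum r 1 ∧
      HasSum (fun n : ℕ => (n : ℝ) * r n) z ∧
      (∀ n : ℕ, r n ≠ 0 → p n ≠ 0 ∧ r n = p n * Real.exp (C + lam * n)) ∧
      ((C + lam * z : ℝ) : EReal) ≤ cramerRate p z := by
  by_cases hboth : (∃ m : ℕ, z < m ∧ 0 < p m) ∧ ∃ n : ℕ, (n : ℝ) < z ∧ 0 < p n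
  · obtain ⟨⟨m, hm, hpm⟩, n, hn, hpn⟩ := hboth
    obtain ⟨lam, hlam⟩ := exists_tsum_natCast_mul_mul_exp_eq hp hexp hm hpm hn hpn
    have hM := tsum_mul_exp_pos hp hp1 hexp lam
    have hle := le_cramerRate (p := p) lam z
    have hsum := (hexp lam).hasSum
    have hmean := (summable_natCast_mul_mul_exp hp hexp lam).hasSum
    rw [hlam] at hmean
    set M := ∑' k : ℕ, p k * Real.exp (lam * k)
    refine ⟨fun k => p k * Real.exp (lam * k) / M, -Real.log M, lam,
      fun k => div_nonneg (mul_nonneg (hp k) (Real.exp_pos _).le) hM.le, ?_, ?_, ?_, ?_⟩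
    · simpa [hM.ne'] using hsum.div_const M
    · simpa [hM.ne', mul_div_assoc] using hmean.div_const M
    · intro k hk
      refine ⟨fun h => hk (by simp [h]), ?_⟩
      rw [Real.exp_add, Real.exp_neg, Real.exp_log hM]
      field_simp
    · rwa [neg_add_eq_sub]
  · obtain ⟨s, hs, hside⟩ : ∃ s : ℝ, s ≠ 0 ∧ ∀ n : ℕ, p n ≠ 0 → s * (n - z) ≤ 0 := by
      rcases not_and_or.1 hboth with h | h <;> push Not at h
      · refine ⟨1, one_ne_zero, fun n hn => ?_⟩
        by_contra! hlt
        exact hn (le_antisymm (h n (by linarith)) (hp n))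
      · refine ⟨-1, by norm_num, fun n hn => ?_⟩
        by_contra! hlt
        exact hn (le_antisymm (h n (by linarith)) (hp n))
    obtain ⟨k, rfl, hpk, hle⟩ := exists_atom_of_one_sided hp hp1 hexp hs hside htop
    refine ⟨Pi.single k 1, -Real.log (p k), 0, fun n => ?_, hasSum_pi_single k 1, ?_, ?_, ?_⟩
    · by_cases hn : n = k <;> simp [hn]
    · convert hasSum_pi_single k (k : ℝ) using 2 with n
      by_cases hn : n = k <;> simp [hn]
    · intro n hn
      obtain rfl : n = k := by
        by_contra h
        simp [h] at hn
      refine ⟨hpk.ne', ?_⟩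
      simp [Real.exp_neg, Real.exp_log hpk, hpk.ne']
    · simpa using hle

end Cramer

omit [Fintype 𝒳] [DecidableEq 𝒳] in
lemma ne_zero_of_mem_of_prodLaw_ne_zero {p : ℕ → ℝ} {v : 𝒳 → ℝ} {c : List 𝒳}
    (h : prodLaw p v c ≠ 0) {a : 𝒳} (ha : a ∈ c) : v a ≠ 0 := by
  intro h0
  refine h ?_
  rw [prodLaw, List.prod_eq_zero (h0 ▸ List.mem_map_of_mem ha), mul_zero]

/-- On lists charged by both product weights, if `r n = p n * exp (C + lam * n)`, the ratio of
the two product laws is the exponential of an affine function of the multiplicities. -/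
lemma prodLaw_eq_mul_exp {r p : ℕ → ℝ} {w v : 𝒳 → ℝ} (hw : ∀ b, 0 ≤ w b) (hv : ∀ b, 0 ≤ v b)
    {C lam : ℝ} {c : List 𝒳} (hr : r c.length = p c.length * Real.exp (C + lam * c.length))
    (hc : ∀ a ∈ c, w a ≠ 0 ∧ v a ≠ 0) :
    prodLaw r w c = prodLaw p v c
      * Real.exp (C + ∑ b, (mult b c : ℝ) * (lam + Real.log (w b / v b))) := by
  have hsum : ∑ b, (mult b c : ℝ) * (lam + Real.log (w b / v b))
      = lam * c.length + ∑ b, (mult b c : ℝ) * Real.log (w b / v b) := by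
    simp only [mul_add, Finset.sum_add_distrib, ← Finset.sum_mul, ← Nat.cast_sum, sum_mult]
    ring
  rw [hsum, ← add_assoc, Real.exp_add, prodLaw, prodLaw, hr, prod_map_eq_mul_exp hw hv hc]
  ring

omit [Fintype 𝒳] in
lemma IsStarMeasure.eq_zero_of_mem {ν : List 𝒳 → ℝ} (hν : IsStarMeasure ν) {b : 𝒳}
    (hb : ∑' c : List 𝒳, (mult b c : ℝ) * ν c = 0) {c : List 𝒳} (hc : b ∈ c) : ν c = 0 := by
  have h := (hasSum_zero_iff_of_nonneg fun c =>
    mul_nonneg (Nat.cast_nonneg (mult b c)) (hν.nonneg c)).1 (hb ▸ (hν.summable_mult b).hasSum)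
  have h1 := congrFun h c
  simp only [Pi.zero_apply, mul_eq_zero, Nat.cast_eq_zero] at h1
  exact h1.resolve_left (List.count_pos_iff.2 hc).ne'

section Identity

variable {p : ℕ → ℝ} (hp : ∀ n, 0 ≤ p n) (hp1 : HasSum p 1)
  (hexp : ∀ lam : ℝ, Summable (fun n : ℕ => p n * Real.exp (lam * n)))
  {v : 𝒳 → ℝ} (hv : ∀ b, 0 ≤ v b) (hv1 : ∑ b, v b = 1)
  {w : 𝒳 → ℝ} (hw : ∀ b, 0 ≤ w b) (hw1 : ∑ b, w b = 1) {z : ℝ}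

omit [DecidableEq 𝒳] in
lemma affine_value (hw1 : ∑ b, w b = 1) (C lam : ℝ) :
    C + ∑ b, z * w b * (lam + Real.log (w b / v b))
      = C + lam * z + z * ∑ b, w b * Real.log (w b / v b) := by
  simp only [mul_add, Finset.sum_add_distrib, ← Finset.sum_mul, mul_assoc, ← Finset.mul_sum, hw1]
  ring

include hp hp1 hexp hv hv1 hw hw1 in
lemma ofReal_le_Itilde (lam : ℝ) :
    ENNReal.ofReal (lam * z - Real.log (∑' n : ℕ, p n * Real.exp (lam * n))
      + z * ∑ b, w b * Real.log (w b / v b)) ≤ Itilde (fun b => z * w b) (prodLaw p v) := by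
  refine le_iInf fun ⟨ν, hν, hφ⟩ => ?_
  have hM := tsum_mul_exp_pos hp hp1 hexp lam
  have hsum := (hexp lam).hasSum
  set M := ∑' n : ℕ, p n * Real.exp (lam * n)
  set r : ℕ → ℝ := fun n => p n * Real.exp (-Real.log M + lam * n) with hr
  have hr0 : ∀ n, 0 ≤ r n := fun n => mul_nonneg (hp n) (Real.exp_pos _).le
  have hr1 : HasSum r 1 := by
    have h := hsum.div_const M
    rw [div_self hM.ne'] at h
    refine h.congr_fun fun n => ?_
    simp only [hr, Real.exp_add, Real.exp_neg, Real.exp_log hM]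
    field_simp
  have hval := hν.hasSum_mul_affine hφ (-Real.log M) (fun b => lam + Real.log (w b / v b))
  rw [affine_value hw1, neg_add_eq_sub] at hval
  refine ofReal_le_relEnt hν.nonneg (prodLaw_nonneg hr0 hw) ?_
    (hasSum_prodLaw hp hv hv1 hp1) (hasSum_prodLaw hr0 hw hw1 hr1) hval
  intro c hνc hqc
  refine prodLaw_eq_mul_exp hw hv rfl fun a ha =>
    ⟨fun h0 => hνc (hν.eq_zero_of_mem ?_ ha), ne_zero_of_mem_of_prodLaw_ne_zero hqc ha⟩
  simp only [← hφ a, h0, mul_zero]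

include hp hp1 hv hv1 hw hw1 in
lemma Itilde_le_ofReal (hac : ∀ b, v b = 0 → w b = 0) {r : ℕ → ℝ} (hr : ∀ n, 0 ≤ r n)
    (hr1 : HasSum r 1) (hrz : HasSum (fun n : ℕ => (n : ℝ) * r n) z) {C lam : ℝ}
    (hrp : ∀ n : ℕ, r n ≠ 0 → p n ≠ 0 ∧ r n = p n * Real.exp (C + lam * n)) :
    0 ≤ C + lam * z + z * ∑ b, w b * Real.log (w b / v b) ∧
    Itilde (fun b => z * w b) (prodLaw p v)
      ≤ ENNReal.ofReal (C + lam * z + z * ∑ b, w b * Real.log (w b / v b)) := by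
  have hν := isStarMeasure_prodLaw hr hr1 hrz.summable hw hw1
  have hφ : ∀ b, z * w b = ∑' c : List 𝒳, (mult b c : ℝ) * prodLaw r w c := fun b =>
    (hasSum_mult_mul_prodLaw hr hw hw1 hrz b).tsum_eq.symm
  have hval := hν.hasSum_mul_affine hφ C (fun b => lam + Real.log (w b / v b))
  rw [affine_value hw1] at hval
  have h := relEnt_eq_ofReal hν.nonneg (prodLaw_nonneg hp hv) (fun c hc => ?_) hν.hasSum
    (hasSum_prodLaw hp hv hv1 hp1) hval
  · exact ⟨h.1, (iInf_le _ ⟨prodLaw r w, hν, hφ⟩).trans h.2.le⟩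
  · obtain ⟨hpc, hrc⟩ := hrp c.length (left_ne_zero_of_mul hc)
    have hletters : ∀ a ∈ c, w a ≠ 0 ∧ v a ≠ 0 := fun a ha =>
      have hwa := ne_zero_of_mem_of_prodLaw_ne_zero hc ha
      ⟨hwa, fun h0 => hwa (hac a h0)⟩
    have he := prodLaw_eq_mul_exp hw hv hrc hletters
    exact ⟨left_ne_zero_of_mul (he ▸ hc), he⟩

omit [Fintype 𝒳] in
lemma Itilde_eq_top {φ : 𝒳 → ℝ} {b : 𝒳} (hvb : v b = 0) (hφb : φ b ≠ 0) :
    Itilde φ (prodLaw p v) = ⊤ := by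
  refine iInf_eq_top.2 fun ⟨ν, hν, hφ⟩ => if_neg fun hac => hφb ?_
  replace hac : ∀ c, prodLaw p v c = 0 → ν c = 0 := hac
  rw [hφ b]
  refine (tsum_congr fun c => ?_).trans tsum_zero
  by_cases hb : b ∈ c
  · rw [hac c (by_contra fun h => ne_zero_of_mem_of_prodLaw_ne_zero h hb hvb), mul_zero]
  · simp [mult, List.count_eq_zero_of_not_mem hb]

omit [DecidableEq 𝒳] in
include hv hv1 hw hw1 in
lemma relEnt_eq_ofReal_sum (hac : ∀ b, v b = 0 → w b = 0) :
    0 ≤ ∑ b, w b * Real.log (w b / v b) ∧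
      relEnt w v = ENNReal.ofReal (∑ b, w b * Real.log (w b / v b)) := by
  refine relEnt_eq_ofReal hw hv (h := fun b => Real.log (w b / v b)) (fun b hb => ?_)
    (hw1 ▸ hasSum_fintype w) (hv1 ▸ hasSum_fintype v) (hasSum_fintype _)
  have hvb : v b ≠ 0 := fun h => hb (hac b h)
  refine ⟨hvb, ?_⟩
  rw [Real.exp_log (div_pos ((hw b).lt_of_ne' hb) ((hv b).lt_of_ne' hvb))]
  field_simp

include hp hp1 hexp hv hv1 hw hw1 in
lemma Itilde_eq_of_absolutelyContinuous (hac : ∀ b, v b = 0 → w b = 0) :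
    (Itilde (fun b => z * w b) (prodLaw p v) : EReal)
      = (z : EReal) * ((relEnt w v : ℝ≥0∞) : EReal) + cramerRate p z := by
  obtain ⟨hK, hrel⟩ := relEnt_eq_ofReal_sum hv hv1 hw hw1 hac
  have hlow := ofReal_le_Itilde (z := z) hp hp1 hexp hv hv1 hw hw1
  have hup := @Itilde_le_ofReal _ _ _ _ hp hp1 _ hv hv1 _ hw hw1 z hac
  set K := ∑ b, w b * Real.log (w b / v b)
  rw [hrel, EReal.coe_ennreal_ofReal, max_eq_left hK, ← EReal.coe_mul]
  refine le_antisymm ?_ ?_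
  · by_cases htop : cramerRate p z = ⊤
    · rw [htop, EReal.coe_add_top]
      exact le_top
    · obtain ⟨r, C, lam, hr, hr1, hrz, hrp, hle⟩ :=
        exists_tilt_of_cramerRate_ne_top hp hp1 hexp htop
      obtain ⟨h0, h1⟩ := hup hr hr1 hrz hrp
      calc (Itilde (fun b => z * w b) (prodLaw p v) : EReal)
          ≤ ((ENNReal.ofReal (C + lam * z + z * K) : ℝ≥0∞) : EReal) :=
            EReal.coe_ennreal_le_coe_ennreal_iff.2 h1
        _ = ((z * K : ℝ) : EReal) + ((C + lam * z : ℝ) : EReal) := by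
            rw [EReal.coe_ennreal_ofReal, max_eq_left h0, ← EReal.coe_add, add_comm]
        _ ≤ _ := add_le_add le_rfl hle
  · rw [add_comm]
    refine EReal.add_le_of_le_sub (iSup_le fun lam => ?_)
    rw [EReal.le_sub_iff_add_le (Or.inl (EReal.coe_ne_bot _)) (Or.inl (EReal.coe_ne_top _)),
      ← EReal.coe_add]
    calc _ ≤ ((ENNReal.ofReal _ : ℝ≥0∞) : EReal) := by
            rw [EReal.coe_ennreal_ofReal, EReal.coe_le_coe_iff]
            exact le_max_left _ _
      _ ≤ _ := EReal.coe_ennreal_le_coe_ennreal_iff.2 (hlow lam)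

end Identity

theorem one_type_constrained_entropy_identity
    (p : ℕ → ℝ) (hp_nonneg : ∀ n, 0 ≤ p n) (hp_sum : HasSum p 1)
    (hp_mean : HasSum (fun n : ℕ => (n : ℝ) * p n) 1)
    (hp_exp : ∀ lam : ℝ, Summable (fun n : ℕ => p n * Real.exp (lam * n)))
    (qhat : 𝒳 → ℝ) (hq_nonneg : ∀ b, 0 ≤ qhat b) (hq_sum : ∑ b, qhat b = 1)
    (φ : 𝒳 → ℝ) (hφ : ∀ b, 0 ≤ φ b) (z : ℝ) (hz : z = ∑ b, φ b) :
    (Itilde φ (prodLaw p qhat) : EReal)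
      = ((z : ℝ) : EReal) * ((relEnt (fun b => φ b / z) qhat : ℝ≥0∞) : EReal)
        + cramerRate p z := by
  rcases eq_or_ne z 0 with rfl | hz0
  · have hφ0 : φ = fun b => (0 : ℝ) * qhat b := by
      funext b
      rw [zero_mul]
      exact (Finset.sum_eq_zero_iff_of_nonneg fun b _ => hφ b).1 hz.symm b (Finset.mem_univ b)
    rw [hφ0, Itilde_eq_of_absolutelyContinuous hp_nonneg hp_sum hp_exp hq_nonneg hq_sum hq_nonneg
      hq_sum fun _ h => h]
    simp
  · have hzpos : 0 < z := (hz ▸ Finset.sum_nonneg fun b _ => hφ b : 0 ≤ z).lt_of_ne' hz0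
    by_cases hac : ∀ b, qhat b = 0 → φ b / z = 0
    · have hφz : φ = fun b => z * (φ b / z) := by
        funext b
        field_simp
      have hw1 : ∑ b, φ b / z = 1 := by rw [← Finset.sum_div, ← hz, div_self hz0]
      have h := Itilde_eq_of_absolutelyContinuous (z := z) hp_nonneg hp_sum hp_exp hq_nonneg hq_sum
        (fun b => div_nonneg (hφ b) hzpos.le) hw1 hac
      rwa [← hφz] at h
    · have hrel : relEnt (fun b => φ b / z) qhat = ⊤ := if_neg hac
      push Not at hac
      obtain ⟨b, hqb, hφb⟩ := hac
      have hbot : cramerRate p z ≠ ⊥ := fun h =>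
        EReal.coe_ne_bot _ (le_bot_iff.1 (h ▸ le_cramerRate (p := p) 0 z))
      rw [Itilde_eq_top hqb fun h => hφb (by rw [h, zero_div]), hrel, EReal.coe_ennreal_top,
        EReal.coe_mul_top_of_pos hzpos, EReal.top_add_of_ne_bot hbot]

end Statement15
end
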